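/- Let T be a combinatorially two-orbit LFC tiling of ℝ^d, d ≥ 1. Then d = 2 or d = 3. -/

import Mathlib

/-! Generic definitions about flags, flag orbits, and abstract polytopes. -/

variable {α : Type*} [PartialOrder α]

/-- Two flags (maximal chains) are in the same orbit of the automorphism group
(the group of order automorphisms) if some order automorphism maps one onto the other. -/
def SameFlagOrbit (Φ Ψ : Flag α) : Prop :=
  ∃ γ : α ≃o α, γ '' (Φ : Set α) = (Ψ : Set α)

/-- The automorphism group has exactly two orbits on the flags. -/
def TwoFlagOrbits (α : Type*) [PartialOrder α] : Prop :=
  ∃ Φ Ψ : Flag α, ¬ SameFlagOrbit Φ Ψ ∧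
    ∀ Ω : Flag α, SameFlagOrbit Ω Φ ∨ SameFlagOrbit Ω Ψ

/-- `Ψ` is the flag `Φ^i`: it differs from `Φ` in exactly the rank-`i` element
(with respect to the rank function `rk`). -/
def IsIAdjacent (rk : α → ℤ) (i : ℤ) (Φ Ψ : Flag α) : Prop :=
  Φ ≠ Ψ ∧ ∀ x : α, rk x ≠ i → (x ∈ Φ ↔ x ∈ Ψ)

/-- A two-orbit polytope (with rank function `rk`, adjacency indices `0, …, n-1`)
is in class `2_I` if, for every flag `Φ` and every `i < n`, the `i`-adjacent flag `Φ^i`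
lies in the same orbit as `Φ` exactly when `i ∈ I`. -/
def InClass (rk : α → ℤ) (n : ℕ) (I : Set ℕ) : Prop :=
  TwoFlagOrbits α ∧
    ∀ (Φ Ψ : Flag α) (i : ℕ), i < n → IsIAdjacent rk i Φ Ψ →
      (SameFlagOrbit Φ Ψ ↔ i ∈ I)

/-- An abstract polytope of rank `d`: a bounded poset, graded by a rank function `rk`
taking values `-1, 0, …, d`, in which every flag (maximal chain) has exactly one element
of each rank, satisfying the diamond condition and strong flag-connectivity. -/
structure IsAbstractPolytope (α : Type*) [PartialOrder α] [BoundedOrder α]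
    (rk : α → ℤ) (d : ℕ) : Prop where
  rk_bot : rk ⊥ = -1
  rk_top : rk ⊤ = d
  rk_strictMono : StrictMono rk
  rk_cover : ∀ x y : α, x ⋖ y → rk y = rk x + 1
  flag_ranks : ∀ (Φ : Flag α) (i : ℤ), -1 ≤ i → i ≤ d → ∃! x, x ∈ Φ ∧ rk x = i
  diamond : ∀ x y : α, x < y → rk y = rk x + 2 →
    ∃ a b : α, a ≠ b ∧ ∀ z : α, (x < z ∧ z < y) ↔ (z = a ∨ z = b)
  connected : ∀ Φ Ψ : Flag α, ∃ (n : ℕ) (c : Fin (n + 1) → Flag α),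
    c 0 = Φ ∧ c (Fin.last n) = Ψ ∧
    (∀ k : Fin n, ∃ i : ℤ, IsIAdjacent rk i (c k.castSucc) (c k.succ)) ∧
    (∀ k, (Φ : Set α) ∩ (Ψ : Set α) ⊆ (c k : Set α))
/-! Definitions about convex polytopes and their face lattices. -/

/-- Euclidean `d`-space. -/
abbrev EucSp (d : ℕ) : Type := EuclideanSpace ℝ (Fin d)

/-- A convex `d`-polytope: the convex hull of a finite set of points of `ℝ^d`,
with nonempty interior. -/
def IsConvexPolytope {d : ℕ} (P : Set (EucSp d)) : Prop :=
  (∃ S : Finset (EucSp d), P = convexHull ℝ (S : Set (EucSp d))) ∧ (interior P).Nonempty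

/-- The face lattice of `P`: the exposed faces of `P` (intersections of `P` with supporting
hyperplanes, together with `∅` and `P` itself), ordered by inclusion. -/
def Faces {d : ℕ} (P : Set (EucSp d)) : Type := {F : Set (EucSp d) // IsExposed ℝ P F}

noncomputable instance {d : ℕ} (P : Set (EucSp d)) : PartialOrder (Faces P) :=
  Subtype.partialOrder _

open scoped Classical

/-- The rank of a face: `-1` for the empty face, and otherwise its affine dimension. -/
noncomputable def faceRank {d : ℕ} {P : Set (EucSp d)} (F : Faces P) : ℤ :=
  if F.1 = ∅ then -1
  else (Module.finrank ℝ (affineSpan ℝ F.1).direction : ℤ)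
/-! Definitions about locally finite face-to-face tilings of Euclidean space by convex
polytopes (LFC tilings) and their face posets. -/

/-- An LFC tiling of `ℝ^d`: a face-to-face, locally finite tiling of `ℝ^d` by convex
`d`-polytopes. -/
structure IsLFCTiling {d : ℕ} (T : Set (Set (EucSp d))) : Prop where
  /-- Every tile is a convex `d`-polytope. -/
  polytope : ∀ t ∈ T, IsConvexPolytope t
  /-- The tiles cover all of `ℝ^d`. -/
  covers : ⋃₀ T = Set.univ
  /-- The tiling is face-to-face: the intersection of any two tiles is a
  (possibly empty) face of each. -/
  face_to_face : ∀ t ∈ T, ∀ s ∈ T, IsExposed ℝ t (t ∩ s) ∧ IsExposed ℝ s (t ∩ s)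
  /-- The tiling is locally finite: every bounded set meets only finitely many tiles. -/
  locally_finite : ∀ B : Set (EucSp d), Bornology.IsBounded B →
    {t ∈ T | (t ∩ B).Nonempty}.Finite

/-- The faces of the tiling `T`: all faces of all tiles (the empty face included). -/
def TFace {d : ℕ} (T : Set (Set (EucSp d))) : Type :=
  {F : Set (EucSp d) // ∃ t ∈ T, IsExposed ℝ t F}

noncomputable instance {d : ℕ} (T : Set (Set (EucSp d))) : PartialOrder (TFace T) :=
  Subtype.partialOrder _

/-- The face poset of the tiling `T`: all faces of all tiles, together with a greatest
element, ordered by inclusion.  It is an abstract polytope of rank `d + 1`. -/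
abbrev TPoset {d : ℕ} (T : Set (Set (EucSp d))) : Type := WithTop (TFace T)

/-- The rank of a subset of `ℝ^d` regarded as a face: `-1` for the empty face, and
otherwise its affine dimension. -/
noncomputable def setRank {d : ℕ} (F : Set (EucSp d)) : ℤ :=
  if F = ∅ then -1 else (Module.finrank ℝ (affineSpan ℝ F).direction : ℤ)

/-- The rank function of the face poset of a tiling of `ℝ^d`: faces get their affine
dimension (`-1` for the empty face), and the greatest element gets rank `d + 1`. -/
noncomputable def tileRank {d : ℕ} (T : Set (Set (EucSp d))) : TPoset T → ℤ :=
  WithTop.recTopCoe ((d : ℤ) + 1) (fun F => setRank F.1)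

/-- A tiling is normal if its tiles are uniformly bounded: for some `u, U > 0`, every tile
contains a ball of radius `u` and is contained in a ball of radius `U`. -/
def IsNormalTiling {d : ℕ} (T : Set (Set (EucSp d))) : Prop :=
  ∃ u U : ℝ, 0 < u ∧ 0 < U ∧ ∀ t ∈ T,
    (∃ x, Metric.closedBall x u ⊆ t) ∧ (∃ x, t ⊆ Metric.closedBall x U)

/-! Triangulations of Euclidean space. -/

/-- A locally finite (vertex-coloured) triangulation of Euclidean space. -/
structure Tri (d : ℕ) (N : Type) where
  b : N → EucSp d
  S : Set (Finset N)
  ne : ∀ C ∈ S, C.Nonempty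
  down : ∀ C ∈ S, ∀ D, D ⊆ C → D.Nonempty → D ∈ S
  ex : ∀ x : EucSp d, ∃ C ∈ S, ∃ w : N → ℝ, (∀ v ∈ C, 0 < w v) ∧ ∑ v ∈ C, w v = 1 ∧
    ∑ v ∈ C, w v • b v = x
  uniq : ∀ C ∈ S, ∀ D ∈ S, ∀ w w' : N → ℝ, (∀ v ∈ C, 0 < w v) → ∑ v ∈ C, w v = 1 →
    (∀ v ∈ D, 0 < w' v) → ∑ v ∈ D, w' v = 1 → ∑ v ∈ C, w v • b v = ∑ v ∈ D, w' v • b v →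
    C = D ∧ ∀ v ∈ C, w v = w' v
  lf : ∀ R : ℝ, {C ∈ S | ∃ x ∈ convexHull ℝ (b '' (C : Set N)), ‖x‖ ≤ R}.Finite
  rk : N → Fin (d + 1)
  rk_inj : ∀ C ∈ S, Set.InjOn rk (C : Set N)
  dpos : 0 < d

namespace Tri

variable {d : ℕ} {N : Type} (K : Tri d N)

/-- The carrier of a point. -/
noncomputable def car (x : EucSp d) : Finset N := (K.ex x).choose

lemma car_mem (x : EucSp d) : K.car x ∈ K.S := (K.ex x).choose_spec.1

lemma car_rep (x : EucSp d) : ∃ w : N → ℝ, (∀ v ∈ K.car x, 0 < w v) ∧ ∑ v ∈ K.car x, w v = 1 ∧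
    ∑ v ∈ K.car x, w v • K.b v = x := (K.ex x).choose_spec.2

lemma car_eq {x : EucSp d} {C : Finset N} (hC : C ∈ K.S) (w : N → ℝ) (h1 : ∀ v ∈ C, 0 < w v)
    (h2 : ∑ v ∈ C, w v = 1) (h3 : ∑ v ∈ C, w v • K.b v = x) : K.car x = C := by
  obtain ⟨w', a1, a2, a3⟩ := K.car_rep x
  exact (K.uniq _ (K.car_mem x) _ hC w' w a1 a2 h1 h2 (a3.trans h3.symm)).1

/-- nonnegative weights: the carrier is the support. -/
lemma car_eq_filter {x : EucSp d} {C : Finset N} (hC : C ∈ K.S) (w : N → ℝ)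
    (h1 : ∀ v ∈ C, 0 ≤ w v)
    (h2 : ∑ v ∈ C, w v = 1) (h3 : ∑ v ∈ C, w v • K.b v = x) :
    K.car x = C.filter (fun v => 0 < w v) := by
  have key : ∀ v ∈ C, v ∉ C.filter (fun v => 0 < w v) → w v = 0 := by
    intro v hv hv'
    simp only [Finset.mem_filter, not_and, not_lt] at hv'
    exact le_antisymm (hv' hv) (h1 v hv)
  have hs : ∑ v ∈ C.filter (fun v => 0 < w v), w v = 1 := by
    rw [← h2]
    exact Finset.sum_subset (Finset.filter_subset _ _) key
  have hs3 : ∑ v ∈ C.filter (fun v => 0 < w v), w v • K.b v = x := by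
    rw [← h3]
    refine Finset.sum_subset (Finset.filter_subset _ _) ?_
    intro v hv hv'
    rw [key v hv hv', zero_smul]
  refine K.car_eq (K.down C hC _ (Finset.filter_subset _ _) ?_) w ?_ hs hs3
  · by_contra hne
    rw [Finset.not_nonempty_iff_eq_empty] at hne
    rw [hne] at hs
    simp at hs
  · intro v hv
    exact (Finset.mem_filter.1 hv).2

lemma hull_iff' {C : Finset N} {x : EucSp d} :
    x ∈ convexHull ℝ (K.b '' (C : Set N)) ↔
    ∃ w : N → ℝ, (∀ v ∈ C, 0 ≤ w v) ∧ ∑ v ∈ C, w v = 1 ∧ ∑ v ∈ C, w v • K.b v = x := by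
  constructor
  · intro hx
    have hconv : Convex ℝ {x | ∃ w : N → ℝ, (∀ v ∈ C, 0 ≤ w v) ∧ ∑ v ∈ C, w v = 1 ∧
        ∑ v ∈ C, w v • K.b v = x} := by
      rintro x ⟨w, h1, h2, rfl⟩ y ⟨w', h1', h2', rfl⟩ a c ha hc hac
      refine ⟨fun v => a * w v + c * w' v, ?_, ?_, ?_⟩
      · intro v hv
        have := h1 v hv
        have := h1' v hv
        positivity
      · rw [Finset.sum_add_distrib, ← Finset.mul_sum, ← Finset.mul_sum, h2, h2']
        linarith
      · simp only [add_smul, mul_smul, Finset.sum_add_distrib, Finset.smul_sum]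
    refine convexHull_min ?_ hconv hx
    rintro _ ⟨v, hv, rfl⟩
    refine ⟨fun u => if u = v then 1 else 0, ?_, ?_, ?_⟩
    · intro u _
      dsimp only
      split_ifs <;> norm_num
    · have hv' : v ∈ C := hv
      simp [hv']
    · have hv' : v ∈ C := hv
      simp [hv']
  · rintro ⟨w, h1, h2, rfl⟩
    refine Convex.sum_mem (convex_convexHull ℝ _) h1 h2 ?_
    intro v hv
    exact subset_convexHull ℝ _ ⟨v, hv, rfl⟩

lemma mem_hull {C : Finset N} (hC : C ∈ K.S) {x : EucSp d} :
    x ∈ convexHull ℝ (K.b '' (C : Set N)) ↔ K.car x ⊆ C := by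
  rw [hull_iff']
  constructor
  · rintro ⟨w, h1, h2, h3⟩
    rw [K.car_eq_filter hC w h1 h2 h3]
    exact Finset.filter_subset _ _
  · intro h
    obtain ⟨w, h1, h2, h3⟩ := K.car_rep x
    refine ⟨fun v => if v ∈ K.car x then w v else 0, ?_, ?_, ?_⟩
    · intro v _
      dsimp only
      split_ifs with hv
      · exact (h1 v hv).le
      · exact le_rfl
    · rw [← h2, ← Finset.sum_subset h]
      · exact Finset.sum_congr rfl fun v hv => by simp [hv]
      · intro v _ hv
        simp [hv]
    · refine Eq.trans ?_ h3
      rw [← Finset.sum_subset h]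
      · exact Finset.sum_congr rfl fun v hv => by simp [hv]
      · intro v _ hv
        simp [hv]

lemma star (x : EucSp d) : ∃ ε > 0, ∀ y, dist y x < ε → K.car x ⊆ K.car y := by
  set A : Set (Finset N) := {C ∈ K.S | ∃ y ∈ convexHull ℝ (K.b '' (C : Set N)), ‖y‖ ≤ ‖x‖ + 1}
    with hA
  have hAf : A.Finite := K.lf _
  set A' : Set (Finset N) := {C ∈ A | x ∉ convexHull ℝ (K.b '' (C : Set N))} with hA'
  have hA'f : A'.Finite := hAf.subset (fun C h => h.1)
  have hcl : IsClosed (⋃ C ∈ A', convexHull ℝ (K.b '' (C : Set N))) := by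
    refine hA'f.isClosed_biUnion ?_
    intro C _
    exact ((C.finite_toSet.image K.b).isCompact_convexHull ℝ).isClosed
  have hx : x ∈ (⋃ C ∈ A', convexHull ℝ (K.b '' (C : Set N)))ᶜ := by
    simp only [Set.mem_compl_iff, Set.mem_iUnion, not_exists]
    intro C hC
    exact hC.2
  obtain ⟨ε, hε, hb⟩ := Metric.isOpen_iff.1 hcl.isOpen_compl x hx
  refine ⟨min ε 1, by positivity, ?_⟩
  intro y hy
  have hyε : y ∈ Metric.ball x ε := lt_of_lt_of_le hy (min_le_left _ _)
  have hy1 : dist y x < 1 := lt_of_lt_of_le hy (min_le_right _ _)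
  have hyh : y ∈ convexHull ℝ (K.b '' (K.car y : Set N)) :=
    (K.mem_hull (K.car_mem y)).2 subset_rfl
  have hyn : ‖y‖ ≤ ‖x‖ + 1 := by
    rw [dist_eq_norm] at hy1
    have := norm_le_norm_add_norm_sub' y x
    linarith
  by_contra hcon
  have : y ∉ (⋃ C ∈ A', convexHull ℝ (K.b '' (C : Set N))) := hb hyε
  apply this
  simp only [Set.mem_iUnion]
  refine ⟨K.car y, ⟨⟨K.car_mem y, y, hyh, hyn⟩, ?_⟩, hyh⟩
  rw [K.mem_hull (K.car_mem y)]
  exact hcon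

/-- barycenter of a simplex -/
noncomputable def bary (C : Finset N) : EucSp d := ∑ v ∈ C, ((C.card : ℝ)⁻¹) • K.b v

lemma bary_w {C : Finset N} (hC : C.Nonempty) : ∑ _v ∈ C, ((C.card : ℝ)⁻¹) = 1 := by
  have : (C.card : ℝ) ≠ 0 := by
    have := hC.card_pos
    positivity
  rw [Finset.sum_const, nsmul_eq_mul]
  exact mul_inv_cancel₀ this

lemma card_inv_pos {C : Finset N} (hC : C.Nonempty) : 0 < ((C.card : ℝ)⁻¹) := by
  have := hC.card_pos
  positivity

lemma car_bary {C : Finset N} (hC : C ∈ K.S) : K.car (K.bary C) = C :=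
  K.car_eq hC (fun _ => (C.card : ℝ)⁻¹) (fun _ _ => card_inv_pos (K.ne C hC))
    (bary_w (K.ne C hC)) rfl

lemma affInd {C : Finset N} (hC : C ∈ K.S) : AffineIndependent ℝ (fun v : C => K.b v) := by
  rw [affineIndependent_iff_of_fintype]
  intro w hw0 hw v
  rw [Finset.univ.weightedVSub_eq_weightedVSubOfPoint_of_sum_eq_zero w _ hw0 (0 : EucSp d),
    Finset.weightedVSubOfPoint_apply] at hw
  simp only [vsub_eq_sub, sub_zero] at hw
  set M : ℝ := ∑ u, |w u| with hM
  have hMb : ∀ u, |w u| ≤ M := fun u =>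
    Finset.single_le_sum (f := fun u => |w u|) (fun i _ => abs_nonneg _) (Finset.mem_univ u)
  have hM0 : 0 ≤ M := Finset.sum_nonneg fun i _ => abs_nonneg _
  set κ : ℝ := (C.card : ℝ)⁻¹ with hκ
  have hκp : 0 < κ := card_inv_pos (K.ne C hC)
  set ε : ℝ := κ / (M + 1) with hε
  have hεp : 0 < ε := by positivity
  set W : N → ℝ := fun u => if h : u ∈ C then w ⟨u, h⟩ else 0 with hW
  have hWs : ∑ u ∈ C, W u = 0 := by
    rw [← Finset.sum_coe_sort C W, ← hw0]
    exact Finset.sum_congr rfl fun u _ => by simp [hW]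
  have hWv : ∑ u ∈ C, W u • K.b u = 0 := by
    rw [← Finset.sum_coe_sort C (fun u => W u • K.b u), ← hw]
    exact Finset.sum_congr rfl fun u _ => by simp [hW]
  have hpos : ∀ u ∈ C, 0 < κ + ε * W u := by
    intro u hu
    have h1 : |W u| ≤ M := by
      simp only [hW, hu, dif_pos]
      exact hMb _
    have h2 : ε * |W u| ≤ ε * M := by gcongr
    have h3 : ε * (M + 1) = κ := by
      rw [hε]
      field_simp
    have h4 : -(ε * |W u|) ≤ ε * W u := by
      have := neg_abs_le (W u)
      nlinarith
    nlinarith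
  have := K.uniq C hC C hC (fun _ => κ) (fun u => κ + ε * W u) (fun _ _ => hκp)
    (bary_w (K.ne C hC)) hpos (by
      rw [Finset.sum_add_distrib, ← Finset.mul_sum, hWs, mul_zero, add_zero]
      exact bary_w (K.ne C hC)) (by
      simp only [add_smul, mul_smul, Finset.sum_add_distrib]
      rw [← Finset.smul_sum, ← Finset.smul_sum, hWv, smul_zero, add_zero, Finset.smul_sum])
  have h := this.2 v v.2
  have : ε * W v = 0 := by linarith
  rcases mul_eq_zero.1 this with h | h
  · exact absurd h hεp.ne'
  · simpa [hW] using h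

lemma card_le {C : Finset N} (hC : C ∈ K.S) : C.card ≤ d + 1 := by
  have := (K.affInd hC).card_le_finrank_succ
  have h2 := Submodule.finrank_le (vectorSpan ℝ (Set.range fun v : C => K.b v))
  simp only [Fintype.card_coe] at this
  rw [finrank_euclideanSpace_fin] at h2
  omega

/-- small sets do not span -/
lemma span_ne_top (A : Finset (EucSp d)) (hA : A.card ≤ d) :
    affineSpan ℝ (A : Set (EucSp d)) ≠ ⊤ := by
  intro h
  have hd := congrArg AffineSubspace.direction h
  rw [direction_affineSpan, AffineSubspace.direction_top] at hd
  rcases Nat.eq_zero_or_pos A.card with h0 | h0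
  · rw [Finset.card_eq_zero] at h0
    subst h0
    simp at h
  have h1 : Module.finrank ℝ (vectorSpan ℝ (A : Set (EucSp d))) ≤ A.card - 1 := by
    have := finrank_vectorSpan_image_finset_le ℝ (id : EucSp d → EucSp d) A (n := A.card - 1)
      (by omega)
    have e : ((Finset.image (id : EucSp d → EucSp d) A : Finset (EucSp d)) : Set (EucSp d)) = A := by
      ext z
      simp
    rwa [e] at this
  rw [hd, finrank_top, finrank_euclideanSpace_fin] at h1
  omega

lemma exists_facet {C : Finset N} (hC : C ∈ K.S) : ∃ D ∈ K.S, C ⊆ D ∧ D.card = d + 1 := by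
  obtain ⟨D, ⟨hD, hCD⟩, hmax⟩ : ∃ D, (D ∈ K.S ∧ C ⊆ D) ∧ ∀ E, E ∈ K.S ∧ C ⊆ E →
      E.card ≤ D.card := by
    by_contra hcon
    push Not at hcon
    have : ∀ n : ℕ, ∃ D, (D ∈ K.S ∧ C ⊆ D) ∧ n ≤ D.card := by
      intro n
      induction n with
      | zero => exact ⟨C, ⟨hC, subset_rfl⟩, Nat.zero_le _⟩
      | succ n ih =>
        obtain ⟨D, hD, hn⟩ := ih
        obtain ⟨E, hE, hE2⟩ := hcon D hD
        exact ⟨E, hE, by omega⟩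
    obtain ⟨D, hD, h⟩ := this (d + 2)
    have := K.card_le hD.1
    omega
  refine ⟨D, hD, hCD, le_antisymm (K.card_le hD) ?_⟩
  by_contra hlt
  obtain ⟨ε, hε, hs⟩ := K.star (K.bary D)
  have hball : Metric.ball (K.bary D) ε ⊆ affineSpan ℝ (K.b '' (D : Set N)) := by
    intro y hy
    have h1 := hs y hy
    rw [K.car_bary hD] at h1
    have h2 := hmax (K.car y) ⟨K.car_mem y, hCD.trans h1⟩
    have h3 : K.car y = D := (Finset.eq_of_subset_of_card_le h1 h2).symm
    exact convexHull_subset_affineSpan _ ((K.mem_hull hD).2 h3.subset)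
  have htop : affineSpan ℝ (K.b '' (D : Set N)) = ⊤ := by
    have := affineSpan_mono ℝ hball
    rw [AffineSubspace.affineSpan_coe] at this
    rw [Metric.isOpen_ball.affineSpan_eq_top ⟨_, Metric.mem_ball_self hε⟩] at this
    exact top_le_iff.1 this
  refine span_ne_top (D.image K.b) (Finset.card_image_le.trans (by omega)) ?_
  rw [Finset.coe_image]
  exact htop

end Tri


namespace Tri

variable {d : ℕ} {N : Type} (K : Tri d N)

lemma rep_uniq {C : Finset N} (hC : C ∈ K.S) (w w' : N → ℝ)
    (h1 : ∑ v ∈ C, w v = ∑ v ∈ C, w' v)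
    (h2 : ∑ v ∈ C, w v • K.b v = ∑ v ∈ C, w' v • K.b v) : ∀ v ∈ C, w v = w' v := by
  have h := K.affInd hC
  rw [affineIndependent_iff] at h
  intro v hv
  have := h Finset.univ (fun u => w u - w' u) (by
    rw [Finset.sum_coe_sort C (fun u => w u - w' u), Finset.sum_sub_distrib, h1, sub_self]) (by
    rw [Finset.sum_coe_sort C (fun u => (w u - w' u) • K.b u)]
    simp only [sub_smul, Finset.sum_sub_distrib, h2, sub_self]) ⟨v, hv⟩ (Finset.mem_univ _)
  simpa [sub_eq_zero] using this

lemma rep_ex {C : Finset N} (hC : C ∈ K.S) (hc : C.card = d + 1) (y : EucSp d) :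
    ∃ w : N → ℝ, ∑ v ∈ C, w v = 1 ∧ ∑ v ∈ C, w v • K.b v = y := by
  have h := K.affInd hC
  have htop : affineSpan ℝ (Set.range (fun v : C => K.b v)) = ⊤ := by
    rw [h.affineSpan_eq_top_iff_card_eq_finrank_add_one]
    simp [hc]
  obtain ⟨w, hw, e⟩ := eq_affineCombination_of_mem_affineSpan_of_fintype (k := ℝ)
    (p := fun v : C => K.b v) (p1 := y) (by rw [htop]; trivial)
  rw [Finset.affineCombination_eq_linear_combination _ _ _ hw] at e
  refine ⟨fun u => if h : u ∈ C then w ⟨u, h⟩ else 0, ?_, ?_⟩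
  · rw [← Finset.sum_coe_sort C, ← hw]
    exact Finset.sum_congr rfl fun u _ => by simp
  · rw [← Finset.sum_coe_sort C, e]
    exact Finset.sum_congr rfl fun u _ => by simp

lemma neg_coeff {C : Finset N} (hne : C.Nonempty) {v w : N} (hv : v ∉ C) (hw : w ∉ C) (hvw : v ≠ w)
    (hvS : insert v C ∈ K.S) (hwS : insert w C ∈ K.S) (a : N → ℝ)
    (h1 : a v + ∑ u ∈ C, a u = 1) (h2 : a v • K.b v + ∑ u ∈ C, a u • K.b u = K.b w) :
    a v < 0 := by
  by_contra hav
  push Not at hav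
  set κ : ℝ := (C.card : ℝ)⁻¹ with hκ
  have hκp : 0 < κ := card_inv_pos hne
  set M : ℝ := ∑ u ∈ C, |a u| with hM
  have hMb : ∀ u ∈ C, |a u| ≤ M := fun u hu =>
    Finset.single_le_sum (f := fun u => |a u|) (fun i _ => abs_nonneg _) hu
  have hM0 : 0 ≤ M := Finset.sum_nonneg fun i _ => abs_nonneg _
  set ε : ℝ := κ / (M + κ + 1) with hε
  have hεp : 0 < ε := by positivity
  have hεe : ε * (M + κ + 1) = κ := by rw [hε]; field_simp
  have hε1 : ε < 1 := by
    rw [hε, div_lt_one (by positivity)]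
    linarith
  set x : EucSp d := (1 - ε) • K.bary C + ε • K.b w with hx
  have hκs : ∑ _u ∈ C, κ = 1 := bary_w hne
  have c1 : K.car x = insert w C := by
    refine K.car_eq hwS (fun u => if u = w then ε else (1 - ε) * κ) ?_ ?_ ?_
    · intro u _
      split_ifs
      · exact hεp
      · exact mul_pos (by linarith) hκp
    · rw [Finset.sum_insert hw, if_pos rfl, Finset.sum_congr rfl (g := fun u => (1 - ε) * κ)]
      · rw [← Finset.mul_sum, hκs]; ring
      · intro u hu
        rw [if_neg]
        rintro rfl
        exact hw hu
    · rw [Finset.sum_insert hw, if_pos rfl,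
        Finset.sum_congr rfl (g := fun u => (1 - ε) • (κ • K.b u))]
      · rw [← Finset.smul_sum, hx, add_comm]; rfl
      · intro u hu
        rw [if_neg, mul_smul]
        rintro rfl
        exact hw hu
  have c2 : K.car x ⊆ insert v C := by
    rw [← K.mem_hull hvS, hull_iff']
    refine ⟨fun u => if u = v then ε * a v else (1 - ε) * κ + ε * a u, ?_, ?_, ?_⟩
    · intro u hu
      dsimp only
      split_ifs with huv
      · positivity
      · have huC : u ∈ C := by
          rcases Finset.mem_insert.1 hu with h | h
          · exact absurd h huv
          · exact h
        have h3 := hMb u huC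
        have h4 := neg_abs_le (a u)
        nlinarith
    · rw [Finset.sum_insert hv, if_pos rfl,
        Finset.sum_congr rfl (g := fun u => (1 - ε) * κ + ε * a u)]
      · rw [Finset.sum_add_distrib, ← Finset.mul_sum, ← Finset.mul_sum, hκs]
        linear_combination ε * h1
      · intro u hu
        rw [if_neg]
        rintro rfl
        exact hv hu
    · beta_reduce
      rw [Finset.sum_insert hv, if_pos rfl,
        Finset.sum_congr rfl (g := fun u => (1 - ε) • (κ • K.b u) + ε • (a u • K.b u))]
      · rw [Finset.sum_add_distrib, hx, ← h2, smul_add, mul_smul, bary, ← hκ]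
        simp only [Finset.smul_sum]
        abel
      · intro u hu
        rw [if_neg, add_smul, mul_smul, mul_smul]
        rintro rfl
        exact hv hu
  rw [c1] at c2
  have := c2 (Finset.mem_insert_self w C)
  rcases Finset.mem_insert.1 this with h | h
  · exact hvw h.symm
  · exact hw h

/-- Facets. -/
abbrev Fac : Type := {Φ : Finset N // Φ ∈ K.S ∧ Φ.card = d + 1}

lemma rk_bij (Φ : K.Fac) (i : Fin (d + 1)) : ∃ v ∈ Φ.1, K.rk v = i := by
  have h : (Φ.1.image K.rk) = Finset.univ := by
    apply Finset.eq_univ_of_card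
    rw [Finset.card_image_of_injOn (K.rk_inj _ Φ.2.1), Φ.2.2]
    simp
  have : i ∈ Φ.1.image K.rk := by rw [h]; exact Finset.mem_univ _
  simpa using this

/-- vertex of a given rank -/
noncomputable def vtx (Φ : K.Fac) (i : Fin (d + 1)) : N := (K.rk_bij Φ i).choose

lemma vtx_mem (Φ : K.Fac) (i : Fin (d + 1)) : K.vtx Φ i ∈ Φ.1 := (K.rk_bij Φ i).choose_spec.1

lemma rk_vtx (Φ : K.Fac) (i : Fin (d + 1)) : K.rk (K.vtx Φ i) = i := (K.rk_bij Φ i).choose_spec.2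

lemma eq_vtx {Φ : K.Fac} {v : N} (hv : v ∈ Φ.1) : K.vtx Φ (K.rk v) = v :=
  K.rk_inj _ Φ.2.1 (K.vtx_mem _ _) hv (K.rk_vtx _ _)

lemma fac_ext {Φ Ψ : K.Fac} (h : ∀ i, K.vtx Φ i = K.vtx Ψ i) : Φ = Ψ := by
  apply Subtype.ext
  ext v
  constructor
  · intro hv
    rw [← K.eq_vtx hv, h]
    exact K.vtx_mem _ _
  · intro hv
    rw [← K.eq_vtx hv, ← h]
    exact K.vtx_mem _ _

lemma erase_ne (Φ : K.Fac) {v : N} (hv : v ∈ Φ.1) : (Φ.1.erase v).Nonempty := by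
  rw [← Finset.card_pos, Finset.card_erase_of_mem hv, Φ.2.2]
  have := K.dpos
  omega

lemma erase_mem (Φ : K.Fac) {v : N} (hv : v ∈ Φ.1) : Φ.1.erase v ∈ K.S :=
  K.down _ Φ.2.1 _ (Finset.erase_subset _ _) (K.erase_ne Φ hv)

lemma adj_ex (Φ : K.Fac) {v : N} (hv : v ∈ Φ.1) :
    ∃ Ψ : K.Fac, Ψ ≠ Φ ∧ Φ.1.erase v ⊆ Ψ.1 := by
  set C := Φ.1.erase v with hC
  have hCS : C ∈ K.S := K.erase_mem Φ hv
  have hvC : v ∉ C := Finset.notMem_erase _ _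
  have hΦ : Φ.1 = insert v C := (Finset.insert_erase hv).symm
  have huv : ∀ u ∈ C, u ≠ v := fun u hu => (Finset.mem_erase.1 hu).1
  set x := K.bary C with hx
  obtain ⟨ε, hε, hs⟩ := K.star x
  set δ : ℝ := ε / (‖x - K.b v‖ + 1) with hδ
  have hδp : 0 < δ := by positivity
  set y := x + δ • (x - K.b v) with hy
  have hyx : dist y x < ε := by
    rw [hy, dist_eq_norm, add_sub_cancel_left, norm_smul, Real.norm_of_nonneg hδp.le, hδ,
      div_mul_eq_mul_div, div_lt_iff₀ (by positivity)]
    nlinarith [norm_nonneg (x - K.b v)]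
  have h1 := hs y hyx
  rw [hx, K.car_bary hCS] at h1
  obtain ⟨D, hD, hyD, hDc⟩ := K.exists_facet (K.car_mem y)
  refine ⟨⟨D, hD, hDc⟩, ?_, h1.trans hyD⟩
  intro he
  have he' : D = Φ.1 := congrArg Subtype.val he
  subst he'
  rw [← K.mem_hull hD, hull_iff'] at hyD
  obtain ⟨w, w1, w2, w3⟩ := hyD
  have key := K.rep_uniq hD (fun u => w u + if u = v then δ else 0)
    (fun u => if u = v then 0 else (1 + δ) * (C.card : ℝ)⁻¹) ?_ ?_ v hv
  · simp only [if_true] at key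
    have := w1 v hv
    linarith
  · have e1 : ∑ u ∈ C, (if u = v then δ else 0) = 0 :=
      Finset.sum_eq_zero fun u hu => if_neg (huv u hu)
    have e2 : ∑ u ∈ C, (if u = v then 0 else (1 + δ) * (C.card : ℝ)⁻¹) = 1 + δ := by
      rw [Finset.sum_congr rfl (g := fun u => (1 + δ) * (C.card : ℝ)⁻¹)
        (fun u hu => if_neg (huv u hu)), ← Finset.mul_sum, bary_w (K.ne C hCS), mul_one]
    rw [Finset.sum_add_distrib, w2, hΦ, Finset.sum_insert hvC, Finset.sum_insert hvC, e1, e2]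
    simp
  · have e1 : ∑ u ∈ C, (if u = v then δ else 0) • K.b u = 0 :=
      Finset.sum_eq_zero fun u hu => by rw [if_neg (huv u hu), zero_smul]
    have e2 : ∑ u ∈ C, (if u = v then 0 else (1 + δ) * (C.card : ℝ)⁻¹) • K.b u = (1 + δ) • x := by
      rw [Finset.sum_congr rfl (g := fun u => (1 + δ) • ((C.card : ℝ)⁻¹ • K.b u))
        (fun u hu => by rw [if_neg (huv u hu), mul_smul]), ← Finset.smul_sum, hx, bary]
    simp only [add_smul]
    rw [Finset.sum_add_distrib, w3, hΦ, Finset.sum_insert hvC, Finset.sum_insert hvC, e1, e2]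
    simp only [if_true, zero_smul, add_zero, zero_add, hy]
    module

lemma eq_insert {Φ Ψ : K.Fac} {v : N} (hv : v ∈ Φ.1) (h : Φ.1.erase v ⊆ Ψ.1) :
    ∃ w, w ∉ Φ.1.erase v ∧ Ψ.1 = insert w (Φ.1.erase v) := by
  have hc : (Ψ.1 \ Φ.1.erase v).card = 1 := by
    rw [Finset.card_sdiff_of_subset h, Finset.card_erase_of_mem hv, Φ.2.2, Ψ.2.2]
    omega
  obtain ⟨w, hw⟩ := Finset.card_eq_one.1 hc
  have hw' : w ∈ Ψ.1 \ Φ.1.erase v := by rw [hw]; simp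
  refine ⟨w, (Finset.mem_sdiff.1 hw').2, ?_⟩
  rw [← Finset.sdiff_union_of_subset h, hw]
  rfl

lemma adj_unique (Φ : K.Fac) {v : N} (hv : v ∈ Φ.1) {Ψ₁ Ψ₂ : K.Fac} (n1 : Ψ₁ ≠ Φ) (n2 : Ψ₂ ≠ Φ)
    (h1 : Φ.1.erase v ⊆ Ψ₁.1) (h2 : Φ.1.erase v ⊆ Ψ₂.1) : Ψ₁ = Ψ₂ := by
  obtain ⟨w1, hw1, e1⟩ := K.eq_insert hv h1
  obtain ⟨w2, hw2, e2⟩ := K.eq_insert hv h2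
  have hne := K.erase_ne Φ hv
  set C := Φ.1.erase v with hC
  have hvC : v ∉ C := Finset.notMem_erase _ _
  have hΦ : Φ.1 = insert v C := (Finset.insert_erase hv).symm
  by_cases h12 : w1 = w2
  · apply Subtype.ext
    rw [e1, e2, h12]
  exfalso
  have hv1 : v ≠ w1 := by
    rintro rfl
    exact n1 (Subtype.ext (e1.trans hΦ.symm))
  have hv2 : v ≠ w2 := by
    rintro rfl
    exact n2 (Subtype.ext (e2.trans hΦ.symm))
  have S0 : insert v C ∈ K.S := hΦ ▸ Φ.2.1
  have S1 : insert w1 C ∈ K.S := e1 ▸ Ψ₁.2.1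
  have S2 : insert w2 C ∈ K.S := e2 ▸ Ψ₂.2.1
  obtain ⟨a, a1, a2⟩ := K.rep_ex Φ.2.1 Φ.2.2 (K.b w1)
  rw [hΦ, Finset.sum_insert hvC] at a1 a2
  obtain ⟨c, c1, c2⟩ := K.rep_ex Ψ₂.2.1 Ψ₂.2.2 (K.b v)
  rw [e2, Finset.sum_insert hw2] at c1 c2
  have na := K.neg_coeff hne hvC hw1 hv1 S0 S1 a a1 a2
  have nc := K.neg_coeff hne hw2 hvC hv2.symm S2 S0 c c1 c2
  have nn := K.neg_coeff hne hw2 hw1 (Ne.symm h12) S2 S1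
    (fun u => a v * c u + if u = w2 then 0 else a u) ?_ ?_
  · simp only [if_true, add_zero] at nn
    nlinarith
  · simp only [if_true]
    rw [Finset.sum_congr rfl (g := fun u => a v * c u + a u), Finset.sum_add_distrib,
      ← Finset.mul_sum]
    · linear_combination a v * c1 + a1
    · intro u hu
      rw [if_neg]
      rintro rfl
      exact hw2 hu
  · simp only [if_true]
    rw [Finset.sum_congr rfl (g := fun u => a v • (c u • K.b u) + a u • K.b u),
      Finset.sum_add_distrib, ← Finset.smul_sum, add_zero, ← a2, ← c2]
    · module
    · intro u hu
      rw [if_neg, add_smul, mul_smul]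
      rintro rfl
      exact hw2 hu

/-- The `i`-adjacent facet. -/
noncomputable def r (i : Fin (d + 1)) (Φ : K.Fac) : K.Fac := (K.adj_ex Φ (K.vtx_mem Φ i)).choose

lemma r_ne (i : Fin (d + 1)) (Φ : K.Fac) : K.r i Φ ≠ Φ :=
  (K.adj_ex Φ (K.vtx_mem Φ i)).choose_spec.1

lemma r_sub (i : Fin (d + 1)) (Φ : K.Fac) : Φ.1.erase (K.vtx Φ i) ⊆ (K.r i Φ).1 :=
  (K.adj_ex Φ (K.vtx_mem Φ i)).choose_spec.2

lemma vtx_r {i j : Fin (d + 1)} (h : j ≠ i) (Φ : K.Fac) : K.vtx (K.r i Φ) j = K.vtx Φ j := by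
  have h1 : K.vtx Φ j ∈ (K.r i Φ).1 := by
    apply K.r_sub
    rw [Finset.mem_erase]
    refine ⟨?_, K.vtx_mem _ _⟩
    intro e
    have := congrArg K.rk e
    rw [K.rk_vtx, K.rk_vtx] at this
    exact h this
  have := K.eq_vtx h1
  rwa [K.rk_vtx] at this

lemma adj_cases {i : Fin (d + 1)} {Φ Ψ : K.Fac} (h : ∀ j, j ≠ i → K.vtx Ψ j = K.vtx Φ j) :
    Ψ = Φ ∨ Ψ = K.r i Φ := by
  by_cases e : Ψ = Φ
  · exact Or.inl e
  refine Or.inr (K.adj_unique Φ (K.vtx_mem Φ i) e (K.r_ne _ _) ?_ (K.r_sub _ _))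
  intro v hv
  rw [Finset.mem_erase] at hv
  have : K.rk v ≠ i := by
    rintro rfl
    exact hv.1 (K.eq_vtx hv.2).symm
  rw [← K.eq_vtx hv.2, ← h _ this]
  exact K.vtx_mem _ _

lemma vtx_r_ne (i : Fin (d + 1)) (Φ : K.Fac) : K.vtx (K.r i Φ) i ≠ K.vtx Φ i := by
  intro e
  apply K.r_ne i Φ
  apply K.fac_ext
  intro j
  by_cases h : j = i
  · rw [h, e]
  · exact K.vtx_r h Φ

lemma r_r (i : Fin (d + 1)) (Φ : K.Fac) : K.r i (K.r i Φ) = Φ := by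
  rcases K.adj_cases (i := i) (Φ := K.r i Φ) (Ψ := Φ) (fun j hj => (K.vtx_r hj Φ).symm) with h | h
  · exact absurd h.symm (K.r_ne i Φ)
  · exact h.symm

lemma sub_r {C : Finset N} {Φ : K.Fac} (h : C ⊆ Φ.1) {i : Fin (d + 1)} :
    C ⊆ (K.r i Φ).1 ↔ ∀ v ∈ C, K.rk v ≠ i := by
  constructor
  · rintro h' v hv rfl
    apply K.vtx_r_ne (K.rk v) Φ
    rw [K.eq_vtx (h' hv), K.eq_vtx (h hv)]
  · intro h' v hv
    rw [← K.eq_vtx (h hv), ← K.vtx_r (h' v hv)]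
    exact K.vtx_mem _ _

lemma exists_fac {C : Finset N} (hC : C ∈ K.S) : ∃ Φ : K.Fac, C ⊆ Φ.1 := by
  obtain ⟨D, h1, h2, h3⟩ := K.exists_facet hC
  exact ⟨⟨D, h1, h3⟩, h2⟩

end Tri


namespace Tri

variable {d : ℕ} {N : Type} (K : Tri d N)

lemma S_countable : K.S.Countable := by
  have : K.S ⊆ ⋃ n : ℕ, {C ∈ K.S | ∃ x ∈ convexHull ℝ (K.b '' (C : Set N)), ‖x‖ ≤ (n : ℝ)} := by
    intro C hC
    obtain ⟨n, hn⟩ := exists_nat_ge ‖K.bary C‖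
    refine Set.mem_iUnion.2 ⟨n, hC, K.bary C, ?_, hn⟩
    rw [K.mem_hull hC, K.car_bary hC]
  exact (Set.countable_iUnion fun n : ℕ => (K.lf n).countable).mono this

/-- generic points exist -/
lemma generic {ι : Type*} [Countable ι] (A : ι → Finset (EucSp d)) (hA : ∀ i, (A i).card ≤ d)
    {O : Set (EucSp d)} (hO : IsOpen O) (hne : O.Nonempty) :
    ∃ x ∈ O, ∀ i, x ∉ affineSpan ℝ (A i : Set (EucSp d)) := by
  by_contra hcon
  push Not at hcon
  have h1 : O ⊆ ⋃ i, (affineSpan ℝ (A i : Set (EucSp d)) : Set (EucSp d)) := by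
    intro x hx
    obtain ⟨i, hi⟩ := hcon x hx
    exact Set.mem_iUnion.2 ⟨i, hi⟩
  have h2 : MeasureTheory.volume (⋃ i, (affineSpan ℝ (A i : Set (EucSp d)) : Set (EucSp d))) = 0 := by
    rw [MeasureTheory.measure_iUnion_null_iff]
    intro i
    exact MeasureTheory.Measure.addHaar_affineSubspace _ _ (span_ne_top _ (hA i))
  have h3 := hO.measure_pos MeasureTheory.volume hne
  exact absurd (MeasureTheory.measure_mono_null h1 h2) h3.ne'

lemma fac_of_car {x : EucSp d} {Φ : K.Fac} (h : K.car x = Φ.1) : IsOpen {y | K.car y = Φ.1} ∧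
    x ∈ {y | K.car y = Φ.1} := by
  refine ⟨?_, h⟩
  rw [Metric.isOpen_iff]
  intro z hz
  obtain ⟨ε, hε, hs⟩ := K.star z
  refine ⟨ε, hε, ?_⟩
  intro y hy
  have := hs y hy
  rw [show K.car z = Φ.1 from hz] at this
  refine (Finset.eq_of_subset_of_card_le this ?_).symm
  rw [Φ.2.2]
  exact K.card_le (K.car_mem y)

lemma isOpen_fac (Φ : K.Fac) : IsOpen {y | K.car y = Φ.1} :=
  (K.fac_of_car (K.car_bary Φ.2.1)).1

/-- two facets over a point of codimension at most one -/
lemma codim_one {D : Finset N} (hc : d ≤ D.card) {Φ Ψ : K.Fac} (h1 : D ⊆ Φ.1) (h2 : D ⊆ Ψ.1) :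
    Ψ = Φ ∨ ∃ i, Ψ = K.r i Φ := by
  by_cases hd : D.card = d
  · have hc : (Φ.1 \ D).card = 1 := by
      rw [Finset.card_sdiff_of_subset h1, Φ.2.2, hd]
      omega
    obtain ⟨w, hw⟩ := Finset.card_eq_one.1 hc
    have hD : ∀ v ∈ Φ.1, v ≠ w → v ∈ D := by
      intro v hv hvw
      by_contra hvD
      have : v ∈ Φ.1 \ D := Finset.mem_sdiff.2 ⟨hv, hvD⟩
      rw [hw] at this
      exact hvw (Finset.mem_singleton.1 this)
    have : Ψ = Φ ∨ Ψ = K.r (K.rk w) Φ := by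
      apply K.adj_cases
      intro j hj
      have h3 : K.vtx Φ j ∈ Ψ.1 := by
        apply h2
        apply hD _ (K.vtx_mem _ _)
        rintro h
        rw [← h, K.rk_vtx] at hj
        exact hj rfl
      have := K.eq_vtx h3
      rwa [K.rk_vtx] at this
    rcases this with h | h
    · exact Or.inl h
    · exact Or.inr ⟨_, h⟩
  · left
    have e1 : D = Φ.1 := Finset.eq_of_subset_of_card_le h1 (by rw [Φ.2.2]; omega)
    have e2 : D = Ψ.1 := Finset.eq_of_subset_of_card_le h2 (by rw [Ψ.2.2]; omega)
    exact Subtype.ext (e2.symm.trans e1)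

lemma reach {Q : Set (EucSp d)} (hQ : IsPreconnected Q) (W : Set K.Fac)
    (hW : ∀ x ∈ Q, ∀ Φ Ψ : K.Fac, K.car x ⊆ Φ.1 → K.car x ⊆ Ψ.1 → Φ ∈ W → Ψ ∈ W)
    {p q : EucSp d} (hp : p ∈ Q) (hq : q ∈ Q) {Φ Ψ : K.Fac} (hΦ : K.car p ⊆ Φ.1)
    (hΨ : K.car q ⊆ Ψ.1) (h : Φ ∈ W) : Ψ ∈ W := by
  let G : EucSp d → Prop := fun x => ∃ Φ ∈ W, K.car x ⊆ Φ.1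
  have key : G p ↔ G q := by
    refine hQ.induction₂ (fun x y => G x ↔ G y) ?_ ?_ ?_ hp hq
    · intro x hx
      obtain ⟨ε, hε, hs⟩ := K.star x
      filter_upwards [mem_nhdsWithin_of_mem_nhds (Metric.ball_mem_nhds x hε)] with y hy
      have hxy := hs y hy
      constructor
      · rintro ⟨Φ, h1, h2⟩
        obtain ⟨Ψ, h3⟩ := K.exists_fac (K.car_mem y)
        exact ⟨Ψ, hW x hx Φ Ψ h2 (hxy.trans h3) h1, h3⟩
      · rintro ⟨Φ, h1, h2⟩
        exact ⟨Φ, h1, hxy.trans h2⟩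
    · intro x y z _ _ _ h1 h2
      exact h1.trans h2
    · intro x y _ _ h1
      exact h1.symm
  obtain ⟨Φ', h1, h2⟩ := key.1 ⟨Φ, h, hΦ⟩
  exact hW q hq Φ' Ψ h2 hΨ h1

/-- the open segment argument -/
lemma conn_aux {O : Set (EucSp d)} (hOc : Convex ℝ O) (hO : IsOpen O) (C : Finset N)
    (hC : ∀ y ∈ O, C ⊆ K.car y) (W : Set K.Fac)
    (hW : ∀ Φ ∈ W, ∀ i, C ⊆ (K.r i Φ).1 → K.r i Φ ∈ W)
    {p q : EucSp d} (hp : p ∈ O) (hq : q ∈ O) {Φ Ψ : K.Fac} (hΦ : K.car p = Φ.1)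
    (hΨ : K.car q = Ψ.1) (h : Φ ∈ W) : Ψ ∈ W := by
  have : Countable {D : Finset N // D ∈ K.S ∧ D.card ≤ d - 1} :=
    (K.S_countable.mono (s₁ := {D | D ∈ K.S ∧ D.card ≤ d - 1}) fun D h => h.1).to_subtype
  obtain ⟨q', hq', hg⟩ := generic (fun D : {D : Finset N // D ∈ K.S ∧ D.card ≤ d - 1} =>
    insert p (D.1.image K.b)) (by
      intro D
      have h1 := Finset.card_insert_le p (D.1.image K.b)
      have h2 := Finset.card_image_le (s := D.1) (f := K.b)
      have := D.2.2
      have := K.dpos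
      omega) (hO.inter (K.isOpen_fac Ψ)) ⟨q, hq, hΨ⟩
  have hcard : ∀ z ∈ segment ℝ p q', d ≤ (K.car z).card := by
    intro z hz
    by_contra hlt
    have hzs : (K.car z).card ≤ d - 1 := by omega
    apply hg ⟨K.car z, K.car_mem z, hzs⟩
    have hzp : z ≠ p := by
      rintro rfl
      rw [hΦ, Φ.2.2] at hlt
      omega
    rw [segment_eq_image_lineMap] at hz
    obtain ⟨t, ht, rfl⟩ := hz
    have ht0 : t ≠ 0 := by
      rintro rfl
      simp at hzp
    set L := affineSpan ℝ ((insert p ((K.car (AffineMap.lineMap p q' t)).image K.b) :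
      Finset (EucSp d)) : Set (EucSp d)) with hL
    have m1 : p ∈ L := subset_affineSpan ℝ _ (by simp)
    have m2 : AffineMap.lineMap p q' t ∈ L := by
      have h3 : AffineMap.lineMap p q' t ∈ convexHull ℝ
        (K.b '' (K.car (AffineMap.lineMap p q' t) : Set N)) :=
        (K.mem_hull (K.car_mem _)).2 subset_rfl
      refine affineSpan_mono ℝ ?_ (convexHull_subset_affineSpan _ h3)
      simp
    have := AffineMap.lineMap_mem t⁻¹ m1 m2
    rwa [AffineMap.lineMap_lineMap_right, inv_mul_cancel₀ ht0, AffineMap.lineMap_apply_one] at this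
  refine K.reach (convex_segment p q').isPreconnected W ?_ (left_mem_segment ℝ p q')
    (right_mem_segment ℝ p q') hΦ.subset (Finset.Subset.trans (le_of_eq hq'.2) subset_rfl) h
  intro x hx Φ' Ψ' h1 h2 h3
  rcases K.codim_one (hcard x hx) h1 h2 with h4 | ⟨i, h4⟩
  · rw [h4]; exact h3
  · rw [h4]
    apply hW _ h3
    rw [← h4]
    exact (hC x (hOc.segment_subset hp hq'.1 hx)).trans h2

lemma conn_all (W : Set K.Fac) (hW : ∀ Φ ∈ W, ∀ i, K.r i Φ ∈ W) {Φ : K.Fac} (h : Φ ∈ W)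
    (Ψ : K.Fac) : Ψ ∈ W :=
  K.conn_aux convex_univ isOpen_univ ∅ (fun _ _ => Finset.empty_subset _) W
    (fun Φ hΦ i _ => hW Φ hΦ i) (Set.mem_univ _) (Set.mem_univ _) (K.car_bary Φ.2.1)
    (K.car_bary Ψ.2.1) h

lemma near {C : Finset N} (hC : C ∈ K.S) {Φ : K.Fac} (h : C ⊆ Φ.1) {ε : ℝ} (hε : 0 < ε) :
    ∃ p ∈ Metric.ball (K.bary C) ε, K.car p = Φ.1 := by
  set x := K.bary C
  set z := K.bary Φ.1
  set t : ℝ := min 1 (ε / (‖z - x‖ + 1)) with ht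
  have htp : 0 < t := by positivity
  have ht1 : t ≤ 1 := min_le_left _ _
  refine ⟨x + t • (z - x), ?_, ?_⟩
  · rw [Metric.mem_ball, dist_eq_norm, add_sub_cancel_left, norm_smul, Real.norm_of_nonneg htp.le]
    calc t * ‖z - x‖ ≤ (ε / (‖z - x‖ + 1)) * ‖z - x‖ := by
          gcongr
          exact min_le_right _ _
      _ < ε := by
        rw [div_mul_eq_mul_div, div_lt_iff₀ (by positivity)]
        nlinarith [norm_nonneg (z - x)]
  · have hk : 0 < ((Φ.1.card : ℝ)⁻¹) := card_inv_pos (K.ne _ Φ.2.1)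
    have hk' : 0 < ((C.card : ℝ)⁻¹) := card_inv_pos (K.ne _ hC)
    refine K.car_eq Φ.2.1 (fun v => t * (Φ.1.card : ℝ)⁻¹ +
      (1 - t) * (if v ∈ C then (C.card : ℝ)⁻¹ else 0)) ?_ ?_ ?_
    · intro v _
      have : 0 ≤ (1 - t) * (if v ∈ C then (C.card : ℝ)⁻¹ else 0) := by
        apply mul_nonneg (by linarith)
        split_ifs
        · exact hk'.le
        · exact le_rfl
      have := mul_pos htp hk
      linarith
    · rw [Finset.sum_add_distrib, ← Finset.mul_sum, ← Finset.mul_sum, bary_w (K.ne _ Φ.2.1),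
        ← Finset.sum_filter, Finset.filter_mem_eq_inter, Finset.inter_eq_right.2 h,
        bary_w (K.ne _ hC)]
      ring
    · have e : ∑ v ∈ Φ.1, (if v ∈ C then (C.card : ℝ)⁻¹ else 0) • K.b v = x := by
        simp only [ite_smul, zero_smul]
        rw [← Finset.sum_filter, Finset.filter_mem_eq_inter, Finset.inter_eq_right.2 h]
        rfl
      simp only [add_smul, mul_smul]
      rw [Finset.sum_add_distrib, ← Finset.smul_sum (r := t) (f := fun v => (Φ.1.card : ℝ)⁻¹ • K.b v),
        ← Finset.smul_sum (r := 1 - t) (f := fun v => (if v ∈ C then (C.card : ℝ)⁻¹ else 0) • K.b v), e,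
        show ∑ v ∈ Φ.1, (Φ.1.card : ℝ)⁻¹ • K.b v = z from rfl]
      module

lemma conn_res {C : Finset N} (hC : C ∈ K.S) (W : Set K.Fac)
    (hW : ∀ Φ ∈ W, ∀ i, C ⊆ (K.r i Φ).1 → K.r i Φ ∈ W) {Φ Ψ : K.Fac} (hΦ : C ⊆ Φ.1)
    (hΨ : C ⊆ Ψ.1) (h : Φ ∈ W) : Ψ ∈ W := by
  obtain ⟨ε, hε, hs⟩ := K.star (K.bary C)
  rw [K.car_bary hC] at hs
  obtain ⟨p, hp, hp'⟩ := K.near hC hΦ hε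
  obtain ⟨q, hq, hq'⟩ := K.near hC hΨ hε
  exact K.conn_aux (convex_ball _ _) Metric.isOpen_ball C hs W hW hp hq hp' hq' h

lemma res_finite {C : Finset N} (hC : C ∈ K.S) : {Φ : K.Fac | C ⊆ Φ.1}.Finite := by
  have := K.lf ‖K.bary C‖
  have h2 : {Φ : K.Fac | C ⊆ Φ.1} ⊆ Subtype.val ⁻¹' {C' ∈ K.S |
      ∃ x ∈ convexHull ℝ (K.b '' (C' : Set N)), ‖x‖ ≤ ‖K.bary C‖} := by
    intro Φ hΦ
    refine ⟨Φ.2.1, K.bary C, ?_, le_rfl⟩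
    rw [K.mem_hull Φ.2.1, K.car_bary hC]
    exact hΦ
  exact (this.preimage (Subtype.val_injective.injOn)).subset h2

lemma nonempty_fac : Nonempty K.Fac := by
  obtain ⟨Φ, _⟩ := K.exists_fac (K.car_mem 0)
  exact ⟨Φ⟩

end Tri


section dihedral

variable {X : Type*}

lemma dih_conj {p q : Equiv.Perm X} (hp : p * p = 1) (hq : q * q = 1) (k : ℤ) :
    p * (p * q) ^ k = (p * q) ^ (-k) * p := by
  have hp' : p⁻¹ = p := inv_eq_of_mul_eq_one_left hp
  have hq' : q⁻¹ = q := inv_eq_of_mul_eq_one_left hq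
  have h1 : p * (p * q) * p⁻¹ = (p * q)⁻¹ := by
    rw [mul_inv_rev, hp', hq', ← mul_assoc, hp, one_mul]
  have h2 := conj_zpow (i := k) (a := p) (b := p * q)
  rw [h1, inv_zpow', ] at h2
  rw [h2, hp', mul_assoc, hp, mul_one]

lemma dih_nofix {p q : Equiv.Perm X} (hp : p * p = 1) (hq : q * q = 1)
    (fp : ∀ x, p x ≠ x) (fq : ∀ x, q x ≠ x) (k : ℤ) (x : X) : ((p * q) ^ k * p) x ≠ x := by
  intro h
  rcases Int.even_or_odd' k with ⟨m, rfl | rfl⟩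
  · apply fp (((p * q) ^ (-m)) x)
    rw [← Equiv.Perm.mul_apply, dih_conj hp hq, neg_neg]
    have : (p * q) ^ (2 * m) * p = (p * q) ^ m * ((p * q) ^ m * p) := by
      rw [← mul_assoc, ← zpow_add, two_mul]
    rw [this, Equiv.Perm.mul_apply] at h
    conv_rhs => rw [← h]
    rw [← Equiv.Perm.mul_apply ((p * q) ^ (-m)), ← zpow_add, neg_add_cancel, zpow_zero]
    rfl
  · apply fq (p (((p * q) ^ (-m)) x))
    have e : p (q (p (((p * q) ^ (-m)) x))) = ((p * q) ^ (m + 1) * p) x := by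
      rw [← Equiv.Perm.mul_apply p ((p * q) ^ (-m)), dih_conj hp hq, neg_neg, add_comm m 1,
        zpow_one_add]
      rfl
    have : (p * q) ^ (2 * m + 1) * p = (p * q) ^ m * ((p * q) ^ (m + 1) * p) := by
      rw [← mul_assoc, ← zpow_add]
      congr 2
      ring
    rw [this, Equiv.Perm.mul_apply] at h
    have e2 : p (q (p (((p * q) ^ (-m)) x))) = ((p * q) ^ (-m)) x := by
      rw [e]
      conv_rhs => rw [← h]
      rw [← Equiv.Perm.mul_apply ((p * q) ^ (-m)) , ← zpow_add, neg_add_cancel, zpow_zero]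
      rfl
    have := congrArg p e2
    rwa [← Equiv.Perm.mul_apply p p, hp, Equiv.Perm.one_apply] at this

end dihedral

namespace Tri

variable {d : ℕ} {N : Type} (K : Tri d N)

/-- covering data over the facet graph -/
structure Cov (X : Type*) where
  π : X → K.Fac
  R : Fin (d + 1) → X → X
  hπ : ∀ i x, π (R i x) = K.r i (π x)
  hinv : ∀ i x, R i (R i x) = x
  hrel : ∀ i j, i ≠ j → ∀ x (k : ℕ), (K.r i ∘ K.r j)^[k] (π x) = π x → (R i ∘ R j)^[k] x = x

namespace Cov

variable {K} {X : Type*} (V : K.Cov X)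

/-- sections over a region -/
def SecOn (Q : Set (EucSp d)) (σ : K.Fac → X) : Prop :=
  ∀ x ∈ Q, ∀ Φ : K.Fac, K.car x ⊆ Φ.1 → V.π (σ Φ) = Φ ∧
    ∀ i, K.car x ⊆ (K.r i Φ).1 → σ (K.r i Φ) = V.R i (σ Φ)

/-- the lifting property -/
def Lif (Q : Set (EucSp d)) : Prop :=
  ∀ x ∈ Q, ∀ Φ : K.Fac, K.car x ⊆ Φ.1 → ∀ e, V.π e = Φ → ∃ σ, V.SecOn Q σ ∧ σ Φ = e

lemma SecOn.mono {V : K.Cov X} {Q Q' : Set (EucSp d)} {σ : K.Fac → X} (h : V.SecOn Q σ)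
    (hQ : Q' ⊆ Q) : V.SecOn Q' σ := fun x hx => h x (hQ hx)

lemma sec_unique {Q : Set (EucSp d)} (hQ : IsPreconnected Q) {σ τ : K.Fac → X}
    (hσ : V.SecOn Q σ) (hτ : V.SecOn Q τ) {p q : EucSp d} (hp : p ∈ Q) (hq : q ∈ Q)
    {Φ Ψ : K.Fac} (hΦ : K.car p ⊆ Φ.1) (hΨ : K.car q ⊆ Ψ.1) (h : σ Φ = τ Φ) : σ Ψ = τ Ψ := by
  refine K.reach hQ {Φ | σ Φ = τ Φ} ?_ hp hq hΦ hΨ h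
  intro x hx Φ Ψ h1 h2 h3
  refine (K.conn_res (K.car_mem x) {Φ | K.car x ⊆ Φ.1 ∧ σ Φ = τ Φ} ?_ h1 h2 ⟨h1, h3⟩).2
  rintro Φ ⟨h4, h5⟩ i h6
  refine ⟨h6, ?_⟩
  rw [(hσ x hx Φ h4).2 i h6, (hτ x hx Φ h4).2 i h6, h5]

/-- the generators as permutations -/
def per (i : Fin (d + 1)) : Equiv.Perm X :=
  ⟨V.R i, V.R i, V.hinv i, V.hinv i⟩

/-- the generators as permutations -/
noncomputable def _root_.Tri.rper (K : Tri d N) (i : Fin (d + 1)) : Equiv.Perm K.Fac :=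
  ⟨K.r i, K.r i, K.r_r i, K.r_r i⟩

lemma per_sq (i : Fin (d + 1)) : V.per i * V.per i = 1 := Equiv.ext (V.hinv i)

lemma rper_sq (i : Fin (d + 1)) : K.rper i * K.rper i = 1 := Equiv.ext (K.r_r i)

lemma π_pow (i j : Fin (d + 1)) (k : ℕ) (x : X) :
    V.π (((V.per i * V.per j) ^ k) x) = ((K.rper i * K.rper j) ^ k) (V.π x) := by
  induction k generalizing x with
  | zero => rfl
  | succ k ih =>
    rw [pow_succ, pow_succ, Equiv.Perm.mul_apply, ih, Equiv.Perm.mul_apply ((_ : Equiv.Perm K.Fac) ^ k)]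
    congr 1
    simp only [Equiv.Perm.mul_apply]
    change V.π (V.R i (V.R j x)) = K.r i (K.r j (V.π x))
    rw [V.hπ, V.hπ]

lemma π_zpow (i j : Fin (d + 1)) (k : ℤ) (x : X) :
    V.π (((V.per i * V.per j) ^ k) x) = ((K.rper i * K.rper j) ^ k) (V.π x) := by
  obtain ⟨n, rfl | rfl⟩ := k.eq_nat_or_neg
  · rw [zpow_natCast, zpow_natCast, V.π_pow]
  · rw [zpow_neg, zpow_natCast, zpow_neg, zpow_natCast, Equiv.Perm.eq_inv_iff_eq, ← V.π_pow,
      ← Equiv.Perm.mul_apply, mul_inv_cancel, Equiv.Perm.one_apply]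

lemma rel_z {i j : Fin (d + 1)} (hij : i ≠ j) (k : ℤ) (x : X)
    (h : ((K.rper i * K.rper j) ^ k) (V.π x) = V.π x) : ((V.per i * V.per j) ^ k) x = x := by
  have key : ∀ (n : ℕ), ((K.rper i * K.rper j) ^ n) (V.π x) = V.π x →
      ((V.per i * V.per j) ^ n) x = x := by
    intro n hn
    rw [← Equiv.Perm.iterate_eq_pow] at hn ⊢
    exact V.hrel i j hij x n hn
  obtain ⟨n, rfl | rfl⟩ := k.eq_nat_or_neg
  · rw [zpow_natCast] at h ⊢
    exact key n h
  · rw [zpow_neg, zpow_natCast, Equiv.Perm.inv_eq_iff_eq] at h ⊢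
    exact (key n h.symm).symm

lemma lif_point {x : EucSp d} (hx : d ≤ (K.car x).card + 1) : V.Lif {x} := by
  intro x' hx' Φ₀ hΦ₀ e he
  rw [Set.mem_singleton_iff] at hx'
  subst hx'
  set C := K.car x' with hC
  -- the two ranks
  obtain ⟨i, j, hij, hI⟩ : ∃ i j : Fin (d + 1), i ≠ j ∧ ∀ l, l ∉ C.image K.rk → l = i ∨ l = j := by
    have hcard : ((C.image K.rk)ᶜ).card ≤ 2 := by
      rw [Finset.card_compl, Finset.card_image_of_injOn (K.rk_inj _ (K.car_mem _)),
        Fintype.card_fin, ← hC]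
      omega
    obtain ⟨Y, hY1, hY2⟩ := Finset.exists_superset_card_eq hcard (by
      rw [Fintype.card_fin]
      have := K.dpos
      omega)
    obtain ⟨i, j, hij, rfl⟩ := Finset.card_eq_two.1 hY2
    refine ⟨i, j, hij, ?_⟩
    intro l hl
    have := hY1 (Finset.mem_compl.2 hl)
    simpa using this
  set p := V.per i with hp
  set q := V.per j with hq
  set Z : Set X := {z | ∃ k : ℤ, z = ((p * q) ^ k) e ∨ z = ((p * q) ^ k) (p e)} with hZ
  have Zi : ∀ z ∈ Z, V.R i z ∈ Z := by
    rintro z ⟨k, rfl | rfl⟩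
    · refine ⟨-k, Or.inr ?_⟩
      change (p * (p * q) ^ k) e = _
      rw [dih_conj (V.per_sq i) (V.per_sq j)]
      rfl
    · refine ⟨-k, Or.inl ?_⟩
      change (p * (p * q) ^ k) (p e) = _
      rw [dih_conj (V.per_sq i) (V.per_sq j), Equiv.Perm.mul_apply, ← Equiv.Perm.mul_apply p p,
        V.per_sq i]
      rfl
  have Zj : ∀ z ∈ Z, V.R j z ∈ Z := by
    have key : ∀ z, V.R j z = V.R i ((p * q) z) := by
      intro z
      change _ = V.R i (V.R i (V.R j z))
      rw [V.hinv]
    rintro z ⟨k, rfl | rfl⟩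
    · rw [key]
      apply Zi
      exact ⟨1 + k, Or.inl (by rw [zpow_one_add]; rfl)⟩
    · rw [key]
      apply Zi
      exact ⟨1 + k, Or.inr (by rw [zpow_one_add]; rfl)⟩
  have hsame : ∀ (f : X) (k l : ℤ), V.π (((p * q) ^ k) f) = V.π (((p * q) ^ l) f) →
      ((p * q) ^ k) f = ((p * q) ^ l) f := by
    intro f k l h
    rw [V.π_zpow, V.π_zpow] at h
    have := V.rel_z hij (-l + k) f (by
      rw [zpow_add, Equiv.Perm.mul_apply, h, ← Equiv.Perm.mul_apply, ← zpow_add, neg_add_cancel,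
        zpow_zero, Equiv.Perm.one_apply])
    rw [zpow_add, Equiv.Perm.mul_apply, zpow_neg, Equiv.Perm.inv_eq_iff_eq] at this
    exact this
  have hmix : ∀ (k l : ℤ), V.π (((p * q) ^ k) e) ≠ V.π (((p * q) ^ l) (p e)) := by
    intro k l h
    rw [V.π_zpow, V.π_zpow] at h
    apply dih_nofix (rper_sq (K := K) i) (rper_sq (K := K) j) (K.r_ne i) (K.r_ne j)
      (-k + l) (V.π e)
    have e1 : V.π (p e) = K.rper i (V.π e) := V.hπ i e
    rw [e1] at h
    rw [Equiv.Perm.mul_apply, zpow_add, Equiv.Perm.mul_apply, ← h, ← Equiv.Perm.mul_apply,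
      ← zpow_add, neg_add_cancel, zpow_zero, Equiv.Perm.one_apply]
  have hinj : ∀ z ∈ Z, ∀ z' ∈ Z, V.π z = V.π z' → z = z' := by
    rintro z ⟨k, rfl | rfl⟩ z' ⟨l, rfl | rfl⟩ h
    · exact hsame _ _ _ h
    · exact absurd h (hmix _ _)
    · exact absurd h.symm (hmix _ _)
    · exact hsame _ _ _ h
  have eZ : e ∈ Z := ⟨0, Or.inl rfl⟩
  have ZI : ∀ Φ : K.Fac, C ⊆ Φ.1 → ∀ z ∈ Z, ∀ l, C ⊆ (K.r l Φ).1 → V.R l z ∈ Z := by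
    intro Φ hΦ z hz l hl
    have : l ∉ C.image K.rk := by
      intro h
      obtain ⟨v, hv, hv'⟩ := Finset.mem_image.1 h
      exact (K.sub_r hΦ).1 hl v hv hv'
    rcases hI l this with rfl | rfl
    · exact Zi z hz
    · exact Zj z hz
  have hsurj : ∀ Φ : K.Fac, C ⊆ Φ.1 → ∃ z ∈ Z, V.π z = Φ := by
    intro Φ hΦ
    refine (K.conn_res (K.car_mem x') {Φ | C ⊆ Φ.1 ∧ ∃ z ∈ Z, V.π z = Φ} ?_ hΦ₀ hΦ
      ⟨hΦ₀, e, eZ, he⟩).2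
    rintro Φ ⟨h1, z, hz, rfl⟩ l hl
    exact ⟨hl, V.R l z, ZI _ h1 z hz l hl, V.hπ l z⟩
  have : Nonempty X := ⟨e⟩
  choose! σ hσ1 hσ2 using hsurj
  refine ⟨σ, ?_, ?_⟩
  · intro y hy Φ hΦ
    rw [Set.mem_singleton_iff] at hy
    subst hy
    refine ⟨hσ2 Φ hΦ, ?_⟩
    intro l hl
    refine hinj _ (hσ1 _ hl) _ (ZI Φ hΦ _ (hσ1 Φ hΦ) l hl) ?_
    rw [hσ2 _ hl, V.hπ, hσ2 _ hΦ]
  · refine hinj _ (hσ1 _ hΦ₀) _ eZ ?_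
    rw [hσ2 _ hΦ₀, he]

end Cov
end Tri


namespace Tri

variable {d : ℕ} {N : Type} {K : Tri d N}

namespace Cov

variable {X : Type*} (V : K.Cov X)

lemma cross {Y : Set (EucSp d)} (hY : Convex ℝ Y) (l : Fin d) (c : ℝ) {u v : EucSp d}
    (hu : u ∈ Y) (hv : v ∈ Y) (h1 : u l ≤ c) (h2 : c ≤ v l) : ∃ z ∈ Y, z l = c := by
  have hcont : ContinuousOn (fun z : EucSp d => z l) Y := by fun_prop
  have := hY.isPreconnected.intermediate_value hu hv hcont ⟨h1, h2⟩
  exact this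

lemma glue_aux {Q Q₁ Q₂ : Set (EucSp d)} (hQ : Q ⊆ Q₁ ∪ Q₂)
    (hm : IsPreconnected (Q₁ ∩ Q₂))
    (hmeet : ∀ Y : Set (EucSp d), Convex ℝ Y → (Y ∩ Q₁).Nonempty → (Y ∩ Q₂).Nonempty →
      (Y ∩ (Q₁ ∩ Q₂)).Nonempty) (h1 : V.Lif Q₁) (h2 : V.Lif Q₂) :
    ∀ x ∈ Q₁, ∀ Φ : K.Fac, K.car x ⊆ Φ.1 → ∀ e, V.π e = Φ → ∃ σ, V.SecOn Q σ ∧ σ Φ = e := by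
  intro x hx Φ hΦ e he
  obtain ⟨σ, hσ, hσe⟩ := h1 x hx Φ hΦ e he
  by_cases hne : Q₂.Nonempty
  · obtain ⟨z, -, hz1, hz2⟩ := hmeet Set.univ convex_univ ⟨x, trivial, hx⟩
      ⟨hne.some, trivial, hne.some_mem⟩
    obtain ⟨Ψ, hΨ⟩ := K.exists_fac (K.car_mem z)
    obtain ⟨τ, hτ, hτe⟩ := h2 z hz2 Ψ hΨ (σ Ψ) (hσ z hz1 Ψ hΨ).1
    have agree : ∀ Ω : K.Fac, (∃ y ∈ Q₁, K.car y ⊆ Ω.1) → (∃ y ∈ Q₂, K.car y ⊆ Ω.1) →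
        σ Ω = τ Ω := by
      rintro Ω ⟨y1, hy1, hy1'⟩ ⟨y2, hy2, hy2'⟩
      obtain ⟨y, hy, hy'⟩ := hmeet (convexHull ℝ (K.b '' (Ω.1 : Set N))) (convex_convexHull _ _)
        ⟨y1, (K.mem_hull Ω.2.1).2 hy1', hy1⟩ ⟨y2, (K.mem_hull Ω.2.1).2 hy2', hy2⟩
      exact V.sec_unique hm (hσ.mono Set.inter_subset_left) (hτ.mono Set.inter_subset_right)
        (⟨hz1, hz2⟩ : z ∈ Q₁ ∩ Q₂) hy' hΨ ((K.mem_hull Ω.2.1).1 hy) hτe.symm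
    refine ⟨fun Ω => if ∃ y ∈ Q₁, K.car y ⊆ Ω.1 then σ Ω else τ Ω, ?_, ?_⟩
    · intro y hy Ω hΩ
      rcases hQ hy with hy1 | hy2
      · refine ⟨?_, ?_⟩
        · simp only [if_pos (show ∃ y ∈ Q₁, K.car y ⊆ Ω.1 from ⟨y, hy1, hΩ⟩)]
          exact (hσ y hy1 Ω hΩ).1
        · intro i hi
          simp only [if_pos (show ∃ y ∈ Q₁, K.car y ⊆ Ω.1 from ⟨y, hy1, hΩ⟩),
            if_pos (show ∃ y ∈ Q₁, K.car y ⊆ (K.r i Ω).1 from ⟨y, hy1, hi⟩)]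
          exact (hσ y hy1 Ω hΩ).2 i hi
      · have key : ∀ Ω : K.Fac, K.car y ⊆ Ω.1 →
            (if ∃ y ∈ Q₁, K.car y ⊆ Ω.1 then σ Ω else τ Ω) = τ Ω := by
          intro Ω hΩ
          split_ifs with h
          · exact agree Ω h ⟨y, hy2, hΩ⟩
          · rfl
        refine ⟨?_, ?_⟩
        · simp only [key Ω hΩ]
          exact (hτ y hy2 Ω hΩ).1
        · intro i hi
          simp only [key Ω hΩ, key _ hi]
          exact (hτ y hy2 Ω hΩ).2 i hi
    · simp only [if_pos (show ∃ y ∈ Q₁, K.car y ⊆ Φ.1 from ⟨x, hx, hΦ⟩)]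
      exact hσe
  · rw [Set.not_nonempty_iff_eq_empty] at hne
    subst hne
    refine ⟨σ, hσ.mono ?_, hσe⟩
    simpa using hQ

lemma glue {Q : Set (EucSp d)} (hQ : Convex ℝ Q) (l : Fin d) (c : ℝ)
    (h1 : V.Lif (Q ∩ {x | x l ≤ c})) (h2 : V.Lif (Q ∩ {x | c ≤ x l})) : V.Lif Q := by
  have c1 : Convex ℝ {x : EucSp d | x l ≤ c} :=
    convex_halfSpace_le (f := fun x : EucSp d => x l) ⟨fun _ _ => rfl, fun _ _ => rfl⟩ c
  have c2 : Convex ℝ {x : EucSp d | c ≤ x l} :=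
    convex_halfSpace_ge (f := fun x : EucSp d => x l) ⟨fun _ _ => rfl, fun _ _ => rfl⟩ c
  have hmeet : ∀ Y : Set (EucSp d), Convex ℝ Y → (Y ∩ (Q ∩ {x | x l ≤ c})).Nonempty →
      (Y ∩ (Q ∩ {x | c ≤ x l})).Nonempty →
      (Y ∩ ((Q ∩ {x | x l ≤ c}) ∩ (Q ∩ {x | c ≤ x l}))).Nonempty := by
    rintro Y hY ⟨u, hu, hu1, hu2⟩ ⟨v, hv, hv1, hv2⟩
    obtain ⟨z, hz, hz'⟩ := cross (hY.inter hQ) l c (⟨hu, hu1⟩ : u ∈ Y ∩ Q) ⟨hv, hv1⟩ hu2 hv2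
    exact ⟨z, hz.1, ⟨hz.2, hz'.le⟩, ⟨hz.2, hz'.ge⟩⟩
  have hcov : Q ⊆ (Q ∩ {x | x l ≤ c}) ∪ (Q ∩ {x | c ≤ x l}) := by
    intro x hx
    rcases le_total (x l) c with h | h
    · exact Or.inl ⟨hx, h⟩
    · exact Or.inr ⟨hx, h⟩
  have hm : IsPreconnected ((Q ∩ {x | x l ≤ c}) ∩ (Q ∩ {x | c ≤ x l})) :=
    ((hQ.inter c1).inter (hQ.inter c2)).isPreconnected
  intro x hx
  rcases hcov hx with h | h
  · exact V.glue_aux hcov hm hmeet h1 h2 x h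
  · refine V.glue_aux (Q₁ := Q ∩ {x | c ≤ x l}) (Q₂ := Q ∩ {x | x l ≤ c}) ?_ ?_ ?_ h2 h1 x h
    · rw [Set.union_comm]; exact hcov
    · rw [Set.inter_comm]; exact hm
    · intro Y hY a b
      rw [Set.inter_comm (Q ∩ _)]
      exact hmeet Y hY b a

lemma lif_compact {Q : Set (EucSp d)} (hQ : Convex ℝ Q) (hc : IsCompact Q)
    (hU : ∀ x ∈ Q, d ≤ (K.car x).card + 1) : V.Lif Q := by
  choose ε hε hs using fun x => K.star x
  obtain ⟨δ, hδ, hL⟩ := lebesgue_number_lemma_of_metric (s := Q) (ι := EucSp d)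
    (c := fun x => if x ∈ Q then Metric.ball x (ε x) else ∅) hc
    (by
      intro x
      split_ifs
      · exact Metric.isOpen_ball
      · exact isOpen_empty)
    (by
      intro x hx
      refine Set.mem_iUnion.2 ⟨x, ?_⟩
      simp only [if_pos hx]
      exact Metric.mem_ball_self (hε x))
  have small : ∀ Y ⊆ Q, (∀ x ∈ Y, ∀ y ∈ Y, dist y x < δ) → V.Lif Y := by
    intro Y hYQ hY x hx Φ hΦ e he
    obtain ⟨z, hz⟩ := hL x (hYQ hx)
    have hxz := hz (Metric.mem_ball_self hδ)
    split_ifs at hz hxz with hzQ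
    · have hcar : ∀ y ∈ Y, K.car z ⊆ K.car y := by
        intro y hy
        exact hs z y (hz (hY x hx y hy))
      obtain ⟨σ, hσ, hσe⟩ := V.lif_point (hU z hzQ) z rfl Φ ((hcar x hx).trans hΦ) e he
      refine ⟨σ, ?_, hσe⟩
      intro y hy Ψ hΨ
      have := hσ z rfl Ψ ((hcar y hy).trans hΨ)
      exact ⟨this.1, fun i hi => this.2 i ((hcar y hy).trans hi)⟩
    · exact absurd hxz (Set.notMem_empty _)
  -- mesh size
  obtain ⟨h, hh, hmesh⟩ : ∃ h > 0, ∀ x y : EucSp d, (∀ i, |y i - x i| ≤ h) → dist y x < δ := by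
    refine ⟨δ / (d + 1), by positivity, ?_⟩
    intro x y hxy
    rw [EuclideanSpace.dist_eq, Real.sqrt_lt' hδ]
    calc ∑ i, dist (y i) (x i) ^ 2 ≤ ∑ _i : Fin d, (δ / (d + 1)) ^ 2 := by
          gcongr with i
          rw [Real.dist_eq]
          exact hxy i
      _ = d * (δ / (d + 1)) ^ 2 := by simp
      _ < δ ^ 2 := by
        rw [div_pow, mul_div_assoc', div_lt_iff₀ (by positivity)]
        have : (0 : ℝ) ≤ d := by positivity
        have hd2 : 0 < δ ^ 2 := by positivity
        nlinarith [mul_pos hd2 (show (0 : ℝ) < (d : ℝ) ^ 2 + d + 1 by positivity)]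
  have main : ∀ (m : ℕ) (Y : Set (EucSp d)), Y ⊆ Q → Convex ℝ Y → ∀ (a : Fin d → ℝ) (k : Fin d → ℕ),
      ∑ i, k i ≤ m → (∀ y ∈ Y, ∀ i, a i ≤ y i ∧ y i ≤ a i + (k i + 1) * h) → V.Lif Y := by
    intro m
    induction m with
    | zero =>
      intro Y hYQ hYc a k hk hY
      refine small Y hYQ ?_
      intro x hx y hy
      apply hmesh
      intro i
      have hk0 : k i = 0 := by
        have := Finset.sum_eq_zero_iff.1 (Nat.le_zero.1 hk) i (Finset.mem_univ i)
        exact this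
      have h1 := hY x hx i
      have h2 := hY y hy i
      rw [hk0] at h1 h2
      rw [abs_le]
      push_cast at h1 h2
      constructor <;> linarith [h1.1, h1.2, h2.1, h2.2]
    | succ m ih =>
      intro Y hYQ hYc a k hk hY
      by_cases hk0 : ∀ i, k i = 0
      · exact ih Y hYQ hYc a k (by simp [hk0]) hY
      push Not at hk0
      obtain ⟨l, hl⟩ := hk0
      have upd : ∀ n < k l, ∑ i, Function.update k l n i ≤ m := by
        intro n hn
        have : ∑ i, Function.update k l n i < ∑ i, k i := by
          apply Finset.sum_lt_sum
          · intro i _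
            by_cases hil : i = l
            · subst hil; simp [hn.le]
            · simp [hil]
          · exact ⟨l, Finset.mem_univ _, by simpa using hn⟩
        omega
      refine V.glue hYc l (a l + k l * h) ?_ ?_
      · refine ih _ (Set.inter_subset_left.trans hYQ) ?_ a (Function.update k l (k l - 1))
          (upd _ (by omega)) ?_
        · exact hYc.inter (convex_halfSpace_le (f := fun x : EucSp d => x l)
            ⟨fun _ _ => rfl, fun _ _ => rfl⟩ _)
        · rintro y ⟨hy, hy'⟩ i
          by_cases hil : i = l
          · subst hil
            refine ⟨(hY y hy i).1, ?_⟩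
            have : ((k i - 1 : ℕ) : ℝ) = k i - 1 := by
              rw [Nat.cast_sub (by omega)]; simp
            rw [Function.update_self, this]
            have : y i ≤ a i + k i * h := hy'
            linarith
          · rw [Function.update_of_ne hil]
            exact hY y hy i
      · refine ih _ (Set.inter_subset_left.trans hYQ) ?_ (Function.update a l (a l + k l * h))
          (Function.update k l 0) (upd _ (by omega)) ?_
        · exact hYc.inter (convex_halfSpace_ge (f := fun x : EucSp d => x l)
            ⟨fun _ _ => rfl, fun _ _ => rfl⟩ _)
        · rintro y ⟨hy, hy'⟩ i
          by_cases hil : i = l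
          · subst hil
            rw [Function.update_self, Function.update_self]
            refine ⟨hy', ?_⟩
            have := (hY y hy i).2
            push_cast
            linarith
          · rw [Function.update_of_ne hil, Function.update_of_ne hil]
            exact hY y hy i
  obtain ⟨M, hM⟩ := hc.isBounded.exists_norm_le
  obtain ⟨n, hn⟩ := exists_nat_ge (2 * M / h)
  refine main _ Q subset_rfl hQ (fun _ => -M) (fun _ => n) le_rfl ?_
  intro y hy i
  have h1 := hM y hy
  have h2 := PiLp.norm_apply_le y i
  rw [Real.norm_eq_abs] at h2
  have h3 := abs_le.1 (h2.trans h1)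
  refine ⟨h3.1, ?_⟩
  have : 2 * M ≤ n * h := (div_le_iff₀ hh).1 hn
  have h4 := h3.2
  nlinarith

end Cov
end Tri


namespace Tri

variable {d : ℕ} {N : Type} {K : Tri d N}

namespace Cov

variable {X : Type*} (V : K.Cov X)

/-- the wall of a facet -/
noncomputable def _root_.Tri.wall (K : Tri d N) (Φ : K.Fac) (i : Fin (d + 1)) : Finset N :=
  Φ.1.erase (K.vtx Φ i)

lemma wall_S (Φ : K.Fac) (i : Fin (d + 1)) : K.wall Φ i ∈ K.S := K.erase_mem Φ (K.vtx_mem Φ i)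

lemma wall_r (Φ : K.Fac) (i : Fin (d + 1)) : K.wall (K.r i Φ) i = K.wall Φ i := by
  symm
  apply Finset.eq_of_subset_of_card_le
  · intro v hv
    refine Finset.mem_erase.2 ⟨?_, K.r_sub i Φ hv⟩
    rintro rfl
    have h1 := (Finset.mem_erase.1 hv)
    apply h1.1
    have := K.eq_vtx h1.2
    rw [K.rk_vtx] at this
    exact this.symm
  · rw [wall, wall, Finset.card_erase_of_mem (K.vtx_mem _ _),
      Finset.card_erase_of_mem (K.vtx_mem _ _), Φ.2.2, (K.r i Φ).2.2]

lemma seg_wall (Φ : K.Fac) (i : Fin (d + 1)) {z : EucSp d}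
    (hz : z ∈ segment ℝ (K.bary Φ.1) (K.bary (K.wall Φ i))) : K.wall Φ i ⊆ K.car z := by
  obtain ⟨a, c, ha, hc, hac, rfl⟩ := hz
  have hk : 0 < ((Φ.1.card : ℝ)⁻¹) := card_inv_pos (K.ne _ Φ.2.1)
  have hk' : 0 < (((K.wall Φ i).card : ℝ)⁻¹) := card_inv_pos (K.ne _ (wall_S Φ i))
  have hsub : K.wall Φ i ⊆ Φ.1 := Finset.erase_subset _ _
  rw [K.car_eq_filter Φ.2.1 (fun v => a * (Φ.1.card : ℝ)⁻¹ +
      c * (if v ∈ K.wall Φ i then ((K.wall Φ i).card : ℝ)⁻¹ else 0))]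
  · intro v hv
    rw [Finset.mem_filter]
    refine ⟨hsub hv, ?_⟩
    rw [if_pos hv]
    rcases ha.lt_or_eq with h | h
    · positivity
    · have : c = 1 := by linarith
      rw [← h, this]
      simpa using hk'
  · intro v _
    split_ifs <;> positivity
  · rw [Finset.sum_add_distrib, ← Finset.mul_sum, ← Finset.mul_sum, bary_w (K.ne _ Φ.2.1),
      ← Finset.sum_filter, Finset.filter_mem_eq_inter, Finset.inter_eq_right.2 hsub,
      bary_w (K.ne _ (wall_S Φ i)), mul_one, mul_one, hac]
  · have e : ∑ v ∈ Φ.1, (if v ∈ K.wall Φ i then ((K.wall Φ i).card : ℝ)⁻¹ else 0) • K.b v =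
        K.bary (K.wall Φ i) := by
      simp only [ite_smul, zero_smul]
      rw [← Finset.sum_filter, Finset.filter_mem_eq_inter, Finset.inter_eq_right.2 hsub]
      rfl
    simp only [add_smul, mul_smul]
    rw [Finset.sum_add_distrib, ← Finset.smul_sum (r := a) (f := fun v => (Φ.1.card : ℝ)⁻¹ • K.b v),
      ← Finset.smul_sum (r := c)
        (f := fun v => (if v ∈ K.wall Φ i then ((K.wall Φ i).card : ℝ)⁻¹ else 0) • K.b v), e]
    rfl

lemma tri_coords {x y w z : EucSp d} (hz : z ∈ convexHull ℝ ({x, y, w} : Set (EucSp d))) :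
    z ∈ segment ℝ y w ∨ x ∈ affineSpan ℝ ({z, y, w} : Set (EucSp d)) := by
  rw [convexHull_insert (Set.insert_nonempty _ _), convexHull_pair, mem_convexJoin] at hz
  obtain ⟨x', hx', u, hu, hz⟩ := hz
  rw [Set.mem_singleton_iff] at hx'
  subst hx'
  rw [segment_symm, segment_eq_image_lineMap] at hz
  obtain ⟨t, ht, rfl⟩ := hz
  by_cases ht0 : t = 0
  · subst ht0
    left
    simpa using hu
  right
  set L := affineSpan ℝ ({AffineMap.lineMap u x' t, y, w} : Set (EucSp d)) with hL
  have m1 : AffineMap.lineMap u x' t ∈ L := subset_affineSpan ℝ _ (by simp)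
  have m2 : u ∈ L := by
    have : u ∈ affineSpan ℝ ({y, w} : Set (EucSp d)) := by
      rw [← convexHull_pair] at hu
      exact convexHull_subset_affineSpan _ hu
    exact affineSpan_mono ℝ (by intro a ha; exact Or.inr ha) this
  have := AffineMap.lineMap_mem t⁻¹ m2 m1
  rwa [AffineMap.lineMap_lineMap_right, inv_mul_cancel₀ ht0, AffineMap.lineMap_apply_one] at this

lemma tri_compact (x y w : EucSp d) : IsCompact (convexHull ℝ ({x, y, w} : Set (EucSp d))) :=
  (Set.toFinite _).isCompact_convexHull ℝ

/-- simple connectivity -/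
theorem section_exists (e : X) :
    ∃ s : K.Fac → X, s (V.π e) = e ∧ (∀ Φ, V.π (s Φ) = Φ) ∧ ∀ i Φ, s (K.r i Φ) = V.R i (s Φ) := by
  set Φ₀ := V.π e with hΦ₀
  have hcount : Countable ({D : Finset N // D ∈ K.S ∧ D.card + 2 ≤ d} × K.Fac × Fin (d + 1)) := by
    have h1 : Countable {D : Finset N // D ∈ K.S ∧ D.card + 2 ≤ d} :=
      (K.S_countable.mono (s₁ := {D | D ∈ K.S ∧ D.card + 2 ≤ d}) fun D h => h.1).to_subtype
    have h2 : Countable K.Fac :=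
      (K.S_countable.mono (s₁ := {D | D ∈ K.S ∧ D.card = d + 1}) fun D h => h.1).to_subtype
    infer_instance
  obtain ⟨x, hx, hg⟩ := generic
    (fun D : {D : Finset N // D ∈ K.S ∧ D.card + 2 ≤ d} × K.Fac × Fin (d + 1) =>
    insert (K.bary D.2.1.1) (insert (K.bary (K.wall D.2.1 D.2.2)) (D.1.1.image K.b))) (by
      intro D
      have h0 := Finset.card_insert_le (K.bary D.2.1.1)
        (insert (K.bary (K.wall D.2.1 D.2.2)) (D.1.1.image K.b))
      have h1 := Finset.card_insert_le (K.bary (K.wall D.2.1 D.2.2)) (D.1.1.image K.b)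
      have h2 := Finset.card_image_le (s := D.1.1) (f := K.b)
      have := D.1.2.2
      omega) (K.isOpen_fac Φ₀) ⟨_, K.car_bary Φ₀.2.1⟩
  have hx : K.car x = Φ₀.1 := hx
  set T : K.Fac → Fin (d + 1) → Set (EucSp d) := fun Φ i =>
    convexHull ℝ ({x, K.bary Φ.1, K.bary (K.wall Φ i)} : Set (EucSp d)) with hT
  have hTx : ∀ Φ i, x ∈ T Φ i := fun Φ i => subset_convexHull ℝ _ (by simp)
  have hTy : ∀ Φ i, K.bary Φ.1 ∈ T Φ i := fun Φ i => subset_convexHull ℝ _ (by simp)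
  have hTw : ∀ Φ i, K.bary (K.wall Φ i) ∈ T Φ i := fun Φ i => subset_convexHull ℝ _ (by simp)
  have hTc : ∀ Φ i, Convex ℝ (T Φ i) := fun Φ i => convex_convexHull ℝ _
  have hLif : ∀ Φ i, V.Lif (T Φ i) := by
    intro Φ i
    refine V.lif_compact (hTc Φ i) (tri_compact _ _ _) ?_
    intro z hz
    by_contra hlt
    rcases tri_coords hz with h | h
    · have h1 := Finset.card_le_card (seg_wall Φ i h)
      rw [wall, Finset.card_erase_of_mem (K.vtx_mem _ _), Φ.2.2] at h1
      omega
    · apply hg ⟨⟨K.car z, K.car_mem z, by omega⟩, Φ, i⟩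
      refine (affineSpan_le (Q := affineSpan ℝ _)).2 ?_ h
      intro a ha
      rcases ha with rfl | rfl | rfl
      · have h3 : a ∈ convexHull ℝ (K.b '' (K.car a : Set N)) :=
          (K.mem_hull (K.car_mem _)).2 subset_rfl
        refine affineSpan_mono ℝ ?_ (convexHull_subset_affineSpan _ h3)
        intro u hu
        simp only [Finset.coe_insert, Finset.coe_image, Set.mem_insert_iff]
        exact Or.inr (Or.inr hu)
      · exact subset_affineSpan ℝ _ (by simp)
      · exact subset_affineSpan ℝ _ (by simp)
  have hτ : ∀ Φ i, ∃ σ, V.SecOn (T Φ i) σ ∧ σ Φ₀ = e := fun Φ i =>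
    hLif Φ i x (hTx Φ i) Φ₀ hx.subset e rfl
  choose τ hτ1 hτ2 using hτ
  -- the value of the section
  have indep : ∀ Φ i j, τ Φ i Φ = τ Φ j Φ := by
    intro Φ i j
    refine V.sec_unique ((hTc Φ i).inter (hTc Φ j)).isPreconnected
      ((hτ1 Φ i).mono Set.inter_subset_left) ((hτ1 Φ j).mono Set.inter_subset_right)
      (⟨hTx Φ i, hTx Φ j⟩ : x ∈ T Φ i ∩ T Φ j)
      (⟨hTy Φ i, hTy Φ j⟩ : K.bary Φ.1 ∈ T Φ i ∩ T Φ j) hx.subset (K.car_bary Φ.2.1).subset ?_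
    rw [hτ2, hτ2]
  refine ⟨fun Φ => τ Φ 0 Φ, hτ2 _ _, ?_, ?_⟩
  · intro Φ
    exact (hτ1 Φ 0 _ (hTy Φ 0) Φ (K.car_bary Φ.2.1).subset).1
  · intro i Φ
    change τ (K.r i Φ) 0 (K.r i Φ) = V.R i (τ Φ 0 Φ)
    rw [indep (K.r i Φ) 0 i, indep Φ 0 i]
    have hw : K.car (K.bary (K.wall Φ i)) = K.wall Φ i := K.car_bary (wall_S Φ i)
    have s1 : K.car (K.bary (K.wall Φ i)) ⊆ Φ.1 := by
      rw [hw]; exact Finset.erase_subset _ _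
    have s2 : K.car (K.bary (K.wall Φ i)) ⊆ (K.r i Φ).1 := by
      rw [hw]; exact K.r_sub i Φ
    rw [← (hτ1 Φ i _ (hTw Φ i) Φ s1).2 i s2]
    have hw2 : K.bary (K.wall Φ i) ∈ T (K.r i Φ) i := by
      have := hTw (K.r i Φ) i
      rwa [wall_r] at this
    refine V.sec_unique ((hTc (K.r i Φ) i).inter (hTc Φ i)).isPreconnected
      ((hτ1 _ i).mono Set.inter_subset_left) ((hτ1 Φ i).mono Set.inter_subset_right)
      (⟨hTx _ i, hTx Φ i⟩ : x ∈ T (K.r i Φ) i ∩ T Φ i)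
      (⟨hw2, hTw Φ i⟩ : K.bary (K.wall Φ i) ∈ T (K.r i Φ) i ∩ T Φ i) hx.subset s2 ?_
    rw [hτ2, hτ2]

end Cov
end Tri


/-- Abstract properties of the flag graph of a two-orbit tiling. -/
structure Sys (n : ℕ) (F : Type) where
  r : Fin n → F → F
  col : F → Bool
  inv : ∀ i Φ, r i (r i Φ) = Φ
  nofix : ∀ i Φ, r i Φ ≠ Φ
  ne : ∀ i j Φ, i ≠ j → r i Φ ≠ r j Φ
  comm : ∀ (i j : Fin n) Φ, (i : ℕ) + 2 ≤ j → r i (r j Φ) = r j (r i Φ)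
  four : ∀ (i j : Fin n) Φ, (i : ℕ) + 1 = j → r i (r j (r i (r j Φ))) ≠ Φ
  aut : ∀ Φ Ψ, col Φ = col Ψ → ∃ g : F → F, (∀ i Ω, g (r i Ω) = r i (g Ω)) ∧ g Φ = Ψ
  aut' : ∀ g : F → F, (∀ i Ω, g (r i Ω) = r i (g Ω)) → ∀ Φ, col (g Φ) = col Φ
  onto : ∀ c, ∃ Φ, col Φ = c
  conn : ∀ W : Set F, (∀ Φ ∈ W, ∀ i, r i Φ ∈ W) → ∀ Φ ∈ W, ∀ Ψ, Ψ ∈ W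
  fin : ∀ (i : Fin n) (Φ : F), ∃ Z : Set F, Z.Finite ∧ Φ ∈ Z ∧ ∀ Ψ ∈ Z, ∀ j, j ≠ i → r j Ψ ∈ Z
  lift : ∀ (X : Type) (π : X → F) (R : Fin n → X → X), (∀ i x, π (R i x) = r i (π x)) →
    (∀ i x, R i (R i x) = x) →
    (∀ i j, i ≠ j → ∀ x (k : ℕ), (r i ∘ r j)^[k] (π x) = π x → (R i ∘ R j)^[k] x = x) →
    ∀ e, ∃ s : F → X, s (π e) = e ∧ (∀ Φ, π (s Φ) = Φ) ∧ ∀ i Φ, s (r i Φ) = R i (s Φ)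

namespace Sys

variable {n : ℕ} {F : Type} (Q : Sys n F)

/-- adjacency of ranks -/
def Ad (i j : Fin n) : Prop := (i : ℕ) + 1 = j ∨ (j : ℕ) + 1 = i

lemma Ad.symm {i j : Fin n} (h : Ad i j) : Ad j i := Or.symm h

lemma Ad.ne {i j : Fin n} (h : Ad i j) : i ≠ j := by
  rintro rfl
  rcases h with h | h <;> omega

lemma commute {i j : Fin n} (hij : i ≠ j) (h : ¬ Ad i j) (Φ : F) :
    Q.r i (Q.r j Φ) = Q.r j (Q.r i Φ) := by
  unfold Ad at h
  have : (i : ℕ) ≠ j := fun h => hij (Fin.ext h)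
  rcases Nat.lt_or_ge (i : ℕ) j with h1 | h1
  · exact Q.comm i j Φ (by omega)
  · exact (Q.comm j i Φ (by omega)).symm

/-- dual system -/
def dual : Sys n F where
  r i := Q.r i.rev
  col := Q.col
  inv i := Q.inv _
  nofix i := Q.nofix _
  ne i j Φ h := Q.ne _ _ _ (fun e => h (Fin.rev_injective e))
  comm i j Φ h := (Q.comm j.rev i.rev Φ (by rw [Fin.val_rev, Fin.val_rev]; omega)).symm
  four i j Φ h := by
    intro e
    have h1 := Q.four j.rev i.rev Φ (by rw [Fin.val_rev, Fin.val_rev]; omega)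
    apply h1
    have := congrArg (fun Ω => Q.r j.rev (Q.r i.rev (Q.r j.rev (Q.r i.rev Ω)))) e
    simp only [Q.inv] at this
    exact this.symm
  aut Φ Ψ h := by
    obtain ⟨g, h1, h2⟩ := Q.aut Φ Ψ h
    exact ⟨g, fun i Ω => h1 _ Ω, h2⟩
  aut' g hg := Q.aut' g fun i Ω => by
    have := hg i.rev Ω
    rwa [Fin.rev_rev] at this
  onto := Q.onto
  conn W hW := Q.conn W fun Φ hΦ i => by
    have := hW Φ hΦ i.rev
    rwa [Fin.rev_rev] at this
  fin i Φ := by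
    obtain ⟨Z, h1, h2, h3⟩ := Q.fin i.rev Φ
    exact ⟨Z, h1, h2, fun Ψ hΨ j hj => h3 Ψ hΨ _ fun e => hj (Fin.rev_injective e)⟩
  lift X π R h1 h2 h3 e := by
    obtain ⟨s, a1, a2, a3⟩ := Q.lift X π (fun i => R i.rev) (fun i x => by
      rw [h1, Fin.rev_rev]) (fun i x => h2 _ x) (fun i j hij x k hk =>
        h3 i.rev j.rev (fun e => hij (Fin.rev_injective e)) x k (by
          rw [Fin.rev_rev, Fin.rev_rev]; exact hk)) e
    exact ⟨s, a1, a2, fun i Φ => by rw [a3, Fin.rev_rev]⟩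

/-- a flag of given colour -/
noncomputable def pick (c : Bool) : F := (Q.onto c).choose

lemma col_pick (c : Bool) : Q.col (Q.pick c) = c := (Q.onto c).choose_spec

lemma iter_g {g : F → F} (hg : ∀ i Ω, g (Q.r i Ω) = Q.r i (g Ω)) (i j : Fin n) (k : ℕ) (Φ : F) :
    g ((Q.r i ∘ Q.r j)^[k] Φ) = (Q.r i ∘ Q.r j)^[k] (g Φ) := by
  have : Function.Semiconj g (Q.r i ∘ Q.r j) (Q.r i ∘ Q.r j) := by
    intro Ω
    simp only [Function.comp_apply, hg]
  exact (this.iterate_right k) Φ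

lemma per_dvd {Φ Ψ : F} (h : Q.col Φ = Q.col Ψ) (i j : Fin n) :
    Function.minimalPeriod (Q.r i ∘ Q.r j) Ψ ∣ Function.minimalPeriod (Q.r i ∘ Q.r j) Φ := by
  obtain ⟨g, hg, rfl⟩ := Q.aut Φ Ψ h
  apply Function.IsPeriodicPt.minimalPeriod_dvd
  change (Q.r i ∘ Q.r j)^[_] (g Φ) = g Φ
  rw [← Q.iter_g hg, Function.iterate_minimalPeriod]

/-- the period, depends on the colour -/
noncomputable def m (i j : Fin n) (c : Bool) : ℕ :=
  Function.minimalPeriod (Q.r i ∘ Q.r j) (Q.pick c)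

lemma m_col (i j : Fin n) (Φ : F) :
    Q.m i j (Q.col Φ) = Function.minimalPeriod (Q.r i ∘ Q.r j) Φ :=
  Nat.dvd_antisymm (Q.per_dvd (Q.col_pick _).symm i j) (Q.per_dvd (Q.col_pick _) i j)

lemma iter_iff (i j : Fin n) (Φ : F) (k : ℕ) :
    (Q.r i ∘ Q.r j)^[k] Φ = Φ ↔ Q.m i j (Q.col Φ) ∣ k := by
  rw [Q.m_col]
  exact Function.isPeriodicPt_iff_minimalPeriod_dvd

lemma m_eq_of {i j i' j' : Fin n} {c c' : Bool} {Φ Ψ : F} (hc : Q.col Φ = c) (hc' : Q.col Ψ = c')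
    (h : ∀ k, (Q.r i ∘ Q.r j)^[k] Φ = Φ ↔ (Q.r i' ∘ Q.r j')^[k] Ψ = Ψ) :
    Q.m i j c = Q.m i' j' c' := by
  subst hc hc'
  apply Nat.dvd_antisymm
  · rw [← Q.iter_iff, h, Q.iter_iff]
  · rw [← Q.iter_iff, ← h, Q.iter_iff]

lemma inv_iter {X : Type*} {f g : X → X} (h : ∀ x, f (g x) = x) (h' : ∀ x, g (f x) = x) (k : ℕ)
    (x : X) : f^[k] x = x ↔ g^[k] x = x := by
  have e1 : ∀ x, f^[k] (g^[k] x) = x := Function.LeftInverse.iterate h k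
  have e2 : ∀ x, g^[k] (f^[k] x) = x := Function.LeftInverse.iterate h' k
  constructor
  · intro hx
    have := e2 x
    rwa [hx] at this
  · intro hx
    have := e1 x
    rwa [hx] at this

lemma m_symm (i j : Fin n) (c : Bool) : Q.m i j c = Q.m j i c := by
  refine Q.m_eq_of (Q.col_pick c) (Q.col_pick c) fun k => inv_iter ?_ ?_ k _
  · intro x; simp [Q.inv]
  · intro x; simp [Q.inv]

lemma m_r_left (i j : Fin n) (Φ : F) : Q.m i j (Q.col (Q.r i Φ)) = Q.m i j (Q.col Φ) := by
  rw [Q.m_symm i j (Q.col Φ)]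
  refine Q.m_eq_of rfl rfl fun k => ?_
  have : Function.Semiconj (Q.r i) (Q.r j ∘ Q.r i) (Q.r i ∘ Q.r j) := fun x => rfl
  rw [← (this.iterate_right k) Φ]
  exact (Function.LeftInverse.injective (Q.inv i)).eq_iff

lemma m_r_right (i j : Fin n) (Φ : F) : Q.m i j (Q.col (Q.r j Φ)) = Q.m i j (Q.col Φ) := by
  rw [Q.m_symm i j, Q.m_symm i j]
  exact Q.m_r_left j i Φ

lemma m_r_far {i j l : Fin n} (h1 : l ≠ i) (h2 : l ≠ j) (h3 : ¬ Ad l i) (h4 : ¬ Ad l j) (Φ : F) :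
    Q.m i j (Q.col (Q.r l Φ)) = Q.m i j (Q.col Φ) := by
  refine Q.m_eq_of rfl rfl fun k => ?_
  have : Function.Semiconj (Q.r l) (Q.r i ∘ Q.r j) (Q.r i ∘ Q.r j) := by
    intro x
    simp only [Function.comp_apply]
    rw [Q.commute h1 h3, Q.commute h2 h4]
  rw [← (this.iterate_right k) Φ]
  exact (Function.LeftInverse.injective (Q.inv l)).eq_iff

/-- colour flipping generators -/
def J (k : Fin n) : Prop := ∀ Φ, Q.col (Q.r k Φ) = !(Q.col Φ)

lemma col_r_congr {Φ Ψ : F} (h : Q.col Φ = Q.col Ψ) (k : Fin n) :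
    Q.col (Q.r k Φ) = Q.col (Q.r k Ψ) := by
  obtain ⟨g, hg, rfl⟩ := Q.aut Φ Ψ h
  rw [← hg, Q.aut' g hg]

lemma not_J {k : Fin n} (h : ¬ Q.J k) (Φ : F) : Q.col (Q.r k Φ) = Q.col Φ := by
  unfold J at h
  push Not at h
  obtain ⟨Ψ, hΨ⟩ := h
  have hΨ : Q.col (Q.r k Ψ) = Q.col Ψ := by
    cases h1 : Q.col (Q.r k Ψ) <;> cases h2 : Q.col Ψ <;> simp_all
  by_cases hc : Q.col Φ = Q.col Ψ
  · rw [Q.col_r_congr hc, hΨ, hc]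
  · by_contra hne
    have h1 : Q.col (Q.r k Φ) = Q.col Ψ := by
      cases h1 : Q.col (Q.r k Φ) <;> cases h2 : Q.col Ψ <;> cases h3 : Q.col Φ <;> simp_all
    have h2 := Q.col_r_congr h1 k
    rw [Q.inv, hΨ] at h2
    exact hc h2

/-- action on colours -/
noncomputable def kap (k : Fin n) (c : Bool) : Bool := if Q.J k then !c else c

lemma col_r (k : Fin n) (Φ : F) : Q.col (Q.r k Φ) = Q.kap k (Q.col Φ) := by
  unfold kap
  split_ifs with h
  · exact h Φ
  · exact Q.not_J h Φ

lemma exists_J : ∃ k, Q.J k := by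
  by_contra h
  push Not at h
  have := Q.conn {Φ | Q.col Φ = true} (fun Φ hΦ i => by
    rw [Set.mem_setOf_eq, Q.not_J (h i)]; exact hΦ) (Q.pick true) (Q.col_pick _) (Q.pick false)
  rw [Set.mem_setOf_eq, Q.col_pick] at this
  exact absurd this (by simp)

lemma m_flip_left {i : Fin n} (h : Q.J i) (j : Fin n) (c c' : Bool) : Q.m i j c = Q.m i j c' := by
  have h1 := Q.m_r_left i j (Q.pick false)
  rw [h, Q.col_pick] at h1
  cases c <;> cases c' <;> simp_all

lemma m_flip_right {j : Fin n} (h : Q.J j) (i : Fin n) (c c' : Bool) : Q.m i j c = Q.m i j c' := by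
  rw [Q.m_symm i j, Q.m_symm i j]
  exact Q.m_flip_left h i c c'

lemma m_flip_far {i j l : Fin n} (h : Q.J l) (h1 : l ≠ i) (h2 : l ≠ j) (h3 : ¬ Ad l i)
    (h4 : ¬ Ad l j) (c c' : Bool) : Q.m i j c = Q.m i j c' := by
  have h1 := Q.m_r_far h1 h2 h3 h4 (Q.pick false)
  rw [h, Q.col_pick] at h1
  cases c <;> cases c' <;> simp_all

lemma m_ne_one {i j : Fin n} (h : i ≠ j) (c : Bool) : Q.m i j c ≠ 1 := by
  intro e
  have := (Q.iter_iff i j (Q.pick c) 1).2 (by rw [Q.col_pick, e])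
  simp only [Function.iterate_one, Function.comp_apply] at this
  apply Q.ne j i (Q.pick c) (Ne.symm h)
  have := congrArg (Q.r i) this
  rwa [Q.inv] at this

lemma m_far {i j : Fin n} (h : i ≠ j) (h' : ¬ Ad i j) (c : Bool) : Q.m i j c = 2 := by
  have : Q.m i j c ∣ 2 := by
    conv_lhs => rw [← Q.col_pick c]
    rw [← Q.iter_iff]
    simp only [Function.iterate_succ, Function.iterate_zero, Function.comp_apply, id]
    rw [Q.commute h h', Q.inv, Q.inv]
  rcases (Nat.dvd_prime Nat.prime_two).1 this with h1 | h1
  · exact absurd h1 (Q.m_ne_one h c)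
  · exact h1

lemma m_ne_two {i j : Fin n} (h : Ad i j) (c : Bool) : Q.m i j c ≠ 2 := by
  have key : ∀ i j : Fin n, (i : ℕ) + 1 = j → Q.m i j c ≠ 2 := by
    intro i j h e
    have := (Q.iter_iff i j (Q.pick c) 2).2 (by rw [Q.col_pick, e])
    exact Q.four i j _ h this
  rcases h with h | h
  · exact key i j h
  · rw [Q.m_symm]
    exact key j i h

lemma m_pos (hn : 3 ≤ n) (i j : Fin n) (c : Bool) : 0 < Q.m i j c := by
  obtain ⟨l, hl1, hl2⟩ : ∃ l : Fin n, l ≠ i ∧ l ≠ j := by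
    by_contra hcon
    push Not at hcon
    have : (Finset.univ : Finset (Fin n)) ⊆ {i, j} := by
      intro l _
      by_cases h : l = i
      · simp [h]
      · simp [hcon l h]
    have h1 := Finset.card_le_card this
    have h2 := Finset.card_le_two (a := i) (b := j)
    rw [Finset.card_univ, Fintype.card_fin] at h1
    omega
  obtain ⟨Z, hZ, hZ1, hZ2⟩ := Q.fin l (Q.pick c)
  have hmaps : ∀ k, (Q.r i ∘ Q.r j)^[k] (Q.pick c) ∈ Z := by
    intro k
    induction k with
    | zero => exact hZ1
    | succ k ih =>
      rw [Function.iterate_succ_apply']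
      exact hZ2 _ (hZ2 _ ih j hl2.symm) i hl1.symm
  have hinj : Function.Injective (Q.r i ∘ Q.r j) :=
    (Function.LeftInverse.injective (Q.inv i)).comp (Function.LeftInverse.injective (Q.inv j))
  obtain ⟨a, -, b, -, hab, he⟩ := Set.infinite_univ.exists_lt_map_eq_of_mapsTo
    (s := (Set.univ : Set ℕ)) (fun k _ => hmaps k) hZ
  have := Function.iterate_cancel hinj (m := a) (n := b) (a := Q.pick c) he
  have h2 : (Q.r i ∘ Q.r j)^[b - a] (Q.pick c) = Q.pick c := by
    have e : b = a + (b - a) := by omega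
    rw [e, Function.iterate_add_apply] at he
    exact (hinj.iterate a he).symm
  rw [Q.iter_iff, Q.col_pick] at h2
  exact Nat.pos_of_dvd_of_pos h2 (by omega)

lemma m_ge_three (hn : 3 ≤ n) {i j : Fin n} (h : Ad i j) (c : Bool) : 3 ≤ Q.m i j c := by
  have := Q.m_pos hn i j c
  have := Q.m_ne_one h.ne c
  have := Q.m_ne_two h c
  omega

lemma even_of_flip {i j : Fin n} (hi : ¬ Q.J i) (hj : Q.J j) {Φ : F} {k : ℕ}
    (h : (Q.r i ∘ Q.r j)^[k] Φ = Φ) : Even k := by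
  have key : ∀ k, Q.col ((Q.r i ∘ Q.r j)^[k] Φ) = (if Even k then Q.col Φ else !(Q.col Φ)) := by
    intro k
    induction k with
    | zero => simp
    | succ k ih =>
      rw [Function.iterate_succ_apply', Function.comp_apply, Q.not_J hi, hj, ih]
      by_cases hk : Even k
      · simp [hk, Nat.even_add_one]
      · simp [hk, Nat.even_add_one]
  by_contra hk
  have := key k
  rw [h, if_neg hk] at this
  simp at this

lemma m_even {i j : Fin n} (hi : ¬ Q.J i) (hj : Q.J j) (c : Bool) : Even (Q.m i j c) :=
  Q.even_of_flip hi hj (Function.iterate_minimalPeriod (f := Q.r i ∘ Q.r j) (x := Q.pick c))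

/-- If the periods are colour independent there is a colour-swapping automorphism. -/
lemma exists_dep : ∃ i j, Ad i j ∧ Q.m i j false ≠ Q.m i j true := by
  by_contra hcon
  push Not at hcon
  have hm : ∀ i j, i ≠ j → ∀ c c', Q.m i j c = Q.m i j c' := by
    intro i j hij c c'
    by_cases h : Ad i j
    · have := hcon i j h
      cases c <;> cases c' <;> simp_all
    · rw [Q.m_far hij h, Q.m_far hij h]
  have hit : ∀ i j (k : ℕ) (x : F × F),
      ((fun x : F × F => (Q.r i x.1, Q.r i x.2)) ∘ fun x : F × F => (Q.r j x.1, Q.r j x.2))^[k] x =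
      ((Q.r i ∘ Q.r j)^[k] x.1, (Q.r i ∘ Q.r j)^[k] x.2) := by
    intro i j k
    induction k with
    | zero => intro x; rfl
    | succ k ih =>
      intro x
      rw [Function.iterate_succ_apply, ih]
      rfl
  obtain ⟨s, h1, h2, h3⟩ := Q.lift (F × F) Prod.fst (fun i x => (Q.r i x.1, Q.r i x.2))
    (fun i x => rfl) (fun i x => by simp [Q.inv]) (fun i j hij x k hk => by
      rw [hit, hk]
      rw [Q.iter_iff, hm i j hij _ (Q.col x.2), ← Q.iter_iff] at hk
      rw [hk]) (Q.pick false, Q.pick true)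
  have := Q.aut' (fun Φ => (s Φ).2) (fun i Ω => by rw [h3]) (Q.pick false)
  simp only at h1
  rw [h1] at this
  simp only [Q.col_pick] at this
  exact absurd this (by simp)

end Sys


namespace Refl

/-- cosine entry of a Coxeter form -/
noncomputable def cs (m : ℕ) : ℝ := -Real.cos (Real.pi / m)

lemma S_zero_even (k : ℕ) (hk : 2 ≤ k) (θ : ℝ) (hθ : (k : ℝ) * θ = Real.pi) :
    (Polynomial.Chebyshev.S ℝ ((k : ℤ) - 1)).eval (2 * Real.cos θ) = 0 := by
  have h1 := Polynomial.Chebyshev.S_two_mul_real_cos θ ((k : ℤ) - 1)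
  have hk' : (2 : ℝ) ≤ k := by exact_mod_cast hk
  have hpi := Real.pi_pos
  have h0 : 0 < θ := by nlinarith
  have h2 : θ < Real.pi := by nlinarith
  have h3 := Real.sin_pos_of_pos_of_lt_pi h0 h2
  push_cast at h1
  rw [sub_add_cancel, hθ, Real.sin_pi] at h1
  exact (mul_eq_zero.1 h1).resolve_right h3.ne'

lemma S_zero_odd (k : ℕ) (hk : 1 ≤ k) (θ : ℝ) (hθ : (2 * k + 1 : ℝ) * θ = 2 * Real.pi) :
    (Polynomial.Chebyshev.S ℝ (k : ℤ)).eval (2 * Real.cos θ) +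
    (Polynomial.Chebyshev.S ℝ ((k : ℤ) - 1)).eval (2 * Real.cos θ) = 0 := by
  have h1 := Polynomial.Chebyshev.S_two_mul_real_cos θ ((k : ℤ) - 1)
  have h1' := Polynomial.Chebyshev.S_two_mul_real_cos θ (k : ℤ)
  have hk' : (1 : ℝ) ≤ k := by exact_mod_cast hk
  have hpi := Real.pi_pos
  have h0 : 0 < θ := by nlinarith
  have h2 : θ < Real.pi := by nlinarith
  have h3 := Real.sin_pos_of_pos_of_lt_pi h0 h2
  push_cast at h1 h1'
  rw [sub_add_cancel] at h1
  have e : (k + 1 : ℝ) * θ = 2 * Real.pi - k * θ := by linarith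
  rw [e, Real.sin_two_pi_sub] at h1'
  have : ((Polynomial.Chebyshev.S ℝ (k : ℤ)).eval (2 * Real.cos θ) +
    (Polynomial.Chebyshev.S ℝ ((k : ℤ) - 1)).eval (2 * Real.cos θ)) * Real.sin θ = 0 := by
    rw [add_mul, h1, h1']; ring
  exact (mul_eq_zero.1 this).resolve_right h3.ne'

lemma refl_pow {V : Type*} [AddCommGroup V] [Module ℝ V] {x y : V} {f g : Module.Dual ℝ V}
    (hf : f x = 2) (hg : g y = 2) (m : ℕ) (hm : 2 ≤ m) (h1 : f y = 2 * cs m) (h2 : g x = 2 * cs m) :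
    (Module.reflection hf * Module.reflection hg) ^ m = 1 := by
  rcases Nat.eq_or_lt_of_le hm with h | h
  · subst h
    have hc : cs 2 = 0 := by simp [cs]
    rw [hc, mul_zero] at h1 h2
    ext z
    have e1 : (1 : V ≃ₗ[ℝ] V) z = z := rfl
    simp only [pow_two, LinearEquiv.mul_apply, Module.reflection_apply, map_sub, map_smul, h1, h2,
      hf, hg, e1]
    module
  · have ht : (2 * Real.cos (2 * Real.pi / m)) = f y * g x - 2 := by
      rw [h1, h2, cs]
      have : 2 * Real.pi / m = 2 * (Real.pi / m) := by ring
      rw [this, Real.cos_two_mul]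
      ring
    have hm0 : (m : ℝ) ≠ 0 := by positivity
    ext z
    rw [Module.reflection_mul_reflection_pow_apply hf hg m z _ ht, show (1 : V ≃ₗ[ℝ] V) z = z from rfl]
    rcases Nat.even_or_odd' m with ⟨k, hk | hk⟩
    · have hS := S_zero_even k (by omega) (2 * Real.pi / m) (by
        have hk0 : (k : ℝ) ≠ 0 := by
          have : k ≠ 0 := by omega
          exact_mod_cast this
        rw [hk]; push_cast; field_simp)
      have e1 : ((m : ℤ) - 2) / 2 = (k : ℤ) - 1 := by omega
      have e2 : ((m : ℤ) - 1) / 2 = (k : ℤ) - 1 := by omega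
      rw [e1, e2, hS]
      simp
    · have hS := S_zero_odd k (by omega) (2 * Real.pi / m) (by
        rw [hk] at hm0 ⊢; push_cast at hm0 ⊢; field_simp)
      have e1 : ((m : ℤ) - 2) / 2 = (k : ℤ) - 1 := by omega
      have e2 : ((m : ℤ) - 1) / 2 = (k : ℤ) := by omega
      have e3 : ((m : ℤ) - 3) / 2 = (k : ℤ) - 1 := by omega
      have e4 : ((m : ℤ)) / 2 = (k : ℤ) := by omega
      rw [e1, e2, e3, e4, hS]
      simp

variable {S : Type} [Fintype S] (B : S → S → ℝ)

/-- the linear form -/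
noncomputable def form (s : S) : Module.Dual ℝ (S → ℝ) :=
  ∑ t, (2 * B t s) • (LinearMap.proj t : (S → ℝ) →ₗ[ℝ] ℝ)

lemma form_apply (s : S) (v : S → ℝ) : form B s v = ∑ t, 2 * B t s * v t := by
  simp [form]

lemma form_single (s t : S) : form B s (Pi.single t 1) = 2 * B t s := by
  rw [form_apply, Finset.sum_eq_single t]
  · simp
  · intro b _ hb; simp [hb]
  · simp

variable {B} (hB1 : ∀ s, B s s = 1) 

/-- reflections -/
noncomputable def rho (s : S) : (S → ℝ) ≃ₗ[ℝ] (S → ℝ) :=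
  Module.reflection (x := (Pi.single s 1 : S → ℝ)) (f := form B s) (by
    rw [form_single, hB1, mul_one])

lemma rho_apply (s : S) (v : S → ℝ) : rho hB1 s v = v - (form B s v) • (Pi.single s 1 : S → ℝ) :=
  Module.reflection_apply _ _

lemma rho_sq (s : S) : rho hB1 s * rho hB1 s = 1 := by
  ext v
  exact congrFun (Module.involutive_reflection (x := (Pi.single s 1 : S → ℝ)) (f := form B s) (by
    rw [form_single, hB1, mul_one]) v) _

lemma rho_pow (hsym : ∀ s t, B s t = B t s) (s t : S) (m : ℕ) (hm : 2 ≤ m) (h : B s t = cs m) :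
    (rho hB1 s * rho hB1 t) ^ m = 1 := by
  apply refl_pow _ _ m hm
  · rw [form_single, hsym, h]
  · rw [form_single, h]

/-- permutation maps -/
noncomputable def perm (τ : S ≃ S) : (S → ℝ) ≃ₗ[ℝ] (S → ℝ) := LinearEquiv.funCongrLeft ℝ ℝ τ

lemma perm_apply (τ : S ≃ S) (v : S → ℝ) (s : S) : perm τ v s = v (τ s) := rfl

lemma perm_mul (τ σ : S ≃ S) : perm τ * perm σ = perm (τ.trans σ) := by
  ext v s
  rfl

lemma perm_refl : perm (Equiv.refl S) = 1 := by
  ext v s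
  rfl

lemma conj (τ : S ≃ S) (hτ : ∀ s, τ (τ s) = s) (hB : ∀ s t, B (τ s) (τ t) = B s t) (s : S) :
    perm τ * rho hB1 s * perm τ = rho hB1 (τ s) := by
  ext v t
  have hs : τ.symm = τ := Equiv.ext fun s => by rw [Equiv.symm_apply_eq, hτ]
  simp only [LinearEquiv.mul_apply, perm_apply, rho_apply, Pi.sub_apply, Pi.smul_apply, hτ,
    smul_eq_mul]
  congr 2
  · rw [form_apply, form_apply]
    apply Fintype.sum_equiv τ
    intro u
    rw [perm_apply, hB]
  · have : τ t = s ↔ t = τ s := ⟨fun h => by rw [← h, hτ], fun h => by rw [h, hτ]⟩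
    simp [Pi.single_apply, this]

lemma fin_lemma (hsym : ∀ s t, B s t = B t s) (M : Finset ((S → ℝ) ≃ₗ[ℝ] (S → ℝ))) (hM : M.Nonempty)
    {q : ℕ} (u : Fin q → S) (hu : Function.Injective u)
    (hcl : ∀ g ∈ M, ∀ a, g * rho hB1 (u a) ∈ M)
    (hcon : ∀ f : Fin q → ℝ, (∀ a b, B (u a) (u b) ≠ 0 → f a = f b) → ∀ a b, f a = f b)
    (v : Fin q → ℝ) (hv : v ≠ 0) : 0 < ∑ a, ∑ b, v a * v b * B (u a) (u b) := by
  set I : (S → ℝ) → (S → ℝ) → ℝ := fun x y => ∑ g ∈ M, (g x) ⬝ᵥ (g y) with hI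
  have Ipos : ∀ x, x ≠ 0 → 0 < I x x := by
    intro x hx
    apply Finset.sum_pos _ hM
    intro g _
    have hg : g x ≠ 0 := by
      rw [Ne, LinearEquiv.map_eq_zero_iff]; exact hx
    have h0 : g x ⬝ᵥ g x ≠ 0 := fun h => hg (dotProduct_self_eq_zero.1 h)
    have h1 : 0 ≤ g x ⬝ᵥ g x := Finset.sum_nonneg fun i _ => mul_self_nonneg _
    exact lt_of_le_of_ne h1 (Ne.symm h0)
  have Icomm : ∀ x y, I x y = I y x := fun x y => by
    simp only [hI]; exact Finset.sum_congr rfl fun g _ => dotProduct_comm _ _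
  have Iadd : ∀ x y z, I (x + y) z = I x z + I y z := fun x y z => by
    simp only [hI, map_add, add_dotProduct, Finset.sum_add_distrib]
  have Ismul : ∀ (c : ℝ) y z, I (c • y) z = c * I y z := fun c y z => by
    simp only [hI, map_smul, smul_dotProduct, Finset.mul_sum, smul_eq_mul]
  have Isum : ∀ (c : Fin q → ℝ) (y : Fin q → S → ℝ) z, I (∑ a, c a • y a) z = ∑ a, c a * I (y a) z := by
    intro c y z
    have : ∀ T : Finset (Fin q), I (∑ a ∈ T, c a • y a) z = ∑ a ∈ T, c a * I (y a) z := by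
      intro T
      induction T using Finset.induction_on with
      | empty => simp [hI]
      | insert a T ha ih => rw [Finset.sum_insert ha, Finset.sum_insert ha, Iadd, Ismul, ih]
    exact this _
  have Iinv : ∀ a x y, I (rho hB1 (u a) x) (rho hB1 (u a) y) = I x y := by
    intro a x y
    simp only [hI]
    refine Finset.sum_bij' (fun g _ => g * rho hB1 (u a)) (fun g _ => g * rho hB1 (u a))
      (fun g hg => hcl g hg a) (fun g hg => hcl g hg a) ?_ ?_ ?_
    · intro g _; rw [mul_assoc, rho_sq, mul_one]
    · intro g _; rw [mul_assoc, rho_sq, mul_one]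
    · intro g _; rfl
  set e : Fin q → S → ℝ := fun a => Pi.single (u a) 1 with he
  have Ie : ∀ a x, 2 * I x (e a) = form B (u a) x * I (e a) (e a) := by
    intro a x
    have h1 := Iinv a x (e a)
    have h2 : rho hB1 (u a) (e a) = (-1 : ℝ) • e a := by
      rw [rho_apply, he]
      simp only [form_single, hB1]
      module
    have h3 : rho hB1 (u a) x = x + (-(form B (u a) x)) • e a := by
      rw [rho_apply, he]; module
    rw [h2, h3, Iadd, Ismul, Icomm x, Icomm (e a), Ismul, Ismul, Icomm (e a) x] at h1
    linarith
  have Iee : ∀ a b, I (e a) (e b) = B (u a) (u b) * I (e b) (e b) := by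
    intro a b
    have := Ie b (e a)
    simp only [he] at this ⊢
    rw [form_single] at this
    linarith
  have hconst : ∀ a b, I (e a) (e a) = I (e b) (e b) := by
    apply hcon (fun a => I (e a) (e a))
    intro a b hab
    have h1 := Iee a b
    have h2 := Iee b a
    rw [Icomm, h1, hsym (u b)] at h2
    exact (mul_left_cancel₀ hab h2).symm
  obtain ⟨a0, ha0⟩ : ∃ a0, v a0 ≠ 0 := by
    by_contra h; push Not at h; exact hv (funext h)
  have hx : (∑ a, v a • e a) ≠ 0 := by
    intro h
    have := congrFun h (u a0)
    rw [Finset.sum_apply, Finset.sum_eq_single a0] at this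
    · simp [he] at this; exact ha0 this
    · intro b _ hb
      have : u a0 ≠ u b := fun h => hb (hu h).symm
      simp [he, this]
    · simp
  have h1 := Ipos _ hx
  have e0 : 0 < I (e a0) (e a0) := Ipos _ (by
    intro h
    have := congrFun h (u a0)
    simp [he] at this)
  have : I (∑ a, v a • e a) (∑ a, v a • e a) = (∑ a, ∑ b, v a * v b * B (u a) (u b)) * I (e a0) (e a0) := by
    rw [Isum, Finset.sum_mul]
    refine Finset.sum_congr rfl fun a _ => ?_
    rw [Icomm, Isum, Finset.mul_sum, Finset.sum_mul]
    refine Finset.sum_congr rfl fun b _ => ?_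
    rw [Iee, hconst a a0, hsym]
    ring
  rw [this] at h1
  exact pos_of_mul_pos_left h1 e0.le

end Refl


namespace Sys

variable {n : ℕ} {F : Type} (Q : Sys n F)

lemma kap_J {k : Fin n} (h : Q.J k) (c : Bool) : Q.kap k c = !c := if_pos h
lemma kap_nJ {k : Fin n} (h : ¬ Q.J k) (c : Bool) : Q.kap k c = c := if_neg h

/-- lifted involution on the product with a group -/
def RX {G : Type} [Group G] (h : Fin n → Bool → G) (k : Fin n) (x : F × G) : F × G :=
  (Q.r k x.1, x.2 * h k (Q.col x.1))

lemma iter_mul {G : Type} [Group G] (f : F × G → F × G) (p : F → F) (a : Bool → G)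
    (hc : ∀ Φ, Q.col (p Φ) = Q.col Φ)
    (hf : ∀ x, f x = (p x.1, x.2 * a (Q.col x.1))) (k : ℕ) (x : F × G) :
    f^[k] x = (p^[k] x.1, x.2 * (a (Q.col x.1)) ^ k) := by
  induction k generalizing x with
  | zero => simp
  | succ k ih =>
    rw [Function.iterate_succ_apply, ih, hf]
    simp only [hc, Function.iterate_succ_apply, pow_succ', mul_assoc]

lemma cocycle (G : Type) [Group G] (h : Fin n → Bool → G)
    (h1 : ∀ k c, h k c * h k (Q.kap k c) = 1)
    (h2 : ∀ i j, i ≠ j → (Q.J i ↔ Q.J j) → ∀ c, (h j c * h i (Q.kap j c)) ^ (Q.m i j c) = 1)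
    (h3 : ∀ i j, ¬ Q.J i → Q.J j → ∀ c,
      (h j c * h i (!c) * h j (!c) * h i c) ^ (Q.m i j c / 2) = 1) :
    ∃ g : F → G, ∀ k Φ, g (Q.r k Φ) = g Φ * h k (Q.col Φ) := by
  have hinv : ∀ i x, Q.RX h i (Q.RX h i x) = x := by
    intro i x
    unfold RX
    simp only [Q.inv, Q.col_r, mul_assoc, h1, mul_one]
  have A : ∀ i j, ¬ Q.J i → Q.J j → ∀ x (k : ℕ), (Q.r i ∘ Q.r j)^[k] x.1 = x.1 →
      (Q.RX h i ∘ Q.RX h j)^[k] x = x := by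
    intro i j hi hj x k hk
    obtain ⟨k', rfl⟩ := Q.even_of_flip hi hj hk
    have hm := (Q.iter_iff i j x.1 _).1 hk
    obtain ⟨m', hm'⟩ := Q.m_even hi hj (Q.col x.1)
    have h3' := h3 i j hi hj (Q.col x.1)
    have e1 : Q.m i j (Q.col x.1) / 2 = m' := by omega
    rw [e1] at h3'
    have hd : m' ∣ k' := by
      rw [hm', ← two_mul, ← two_mul] at hm
      exact Nat.dvd_of_mul_dvd_mul_left (by norm_num) hm
    obtain ⟨q, rfl⟩ := hd
    rw [← two_mul, Function.iterate_mul] at hk ⊢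
    rw [Q.iter_mul _ ((Q.r i ∘ Q.r j)^[2]) (fun c => h j c * h i (!c) * h j (!c) * h i c)]
    · rw [hk]
      simp only [pow_mul, h3', one_pow, mul_one]
    · intro Φ
      simp only [Function.iterate_succ, Function.iterate_zero, Function.comp_apply, id,
        Q.not_J hi, hj _, Bool.not_not]
    · intro x
      change Q.RX h i (Q.RX h j (Q.RX h i (Q.RX h j x))) = _
      simp only [Function.iterate_succ, Function.iterate_zero, Function.comp_apply, id, RX,
        Q.not_J hi, hj _, Bool.not_not, mul_assoc]
  obtain ⟨s, -, a2, a3⟩ := Q.lift (F × G) Prod.fst (Q.RX h) (fun i x => rfl) hinv (by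
    intro i j hij x k hk
    by_cases hi : Q.J i <;> by_cases hj : Q.J j
    · rw [Q.iter_mul _ (Q.r i ∘ Q.r j) (fun c => h j c * h i (Q.kap j c))]
      · rw [hk]
        obtain ⟨q, rfl⟩ := (Q.iter_iff i j x.1 _).1 hk
        simp only [pow_mul, h2 i j hij (by tauto), one_pow, mul_one]
      · intro Φ
        simp only [Function.comp_apply, hi _, hj _, Bool.not_not]
      · intro x
        simp only [Function.comp_apply, RX, Q.col_r, mul_assoc]
    · rw [inv_iter (g := Q.RX h j ∘ Q.RX h i)]
      · apply A j i hj hi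
        rwa [inv_iter (g := Q.r i ∘ Q.r j)]
        · intro x; simp [Q.inv]
        · intro x; simp [Q.inv]
      · intro x; simp [hinv]
      · intro x; simp [hinv]
    · exact A i j hi hj x k hk
    · rw [Q.iter_mul _ (Q.r i ∘ Q.r j) (fun c => h j c * h i (Q.kap j c))]
      · rw [hk]
        obtain ⟨q, rfl⟩ := (Q.iter_iff i j x.1 _).1 hk
        simp only [pow_mul, h2 i j hij (by tauto), one_pow, mul_one]
      · intro Φ
        simp only [Function.comp_apply, Q.not_J hi, Q.not_J hj]
      · intro x
        simp only [Function.comp_apply, RX, Q.col_r, mul_assoc]) (Q.pick true, 1)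
  refine ⟨fun Φ => (s Φ).2, fun k Φ => ?_⟩
  simp only [a3, RX, a2]

open Refl in
lemma rep (hn : 3 ≤ n) {S : Type} [Fintype S] {B : S → S → ℝ} (hB1 : ∀ s, B s s = 1)
    (hsym : ∀ s t, B s t = B t s) (τ : Fin n → S ≃ S) (hτ : ∀ k s, τ k (τ k s) = s)
    (hτB : ∀ k s t, B (τ k s) (τ k t) = B s t)
    (hJJ : ∀ k l, Q.J k → Q.J l → k ≠ l → ¬ Ad k l ∧ ∀ s, τ k (τ l s) = τ l (τ k s))
    (σ : Fin n → Bool → S)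
    (H1 : ∀ k l, k ≠ l → ¬ Q.J k → ¬ Q.J l → ∀ c, B (σ k c) (σ l c) = cs (Q.m k l c))
    (H2 : ∀ k j, ¬ Q.J k → Q.J j → ¬ Ad k j → ∀ c, τ j (σ k (!c)) = σ k c)
    (H3 : ∀ k j, ¬ Q.J k → Q.J j → Ad k j → ∀ c, B (τ j (σ k (!c))) (σ k c) = cs (Q.m k j c / 2)) :
    ∃ g : F → ((S → ℝ) ≃ₗ[ℝ] (S → ℝ)),
      (∀ k, ¬ Q.J k → ∀ Φ, g (Q.r k Φ) = g Φ * rho hB1 (σ k (Q.col Φ))) ∧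
      (∀ j, Q.J j → ∀ Φ, g (Q.r j Φ) = g Φ * perm (τ j)) := by
  have hT : ∀ k, perm (τ k) * perm (τ k) = 1 := by
    intro k
    rw [perm_mul, ← perm_refl]
    congr 1
    ext s
    exact hτ k s
  obtain ⟨g, hg⟩ := Q.cocycle ((S → ℝ) ≃ₗ[ℝ] (S → ℝ))
    (fun k c => if Q.J k then perm (τ k) else rho hB1 (σ k c)) (by
      intro k c
      by_cases hk : Q.J k
      · simp only [hk, if_true, hT]
      · simp only [hk, if_false, Q.kap_nJ hk, rho_sq]) (by
      intro i j hij hJ c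
      by_cases hi : Q.J i
      · have hj := hJ.1 hi
        obtain ⟨h1, h2⟩ := hJJ i j hi hj hij
        simp only [hi, hj, if_true, Q.m_far hij h1]
        have : perm (τ i) * perm (τ j) = perm (τ j) * perm (τ i) := by
          rw [perm_mul, perm_mul]
          congr 1
          ext s
          exact (h2 s).symm
        rw [pow_two, mul_assoc, ← mul_assoc (perm (τ i)), this, mul_assoc, hT, mul_one, hT]
      · have hj : ¬ Q.J j := fun h => hi (hJ.2 h)
        simp only [hi, hj, if_false, Q.kap_nJ hj]
        apply rho_pow _ hsym
        · have := Q.m_pos hn i j c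
          have := Q.m_ne_one hij c
          omega
        · rw [hsym, H1 i j hij hi hj]) (by
      intro i j hi hj c
      have hij : i ≠ j := by rintro rfl; exact hi hj
      simp only [hi, hj, if_true, if_false]
      rw [conj hB1 (τ j) (hτ j) (hτB j)]
      by_cases hA : Ad i j
      · apply rho_pow _ hsym
        · have := Q.m_ge_three hn hA c
          have := Q.m_even hi hj c
          rcases this with ⟨q, hq⟩
          omega
        · exact H3 i j hi hj hA c
      · rw [Q.m_far hij hA, H2 i j hi hj hA, rho_sq]
        simp)
  refine ⟨g, fun k hk Φ => ?_, fun j hj Φ => ?_⟩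
  · rw [hg]; simp only [hk, if_false]
  · rw [hg]; simp only [hj, if_true]

end Sys


namespace Refl

lemma cs_two : cs 2 = 0 := by simp [cs]

lemma cs_anti {k m : ℕ} (hk : 1 ≤ k) (h : k ≤ m) : cs m ≤ cs k := by
  unfold cs
  have hk' : (1 : ℝ) ≤ k := by exact_mod_cast hk
  have hm' : (k : ℝ) ≤ m := by exact_mod_cast h
  apply neg_le_neg
  apply Real.cos_le_cos_of_nonneg_of_le_pi
  · positivity
  · exact div_le_self Real.pi_pos.le hk'
  · exact div_le_div_of_nonneg_left Real.pi_pos.le (by linarith) hm'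

lemma cs_three {m : ℕ} (h : 3 ≤ m) : cs m ≤ -(1 / 2) := by
  have := cs_anti (by norm_num) h
  have h3 : cs 3 = -(1 / 2) := by simp [cs]
  linarith

lemma cs_four {m : ℕ} (h : 4 ≤ m) : cs m ≤ -(√2 / 2) := by
  have := cs_anti (by norm_num) h
  have h3 : cs 4 = -(√2 / 2) := by simp [cs]
  linarith

lemma cs_nonpos {m : ℕ} (h : 2 ≤ m) : cs m ≤ 0 := by
  have := cs_anti (by norm_num) h
  rwa [cs_two] at this

end Refl

namespace Sys

open Refl

variable {n : ℕ} {F : Type} (Q : Sys n F)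

/-- the form in the case of a single colour-flipping generator -/
noncomputable def Bs (b : Fin n) (s t : Fin n × Bool) : ℝ :=
  if s.1 = t.1 then (if s.2 = t.2 then 1 else cs (Q.m s.1 b false / 2))
  else if Ad s.1 b then (if Ad t.1 b ∧ s.2 ≠ t.2 then -1 else cs (Q.m s.1 t.1 s.2))
  else cs (Q.m s.1 t.1 t.2)

lemma indep {b : Fin n} (hb : Q.J b) {k l : Fin n} (hk : ¬ Ad k b) (hl : ¬ Ad l b) (c c' : Bool) :
    Q.m k l c = Q.m k l c' := by
  by_cases h1 : k = b
  · subst h1; exact Q.m_flip_left hb l c c'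
  by_cases h2 : l = b
  · subst h2; exact Q.m_flip_right hb k c c'
  exact Q.m_flip_far hb (Ne.symm h1) (Ne.symm h2) (fun h => hk h.symm) (fun h => hl h.symm) c c'

lemma single (hn : 3 ≤ n) {b : Fin n} (hJ : ∀ k, Q.J k ↔ k = b) (o : Fin n) (ho : b ≠ o) {q : ℕ}
    (u : Fin q → Fin n × Bool) (hu : Function.Injective u)
    (hub : ∀ a, (u a).1 ≠ b ∧ (u a).1 ≠ o ∧ (Ad (u a).1 b ∨ (u a).2 = false))
    (hcon : ∀ f : Fin q → ℝ, (∀ a c, Q.Bs b (u a) (u c) ≠ 0 → f a = f c) → ∀ a c, f a = f c)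
    (v : Fin q → ℝ) (hv : v ≠ 0) : 0 < ∑ a, ∑ c, v a * v c * Q.Bs b (u a) (u c) := by
  have hb : Q.J b := (hJ b).2 rfl
  have hB1 : ∀ s, Q.Bs b s s = 1 := fun s => by simp [Bs]
  have hsym : ∀ s t, Q.Bs b s t = Q.Bs b t s := by
    rintro ⟨k, e⟩ ⟨l, d⟩
    by_cases hkl : k = l
    · subst hkl
      simp only [Bs, if_true, eq_comm]
    · have hlk : l ≠ k := Ne.symm hkl
      by_cases hk : Ad k b <;> by_cases hl : Ad l b
      · by_cases hed : e = d
        · subst hed; simp [Bs, hkl, hlk, hk, hl, Q.m_symm k l]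
        · have := Ne.symm hed
          simp [Bs, hkl, hlk, hk, hl, hed, this]
      · simp [Bs, hkl, hlk, hk, hl, Q.m_symm k l]
      · simp [Bs, hkl, hlk, hk, hl, Q.m_symm k l]
      · simp [Bs, hkl, hlk, hk, hl, Q.m_symm k l, Q.indep hb hl hk e d]
  obtain ⟨g, hg1, hg2⟩ := Q.rep hn (B := Q.Bs b) hB1 hsym (fun _ => Equiv.refl _) (fun _ _ => rfl)
    (fun _ _ _ => rfl) (fun k l hk hl hkl => absurd (((hJ k).1 hk).trans ((hJ l).1 hl).symm) hkl)
    (fun k c => if Ad k b then (k, c) else (k, false)) (by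
      intro k l hkl _ _ c
      by_cases hk : Ad k b <;> by_cases hl : Ad l b
      · simp [Bs, hkl, hk, hl]
      · simp [Bs, hkl, hk, hl]
      · simp [Bs, hkl, hk, hl]
      · simp [Bs, hkl, hk, hl, Q.indep hb hk hl c false]) (by
      intro k j hk hj h c
      rw [(hJ j).1 hj] at h
      simp [h]) (by
      intro k j hk hj h c
      rw [(hJ j).1 hj] at h ⊢
      simp [h, Bs, Q.m_flip_right hb k c false])
  obtain ⟨Z, hZ, hZ1, hZ2⟩ := Q.fin o (Q.pick true)
  refine fin_lemma hB1 hsym (hZ.toFinset.image g) ⟨g (Q.pick true), ?_⟩ u hu ?_ hcon v hv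
  · simp only [Finset.mem_image, Set.Finite.mem_toFinset]
    exact ⟨_, hZ1, rfl⟩
  · intro x hx a
    simp only [Finset.mem_image, Set.Finite.mem_toFinset] at hx ⊢
    obtain ⟨Φ, hΦ, rfl⟩ := hx
    obtain ⟨h1, h2, h3⟩ := hub a
    have hnJ : ¬ Q.J (u a).1 := fun h => h1 ((hJ _).1 h)
    by_cases hA : Ad (u a).1 b
    · by_cases hc : Q.col Φ = (u a).2
      · refine ⟨_, hZ2 Φ hΦ _ h2, ?_⟩
        rw [hg1 _ hnJ, hc, if_pos hA]
      · refine ⟨_, hZ2 _ (hZ2 Φ hΦ b ho) _ h2, ?_⟩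
        have hc' : Q.col (Q.r b Φ) = (u a).2 := by
          rw [hb]
          cases h : Q.col Φ <;> cases h' : (u a).2 <;> simp_all
        rw [hg1 _ hnJ, hc', if_pos hA, hg2 _ hb, perm_refl, mul_one]
    · refine ⟨_, hZ2 Φ hΦ _ h2, ?_⟩
      rw [hg1 _ hnJ, if_neg hA]
      have : (u a).2 = false := h3.resolve_left hA
      rw [← this]

lemma exists_ne (hn : 5 ≤ n) (a b c d : Fin n) : ∃ o : Fin n, a ≠ o ∧ b ≠ o ∧ c ≠ o ∧ d ≠ o := by
  by_contra hcon
  push Not at hcon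
  have : (Finset.univ : Finset (Fin n)) ⊆ {a, b, c, d} := by
    intro l _
    simp only [Finset.mem_insert, Finset.mem_singleton]
    by_contra h
    push Not at h
    exact h.2.2.2 (hcon l h.1.symm h.2.1.symm h.2.2.1.symm).symm
  have h1 := Finset.card_le_card this
  have h2 := Finset.card_le_four (a := a) (b := b) (c := c) (d := d)
  rw [Finset.card_univ, Fintype.card_fin] at h1
  omega

lemma C1 (hn : 5 ≤ n) {b : Fin n} (hJ : ∀ k, Q.J k ↔ k = b) (h0 : 0 < (b : ℕ))
    (h1 : (b : ℕ) + 1 < n) : False := by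
  let k : Fin n := ⟨b - 1, by omega⟩
  let l : Fin n := ⟨b + 1, h1⟩
  have hk : Ad k b := Or.inl (by simp only [k]; omega)
  have hl : Ad l b := Or.inr rfl
  have hkl : k ≠ l := fun h => by
    have := congrArg Fin.val h
    simp only [k, l] at this
    omega
  obtain ⟨o, o1, o2, o3, -⟩ := exists_ne hn b k l b
  have e1 : Q.Bs b (k, false) (l, true) = -1 := by simp [Bs, hkl, hk, hl]
  have e2 : Q.Bs b (l, true) (k, false) = -1 := by simp [Bs, hkl.symm, hk, hl]
  have e3 : ∀ s, Q.Bs b s s = 1 := fun s => by simp [Bs]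
  have := Q.single (by omega) hJ o o1 ![(k, false), (l, true)] (by
    intro a c h
    fin_cases a <;> fin_cases c <;> simp_all) (by
    intro a
    fin_cases a
    · exact ⟨hk.ne, o2, Or.inl hk⟩
    · exact ⟨hl.ne, o3, Or.inl hl⟩) (by
    intro f hf a c
    have h01 : f 0 = f 1 := hf 0 1 (by
      simp only [Matrix.cons_val_zero, Matrix.cons_val_one, e1]; norm_num)
    fin_cases a <;> fin_cases c <;> simp_all) ![1, 1] (by
    intro h
    have := congrFun h 0
    simp at this)
  simp [Fin.sum_univ_two, e1, e2, e3] at this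

lemma C2 (hn : 5 ≤ n) {b : Fin n} (hJ : ∀ k, Q.J k ↔ k = b) (h0 : (b : ℕ) + 1 = n) {y z : Fin n}
    (hy : (y : ℕ) + 2 = b) (hz : (z : ℕ) + 1 = b) (hd : Q.m y z false ≠ Q.m y z true) : False := by
  have hn3 : 3 ≤ n := by omega
  have hb : Q.J b := (hJ b).2 rfl
  let x : Fin n := ⟨y - 1, by omega⟩
  have hx : (x : ℕ) + 1 = y := by simp only [x]; omega
  clear_value x
  have ne : ∀ {i j : Fin n}, (i : ℕ) ≠ j → i ≠ j := fun h e => h (congrArg Fin.val e)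
  have hxy : x ≠ y := ne (by omega)
  have hxz : x ≠ z := ne (by omega)
  have hyz : y ≠ z := ne (by omega)
  have Axy : Ad x y := Or.inl hx
  have Ayz : Ad y z := Or.inl (by omega)
  have Azb : Ad z b := Or.inl hz
  have nxb : ¬ Ad x b := by unfold Ad; omega
  have nyb : ¬ Ad y b := by unfold Ad; omega
  have nxz : ¬ Ad x z := by unfold Ad; omega
  obtain ⟨o, o1, o2, o3, o4⟩ := exists_ne hn b x y z
  have e3 : ∀ s, Q.Bs b s s = 1 := fun s => by simp [Bs]
  have exy : Q.Bs b (x, false) (y, false) = cs (Q.m x y false) := by simp [Bs, hxy, nxb]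
  have eyx : Q.Bs b (y, false) (x, false) = cs (Q.m x y false) := by
    simp [Bs, hxy.symm, nyb, Q.m_symm y x]
  have exz : ∀ e, Q.Bs b (x, false) (z, e) = 0 := fun e => by
    simp [Bs, hxz, nxb, Q.m_far hxz nxz, cs_two]
  have ezx : ∀ e, Q.Bs b (z, e) (x, false) = 0 := fun e => by
    simp [Bs, hxz.symm, nxb, Azb, Q.m_symm z x, Q.m_far hxz nxz, cs_two]
  have eyz : ∀ e, Q.Bs b (y, false) (z, e) = cs (Q.m y z e) := fun e => by simp [Bs, hyz, nyb]
  have ezy : ∀ e, Q.Bs b (z, e) (y, false) = cs (Q.m y z e) := fun e => by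
    simp [Bs, hyz.symm, nyb, Azb, Q.m_symm z y]
  have ezz : Q.Bs b (z, false) (z, true) = cs (Q.m z b false / 2) := by simp [Bs]
  have ezz' : Q.Bs b (z, true) (z, false) = cs (Q.m z b false / 2) := by simp [Bs]
  have m1 := cs_three (Q.m_ge_three hn3 Axy false)
  have mf := Q.m_ge_three hn3 Ayz false
  have mt := Q.m_ge_three hn3 Ayz true
  have m4 : cs (Q.m z b false / 2) ≤ 0 := by
    apply cs_nonpos
    have hnz : ¬ Q.J z := fun h => (ne (i := z) (j := b) (by omega)) ((hJ z).1 h)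
    obtain ⟨q, hq⟩ := Q.m_even hnz hb false
    have := Q.m_ge_three hn3 Azb false
    omega
  have key := Q.single hn3 hJ o o1 ![(x, false), (y, false), (z, false), (z, true)] (by
    have := hxy.symm
    have := hxz.symm
    have := hyz.symm
    intro a c h
    fin_cases a <;> fin_cases c <;> simp_all) (by
    intro a
    fin_cases a
    · exact ⟨ne (by simp; omega), o2, Or.inr rfl⟩
    · exact ⟨ne (by simp; omega), o3, Or.inr rfl⟩
    · exact ⟨ne (by simp; omega), o4, Or.inl Azb⟩
    · exact ⟨ne (by simp; omega), o4, Or.inl Azb⟩) (by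
    intro f hf a c
    have h01 : f 0 = f 1 := hf 0 1 (by change Q.Bs b (x, false) (y, false) ≠ 0; rw [exy]; linarith)
    have h12 : f 1 = f 2 := hf 1 2 (by
      change Q.Bs b (y, false) (z, false) ≠ 0; rw [eyz]; linarith [cs_three mf])
    have h13 : f 1 = f 3 := hf 1 3 (by
      change Q.Bs b (y, false) (z, true) ≠ 0; rw [eyz]; linarith [cs_three mt])
    fin_cases a <;> fin_cases c <;> simp_all)
  have s2 : √2 * √2 = 2 := Real.mul_self_sqrt (by norm_num)
  have s0 : 0 < √2 := Real.sqrt_pos.2 (by norm_num)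
  rcases Nat.lt_or_ge 3 (Q.m y z false) with h | h
  · have := key ![1, 2, √2, 1] (by
      intro h
      have := congrFun h 0
      simp at this)
    simp [Fin.sum_univ_four, e3, exy, eyx, exz, ezx, eyz, ezy, ezz, ezz'] at this
    nlinarith [mul_le_mul_of_nonneg_left (cs_four h) s0.le, cs_three mt,
      mul_nonneg s0.le (neg_nonneg.2 m4)]
  · have h' : 3 < Q.m y z true := by omega
    have := key ![1, 2, 1, √2] (by
      intro h
      have := congrFun h 0
      simp at this)
    simp [Fin.sum_univ_four, e3, exy, eyx, exz, ezx, eyz, ezy, ezz, ezz'] at this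
    nlinarith [mul_le_mul_of_nonneg_left (cs_four h') s0.le, cs_three mf,
      mul_nonneg s0.le (neg_nonneg.2 m4)]

end Sys


namespace Sys

open Refl

variable {n : ℕ} {F : Type} (Q : Sys n F)

/-- the form in the case of two colour-flipping generators -/
noncomputable def Bd (j b : Fin n) (s t : Fin n × Bool) : ℝ :=
  if s.1 = t.1 then (if s.2 = t.2 then 1 else
    if Ad s.1 b then cs (Q.m s.1 b false / 2) else cs (Q.m s.1 j false / 2))
  else cs (Q.m s.1 t.1 (xor s.2 t.2))

/-- colour swap -/
noncomputable def swp (j b : Fin n) (s : Fin n × Bool) : Fin n × Bool :=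
  if Ad s.1 j ∨ Ad s.1 b then (s.1, !s.2) else s

lemma swp_swp (j b : Fin n) (s : Fin n × Bool) : swp j b (swp j b s) = s := by
  by_cases h : Ad s.1 j ∨ Ad s.1 b
  · simp [swp, h]
  · simp [swp, h]

/-- colour swap equivalence -/
noncomputable def swpE (j b : Fin n) : (Fin n × Bool) ≃ (Fin n × Bool) :=
  ⟨swp j b, swp j b, swp_swp j b, swp_swp j b⟩

lemma swpE_apply (j b : Fin n) (s) : swpE j b s = swp j b s := rfl

lemma C3 (hn : 5 ≤ n) {j b : Fin n} (hjb : (j : ℕ) + 3 = b) (hJ : ∀ k, Q.J k ↔ k = j ∨ k = b) :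
    False := by
  have hn3 : 3 ≤ n := by omega
  have hj : Q.J j := (hJ j).2 (Or.inl rfl)
  have hb : Q.J b := (hJ b).2 (Or.inr rfl)
  have ne : ∀ {i j : Fin n}, (i : ℕ) ≠ j → i ≠ j := fun h e => h (congrArg Fin.val e)
  have njb : j ≠ b := ne (by omega)
  have nbad : ∀ k, Ad k b → ¬ Ad k j := by
    intro k h h'
    unfold Ad at h h'
    omega
  have nAjb : ¬ Ad j b := by unfold Ad; omega
  let p : Fin n := ⟨j + 1, by omega⟩
  let q : Fin n := ⟨j + 2, by omega⟩
  have hp : (p : ℕ) = j + 1 := rfl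
  have hq : (q : ℕ) = j + 2 := rfl
  clear_value p q
  have Apj : Ad p j := Or.inr hp.symm
  have Aqb : Ad q b := Or.inl (by omega)
  have Apq : Ad p q := Or.inl (by omega)
  have npq : p ≠ q := Apq.ne
  have npb : ¬ Ad p b := fun h => nbad p h Apj
  have npJ : ¬ Q.J p := by rw [hJ]; rintro (h | h) <;> (have := congrArg Fin.val h; omega)
  have nqJ : ¬ Q.J q := by rw [hJ]; rintro (h | h) <;> (have := congrArg Fin.val h; omega)
  have hB1 : ∀ s, Q.Bd j b s s = 1 := fun s => by simp [Bd]
  have hsym : ∀ s t, Q.Bd j b s t = Q.Bd j b t s := by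
    rintro ⟨k, e⟩ ⟨l, d⟩
    by_cases hkl : k = l
    · subst hkl
      simp only [Bd, if_true, eq_comm]
    · have hlk : l ≠ k := Ne.symm hkl
      simp [Bd, hkl, hlk, Q.m_symm k l, Bool.xor_comm]
  have hfar : ∀ k l, ¬ (Ad k j ∨ Ad k b) → ∀ c c', Q.m k l c = Q.m k l c' := by
    intro k l hk c c'
    push Not at hk
    by_cases hl : Ad l b
    · exact Q.indep hj hk.1 (nbad l hl) c c'
    · exact Q.indep hb hk.2 hl c c'
  have hsw : ∀ s t, Q.Bd j b (swp j b s) (swp j b t) = Q.Bd j b s t := by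
    rintro ⟨k, e⟩ ⟨l, d⟩
    by_cases hkl : k = l
    · subst hkl
      by_cases hk : Ad k j ∨ Ad k b
      · simp [swp, Bd, hk]
      · simp [swp, Bd, hk]
    · by_cases hk : Ad k j ∨ Ad k b <;> by_cases hl : Ad l j ∨ Ad l b
      · simp [swp, Bd, hk, hl, hkl]
      · simp only [swp, Bd, hk, hl, hkl, if_true, if_false]
        rw [Q.m_symm k l, Q.m_symm k l, hfar l k hl]
      · simp only [swp, Bd, hk, hl, hkl, if_true, if_false]
        rw [hfar k l hk]
      · simp [swp, Bd, hk, hl, hkl]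
  obtain ⟨g, hg1, hg2⟩ := Q.rep hn3 (B := Q.Bd j b) hB1 hsym
    (fun k => if k = j then swpE j b else Equiv.refl _) (by
      intro k s
      by_cases h : k = j
      · simp [h, swpE_apply, swp_swp]
      · simp [h]) (by
      intro k s t
      by_cases h : k = j
      · simp only [h, if_true, swpE_apply, hsw]
      · simp [h]) (by
      intro k l hk hl hkl
      rw [hJ] at hk hl
      rcases hk with rfl | rfl <;> rcases hl with rfl | rfl
      · exact absurd rfl hkl
      · exact ⟨nAjb, fun s => by simp [njb.symm]⟩
      · exact ⟨fun h => nAjb h.symm, fun s => by simp [njb.symm]⟩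
      · exact absurd rfl hkl)
    (fun k c => if Ad k b then (k, c) else (k, false)) (by
      intro k l hkl _ _ c
      by_cases hk : Ad k b <;> by_cases hl : Ad l b
      · simp [Bd, hkl, hk, hl, Q.indep hj (nbad k hk) (nbad l hl) c false]
      · simp [Bd, hkl, hk, hl]
      · simp [Bd, hkl, hk, hl]
      · simp [Bd, hkl, hk, hl, Q.indep hb hk hl c false]) (by
      intro k i hk hi h c
      rcases (hJ i).1 hi with rfl | rfl
      · simp only [if_true, swpE_apply]
        by_cases hkb : Ad k b
        · simp [swp, hkb]
        · simp [swp, hkb, h]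
      · simp [njb.symm, h]) (by
      intro k i hk hi h c
      rcases (hJ i).1 hi with rfl | rfl
      · have hkb : ¬ Ad k b := fun h' => nbad k h' h
        simp [swpE_apply, swp, hkb, h, Bd, Q.m_flip_right hj k c false]
      · simp [h, njb.symm, Bd, Q.m_flip_right hb k c false])
  obtain ⟨o, oj, op, oq, ob⟩ := exists_ne hn j p q b
  obtain ⟨Z, hZ, hZ1, hZ2⟩ := Q.fin o (Q.pick true)
  have epq : ∀ e d, Q.Bd j b (p, e) (q, d) = cs (Q.m p q (xor e d)) := fun e d => by
    simp [Bd, npq]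
  have eqp : ∀ e d, Q.Bd j b (q, d) (p, e) = cs (Q.m p q (xor e d)) := fun e d => by
    rw [hsym, epq]
  have epp : ∀ e, Q.Bd j b (p, e) (p, !e) = cs (Q.m p j false / 2) := fun e => by simp [Bd, npb]
  have eqq : ∀ e, Q.Bd j b (q, e) (q, !e) = cs (Q.m q b false / 2) := fun e => by simp [Bd, Aqb]
  have hm : ∀ c, cs (Q.m p q c) ≤ -(1 / 2) := fun c => cs_three (Q.m_ge_three hn3 Apq c)
  have hmp : cs (Q.m p j false / 2) ≤ 0 := by
    apply cs_nonpos
    obtain ⟨q, hq⟩ := Q.m_even npJ hj false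
    have := Q.m_ge_three hn3 Apj false
    omega
  have hmq : cs (Q.m q b false / 2) ≤ 0 := by
    apply cs_nonpos
    obtain ⟨q, hq⟩ := Q.m_even nqJ hb false
    have := Q.m_ge_three hn3 Aqb false
    omega
  have hne : ∀ e d, Q.Bd j b (p, e) (q, d) ≠ 0 := fun e d => by
    rw [epq]; linarith [hm (xor e d)]
  have rp : ∀ Φ ∈ Z, g Φ * rho hB1 (p, false) ∈ g '' Z := by
    intro Φ hΦ
    refine ⟨_, hZ2 Φ hΦ p op, ?_⟩
    rw [hg1 _ npJ, if_neg npb]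
  have rq : ∀ c, ∀ Φ ∈ Z, g Φ * rho hB1 (q, c) ∈ g '' Z := by
    intro c Φ hΦ
    by_cases hc : Q.col Φ = c
    · refine ⟨_, hZ2 Φ hΦ q oq, ?_⟩
      rw [hg1 _ nqJ, if_pos Aqb, hc]
    · refine ⟨_, hZ2 _ (hZ2 Φ hΦ b ob) q oq, ?_⟩
      have hc' : Q.col (Q.r b Φ) = c := by
        rw [hb]
        clear * - hc
        cases h : Q.col Φ <;> cases c <;> simp_all
      rw [hg1 _ nqJ, if_pos Aqb, hc', hg2 _ hb, if_neg njb.symm, perm_refl, mul_one]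
  have rp' : ∀ Φ ∈ Z, g Φ * rho hB1 (p, true) ∈ g '' Z := by
    intro Φ hΦ
    refine ⟨_, hZ2 _ (hZ2 _ (hZ2 Φ hΦ j oj) p op) j oj, ?_⟩
    rw [hg2 _ hj, if_pos rfl, hg1 _ npJ, if_neg npb, hg2 _ hj, if_pos rfl, mul_assoc, mul_assoc,
      ← mul_assoc (perm _), conj hB1 (swpE j b) (swp_swp j b) hsw, swpE_apply]
    simp [swp, Apj]
  have key := fin_lemma hB1 hsym (hZ.toFinset.image g) ⟨g (Q.pick true), by
      simp only [Finset.mem_image, Set.Finite.mem_toFinset]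
      exact ⟨_, hZ1, rfl⟩⟩ ![(p, false), (q, false), (p, true), (q, true)] (by
      have := npq.symm
      clear * - npq this
      intro a c h
      fin_cases a <;> fin_cases c <;> simp_all) (by
      intro x hx a
      simp only [Finset.mem_image, Set.Finite.mem_toFinset] at hx ⊢
      obtain ⟨Φ, hΦ, rfl⟩ := hx
      fin_cases a
      · exact rp Φ hΦ
      · exact rq _ Φ hΦ
      · exact rp' Φ hΦ
      · exact rq _ Φ hΦ) (by
      intro f hf a c
      have h01 : f 0 = f 1 := hf 0 1 (hne _ _)
      have h03 : f 0 = f 3 := hf 0 3 (hne _ _)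
      have h21 : f 2 = f 1 := hf 2 1 (hne _ _)
      clear * - h01 h03 h21
      fin_cases a <;> fin_cases c <;> simp_all) ![1, 1, 1, 1] (by
      intro h
      have := congrFun h 0
      simp at this)
  have a1 := epp false
  have a2 := epp true
  have a3 := eqq false
  have a4 := eqq true
  simp only [Bool.not_true, Bool.not_false] at a1 a2 a3 a4
  simp [Fin.sum_univ_four, hB1, epq, eqp, a1, a2, a3, a4] at key
  linarith [hm true, hm false]

lemma dual_J (k : Fin n) : Q.dual.J k ↔ Q.J k.rev := Iff.rfl

theorem main (Q : Sys n F) (h : n = 2 ∨ 5 ≤ n) : False := by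
  obtain ⟨p, q, hpq, hd⟩ : ∃ p q : Fin n, (p : ℕ) + 1 = q ∧ Q.m p q false ≠ Q.m p q true := by
    obtain ⟨i, j, hA, hd⟩ := Q.exists_dep
    rcases hA with hA | hA
    · exact ⟨i, j, hA, hd⟩
    · refine ⟨j, i, hA, ?_⟩
      rwa [Q.m_symm j i, Q.m_symm j i]
  have hJ : ∀ k, Q.J k → (k : ℕ) + 1 = p ∨ (q : ℕ) + 1 = k := by
    intro k hk
    have h1 : k ≠ p := by rintro rfl; exact hd (Q.m_flip_left hk _ _ _)
    have h2 : k ≠ q := by rintro rfl; exact hd (Q.m_flip_right hk _ _ _)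
    have h3 : (k : ℕ) ≠ p := fun e => h1 (Fin.ext e)
    have h4 : (k : ℕ) ≠ q := fun e => h2 (Fin.ext e)
    by_contra hcon
    push Not at hcon
    refine hd (Q.m_flip_far hk h1 h2 ?_ ?_ _ _)
    · unfold Ad; omega
    · unfold Ad; omega
  obtain ⟨k, hk⟩ := Q.exists_J
  have hkk := hJ k hk
  have hn : 5 ≤ n := by
    rcases h with h | h
    · omega
    · exact h
  by_cases hl : ∃ l, Q.J l ∧ l ≠ k
  · obtain ⟨l, hl, hlk⟩ := hl
    have hlk' : (l : ℕ) ≠ k := fun e => hlk (Fin.ext e)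
    have hll := hJ l hl
    have gen : ∀ j b : Fin n, (j : ℕ) + 1 = p → (q : ℕ) + 1 = b → Q.J j → Q.J b → False := by
      intro j b hj hb h1 h2
      refine Q.C3 hn (j := j) (b := b) (by omega) fun i => ⟨fun hi => ?_, ?_⟩
      · rcases hJ i hi with h | h
        · exact Or.inl (Fin.ext (by omega))
        · exact Or.inr (Fin.ext (by omega))
      · rintro (rfl | rfl)
        · exact h1
        · exact h2
    rcases hkk with h1 | h1 <;> rcases hll with h2 | h2
    · omega
    · exact gen k l h1 h2 hk hl
    · exact gen l k h2 h1 hl hk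
    · omega
  · push Not at hl
    have hJ' : ∀ i, Q.J i ↔ i = k := fun i => ⟨hl i, by rintro rfl; exact hk⟩
    by_cases hin : 0 < (k : ℕ) ∧ (k : ℕ) + 1 < n
    · exact Q.C1 hn hJ' hin.1 hin.2
    rcases hkk with h1 | h1
    · have hk0 : (k : ℕ) = 0 := by omega
      refine Q.dual.C2 hn (b := k.rev) (y := q.rev) (z := p.rev) ?_ ?_ ?_ ?_ ?_
      · intro i
        rw [dual_J, hJ', Fin.rev_eq_iff]
      · rw [Fin.val_rev]; omega
      · rw [Fin.val_rev, Fin.val_rev]; omega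
      · rw [Fin.val_rev, Fin.val_rev]; omega
      · have : ∀ c, Q.dual.m q.rev p.rev c = Q.m p q c := by
          intro c
          rw [Q.m_symm p q]
          change Q.m q.rev.rev p.rev.rev c = _
          rw [Fin.rev_rev, Fin.rev_rev]
        rwa [this, this]
    · exact Q.C2 hn hJ' (by omega) (y := p) (z := q) (by omega) (by omega) hd

end Sys


namespace Geo

variable {d : ℕ}

/-- convex hull of a finite set -/
def IsPoly (P : Set (EucSp d)) : Prop := ∃ S : Finset (EucSp d), P = convexHull ℝ (S : Set (EucSp d))

lemma IsPoly.convex {P : Set (EucSp d)} (h : IsPoly P) : Convex ℝ P := by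
  obtain ⟨S, rfl⟩ := h
  exact convex_convexHull ℝ _

lemma IsPoly.compact {P : Set (EucSp d)} (h : IsPoly P) : IsCompact P := by
  obtain ⟨S, rfl⟩ := h
  exact S.finite_toSet.isCompact_convexHull ℝ

lemma exposed_hull {S : Finset (EucSp d)} {F : Set (EucSp d)}
    (h : IsExposed ℝ (convexHull ℝ (S : Set (EucSp d))) F) :
    F = convexHull ℝ ((S.filter (· ∈ F) : Finset (EucSp d)) : Set (EucSp d)) := by
  have hP : IsPoly (convexHull ℝ (S : Set (EucSp d))) := ⟨S, rfl⟩
  have hc := h.isCompact hP.compact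
  have hv := h.convex hP.convex
  apply subset_antisymm
  · have h1 : F.extremePoints ℝ ⊆ ((S.filter (· ∈ F) : Finset (EucSp d)) : Set (EucSp d)) := by
      intro x hx
      have h2 : x ∈ (convexHull ℝ (S : Set (EucSp d))).extremePoints ℝ :=
        h.isExtreme.extremePoints_subset_extremePoints hx
      have h3 := extremePoints_convexHull_subset h2
      simp only [Finset.coe_filter, Set.mem_ofPred_eq]
      exact ⟨h3, hx.1⟩
    have h4 : IsClosed (convexHull ℝ ((S.filter (· ∈ F) : Finset (EucSp d)) : Set (EucSp d))) :=
      ((Finset.finite_toSet _).isCompact_convexHull ℝ).isClosed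
    intro x hx
    rw [← closure_convexHull_extremePoints hc hv] at hx
    exact closure_minimal (convexHull_mono h1) h4 hx
  · apply convexHull_min _ hv
    intro x hx
    simp only [Finset.coe_filter, Set.mem_ofPred_eq] at hx
    exact hx.2

lemma exposed_poly {P F : Set (EucSp d)} (hP : IsPoly P) (h : IsExposed ℝ P F) : IsPoly F := by
  obtain ⟨S, rfl⟩ := hP
  exact ⟨_, exposed_hull h⟩

lemma exposed_finite {P : Set (EucSp d)} (hP : IsPoly P) : {F | IsExposed ℝ P F}.Finite := by
  obtain ⟨S, rfl⟩ := hP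
  refine (S.powerset.finite_toSet.image fun U : Finset (EucSp d) => convexHull ℝ (U : Set (EucSp d))).subset ?_
  intro F hF
  refine ⟨_, ?_, (exposed_hull hF).symm⟩
  exact Finset.mem_coe.2 (Finset.mem_powerset.2 (Finset.filter_subset _ _))

/-- maximal value description -/
lemma exposed_max {P F : Set (EucSp d)} (h : IsExposed ℝ P F) (hne : F.Nonempty) :
    ∃ (l : EucSp d →L[ℝ] ℝ) (M : ℝ), (∀ x ∈ P, l x ≤ M) ∧ ∀ x, x ∈ F ↔ x ∈ P ∧ l x = M := by
  obtain ⟨l, hl⟩ := h hne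
  obtain ⟨y, hy⟩ := hne
  have hy' := hy
  rw [hl] at hy'
  refine ⟨l, l y, hy'.2, fun x => ?_⟩
  rw [hl]
  constructor
  · rintro ⟨h1, h2⟩
    exact ⟨h1, le_antisymm (hy'.2 x h1) (h2 y hy'.1)⟩
  · rintro ⟨h1, h2⟩
    refine ⟨h1, fun z hz => ?_⟩
    rw [h2]
    exact hy'.2 z hz

lemma exposed_of_max {P F : Set (EucSp d)} (l : EucSp d →L[ℝ] ℝ) (M : ℝ) (h1 : ∀ x ∈ P, l x ≤ M)
    (h2 : ∀ x, x ∈ F ↔ x ∈ P ∧ l x = M) : IsExposed ℝ P F := by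
  intro ⟨y, hy⟩
  refine ⟨l, ?_⟩
  ext x
  rw [h2]
  constructor
  · rintro ⟨a, b⟩
    exact ⟨a, fun z hz => by rw [b]; exact h1 z hz⟩
  · rintro ⟨a, b⟩
    obtain ⟨c, e⟩ := (h2 y).1 hy
    exact ⟨a, le_antisymm (h1 x a) (e ▸ b y c)⟩

lemma le_on_hull {S : Set (EucSp d)} (l : EucSp d →L[ℝ] ℝ) (M : ℝ) (h : ∀ x ∈ S, l x ≤ M) :
    ∀ x ∈ convexHull ℝ S, l x ≤ M := by
  have : convexHull ℝ S ⊆ {x | l x ≤ M} :=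
    convexHull_min h (convex_halfSpace_le l.toLinearMap.isLinear M)
  exact this

lemma exposed_trans {P F G : Set (EucSp d)} (hP : IsPoly P) (hF : IsExposed ℝ P F)
    (hG : IsExposed ℝ F G) : IsExposed ℝ P G := by
  rcases Set.eq_empty_or_nonempty G with rfl | hGn
  · exact isExposed_empty
  have hFn : F.Nonempty := hGn.mono hG.subset
  obtain ⟨l, M, h1, h2⟩ := exposed_max hF hFn
  obtain ⟨l', M', h1', h2'⟩ := exposed_max hG hGn
  obtain ⟨S, rfl⟩ := hP
  -- choose a small coefficient
  obtain ⟨ε, hε, hεS⟩ : ∃ ε : ℝ, 0 < ε ∧ ∀ s ∈ S, s ∉ F → ε * (l' s - M') < M - l s := by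
    have : ∀ T ⊆ S, ∃ ε : ℝ, 0 < ε ∧ ∀ s ∈ T, s ∉ F → ε * (l' s - M') < M - l s := by
      intro T
      induction T using Finset.induction_on with
      | empty => intro _; exact ⟨1, one_pos, by simp⟩
      | insert a T ha ih =>
        intro hT
        obtain ⟨ε, hε, h⟩ := ih ((Finset.subset_insert _ _).trans hT)
        have haP : a ∈ convexHull ℝ (S : Set (EucSp d)) :=
          subset_convexHull ℝ _ (hT (Finset.mem_insert_self _ _))
        by_cases haF : a ∈ F
        · refine ⟨ε, hε, fun s hs hsF => ?_⟩
          rcases Finset.mem_insert.1 hs with rfl | hs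
          · exact absurd haF hsF
          · exact h s hs hsF
        · have hlt : 0 < M - l a := by
            have := h1 a haP
            have : l a ≠ M := fun e => haF ((h2 a).2 ⟨haP, e⟩)
            rcases lt_or_eq_of_le (h1 a haP) with h | h
            · linarith
            · exact absurd h this
          have hpos : 0 < |l' a - M'| + 1 := by positivity
          refine ⟨min ε ((M - l a) / (|l' a - M'| + 1)), by positivity, fun s hs hsF => ?_⟩
          rcases Finset.mem_insert.1 hs with rfl | hs
          · have h3 : min ε ((M - l s) / (|l' s - M'| + 1)) ≤ (M - l s) / (|l' s - M'| + 1) :=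
              min_le_right _ _
            have h4 : 0 < min ε ((M - l s) / (|l' s - M'| + 1)) := by positivity
            have h5 : l' s - M' < |l' s - M'| + 1 := by linarith [le_abs_self (l' s - M')]
            calc _ < min ε ((M - l s) / (|l' s - M'| + 1)) * (|l' s - M'| + 1) :=
                  mul_lt_mul_of_pos_left h5 h4
              _ ≤ (M - l s) / (|l' s - M'| + 1) * (|l' s - M'| + 1) :=
                  mul_le_mul_of_nonneg_right h3 hpos.le
              _ = M - l s := by field_simp
          · have h6 := h s hs hsF
            have hsP : s ∈ convexHull ℝ (S : Set (EucSp d)) :=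
              subset_convexHull ℝ _ (hT (Finset.mem_insert_of_mem hs))
            have hlt' : 0 < M - l s := by
              have : l s ≠ M := fun e => hsF ((h2 s).2 ⟨hsP, e⟩)
              rcases lt_or_eq_of_le (h1 s hsP) with h | h
              · linarith
              · exact absurd h this
            have h7 : min ε ((M - l a) / (|l' a - M'| + 1)) ≤ ε := min_le_left _ _
            have h4 : 0 < min ε ((M - l a) / (|l' a - M'| + 1)) := by positivity
            rcases le_or_gt (l' s - M') 0 with h8 | h8
            · nlinarith
            · nlinarith
    exact this S subset_rfl
  set L : EucSp d →L[ℝ] ℝ := l + ε • l' with hL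
  have hLa : ∀ x, L x = l x + ε * l' x := fun x => by simp [hL]
  have hLS : ∀ s ∈ S, L s ≤ M + ε * M' ∧ (L s = M + ε * M' → s ∈ G) := by
    intro s hs
    have hsP : s ∈ convexHull ℝ (S : Set (EucSp d)) := subset_convexHull ℝ _ hs
    rw [hLa]
    by_cases hsF : s ∈ F
    · have h3 := ((h2 s).1 hsF).2
      have h4 := h1' s hsF
      refine ⟨by nlinarith, fun e => (h2' s).2 ⟨hsF, ?_⟩⟩
      have : ε * l' s = ε * M' := by linarith
      exact mul_left_cancel₀ hε.ne' this
    · have := hεS s hs hsF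
      exact ⟨by nlinarith, fun e => by nlinarith⟩
  have hLP := le_on_hull L (M + ε * M') (fun s hs => (hLS s hs).1)
  have hGF : ∀ x, x ∈ G → x ∈ convexHull ℝ (S : Set (EucSp d)) ∧ L x = M + ε * M' := by
    intro x hx
    obtain ⟨a, b⟩ := (h2' x).1 hx
    obtain ⟨a', b'⟩ := (h2 x).1 a
    exact ⟨a', by rw [hLa, b, b']⟩
  refine exposed_of_max L (M + ε * M') hLP fun x => ⟨hGF x, fun hx => ?_⟩
  have hX : IsExposed ℝ (convexHull ℝ (S : Set (EucSp d)))
      {x | x ∈ convexHull ℝ (S : Set (EucSp d)) ∧ L x = M + ε * M'} :=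
    exposed_of_max L _ hLP fun x => Iff.rfl
  have h5 : x ∈ {x | x ∈ convexHull ℝ (S : Set (EucSp d)) ∧ L x = M + ε * M'} := hx
  rw [exposed_hull hX] at h5
  have hGc : Convex ℝ G := hG.convex (hF.convex (convex_convexHull ℝ _))
  refine convexHull_min ?_ hGc h5
  intro s hs
  simp only [Finset.coe_filter, Set.mem_ofPred_eq] at hs
  exact (hLS s hs.1).2 hs.2.2

/-- dimension -/
noncomputable def dim (F : Set (EucSp d)) : ℕ := Module.finrank ℝ (affineSpan ℝ F).direction

lemma dim_le (F : Set (EucSp d)) : dim F ≤ d := by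
  have := Submodule.finrank_le (affineSpan ℝ F).direction
  simpa [dim] using this

lemma dim_lt {F G : Set (EucSp d)} (h : IsExposed ℝ F G) (hne : G.Nonempty) (hFG : G ≠ F) :
    dim G < dim F := by
  obtain ⟨l, M, h1, h2⟩ := exposed_max h hne
  have hsub := h.subset
  obtain ⟨x, hxF, hxG⟩ : ∃ x ∈ F, x ∉ G := by
    by_contra hcon
    push Not at hcon
    exact hFG (subset_antisymm hsub hcon)
  have hle : affineSpan ℝ G ≤ affineSpan ℝ F := affineSpan_mono ℝ hsub
  have hx : x ∉ affineSpan ℝ G := by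
    intro hx
    have hmap : (affineSpan ℝ G).map l.toLinearMap.toAffineMap ≤ affineSpan ℝ {M} := by
      rw [AffineSubspace.map_span]
      apply affineSpan_mono
      rintro _ ⟨z, hz, rfl⟩
      exact ((h2 z).1 hz).2
    have : l x ∈ affineSpan ℝ {M} := hmap ⟨x, hx, rfl⟩
    rw [AffineSubspace.mem_affineSpan_singleton] at this
    exact hxG ((h2 x).2 ⟨hxF, this⟩)
  have hlt : affineSpan ℝ G < affineSpan ℝ F :=
    lt_of_le_of_ne hle fun e => hx (e ▸ subset_affineSpan ℝ F hxF)
  have := AffineSubspace.direction_lt_of_nonempty hlt (hne.mono (subset_affineSpan ℝ G))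
  exact Submodule.finrank_lt_finrank_of_lt this

lemma exit {F : Set (EucSp d)} (hF : Convex ℝ F) {b y : EucSp d} (hb : b ∈ F) (hy : y ∈ F)
    (hno : ∀ s : ℝ, 1 < s → b + s • (y - b) ∉ F) :
    ∃ G, IsExposed ℝ F G ∧ y ∈ G ∧ G ≠ F := by
  set A : Set (EucSp d) := (fun x => x - b) '' F with hA
  set W := Submodule.span ℝ A with hW
  set F' : Set W := ((↑) : W → EucSp d) ⁻¹' A with hF'
  have hAc : Convex ℝ A := by
    have : A = (fun x => (-b) + x) '' F := by
      rw [hA]; congr 1; ext x; simp [sub_eq_neg_add]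
    rw [this]
    exact hF.translate _
  have hF'c : Convex ℝ F' := hAc.linear_preimage W.subtype
  have h0 : (0 : W) ∈ F' := ⟨b, hb, by simp⟩
  have hspan : affineSpan ℝ F' = ⊤ := by
    have h1 : insert 0 F' = F' := Set.insert_eq_of_mem h0
    have h2 := affineSpan_insert_zero (k := ℝ) F'
    rw [h1] at h2
    have h3 : Submodule.span ℝ F' = ⊤ := Submodule.span_span_coe_preimage
    rw [h3] at h2
    exact SetLike.coe_injective (by rw [h2]; rfl)
  have hinr : (interior F').Nonempty := hF'c.interior_nonempty_iff_affineSpan_eq_top.2 hspan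
  have hyA : y - b ∈ A := ⟨y, hy, rfl⟩
  let y' : W := ⟨y - b, Submodule.subset_span hyA⟩
  have hy' : y' ∈ F' := hyA
  by_cases hyi : y' ∈ interior F'
  · exfalso
    have hcont : Continuous fun s : ℝ => s • y' := by fun_prop
    have hnhds : ∀ᶠ s in nhds (1 : ℝ), s • y' ∈ F' := by
      apply hcont.continuousAt.eventually
      simp only [one_smul]
      exact mem_interior_iff_mem_nhds.1 hyi
    have h2 := (hnhds.filter_mono nhdsWithin_le_nhds).and
      (self_mem_nhdsWithin : Set.Ioi (1 : ℝ) ∈ nhdsWithin 1 (Set.Ioi 1))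
    obtain ⟨s, hs1, hs2⟩ := h2.exists
    obtain ⟨z, hz, hz'⟩ := hs1
    apply hno s hs2
    have : b + s • (y - b) = z := by
      have h5 : z - b = s • (y - b) := hz'
      rw [← h5]; abel
    rwa [this]
  · obtain ⟨f, hf⟩ := geometric_hahn_banach_open_point hF'c.interior isOpen_interior hyi
    have hle : ∀ w ∈ F', f w ≤ f y' := by
      have h1 : closure (interior F') ⊆ {w | f w ≤ f y'} :=
        closure_minimal (fun w hw => (hf w hw).le) (isClosed_le f.continuous continuous_const)
      rw [hF'c.closure_interior_eq_closure_of_nonempty_interior hinr] at h1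
      exact fun w hw => h1 (subset_closure hw)
    obtain ⟨g, hg, -⟩ := exists_extension_norm_eq W f
    refine ⟨{x | x ∈ F ∧ g x = g y}, exposed_of_max g (g y) ?_ (fun x => Iff.rfl), ⟨hy, rfl⟩, ?_⟩
    · intro x hx
      have hxA : x - b ∈ A := ⟨x, hx, rfl⟩
      have h1 := hle ⟨x - b, Submodule.subset_span hxA⟩ hxA
      rw [← hg, ← hg] at h1
      simp only [y', map_sub] at h1
      linarith
    · intro e
      obtain ⟨w, hw⟩ := hinr
      have h1 := hf w hw
      obtain ⟨x, hx, hxw⟩ := interior_subset hw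
      have h2 : g x = g y := by
        have : x ∈ {x | x ∈ F ∧ g x = g y} := by rw [e]; exact hx
        exact this.2
      rw [← hg, ← hg] at h1
      have hxw' : x - b = (w : EucSp d) := hxw
      rw [← hxw'] at h1
      simp only [y', map_sub] at h1
      linarith

/-- relative interior -/
def ri (F : Set (EucSp d)) : Set (EucSp d) := {x | x ∈ F ∧ ∀ G, IsExposed ℝ F G → x ∈ G → G = F}

lemma ri_nonempty {P : Set (EucSp d)} (hP : IsPoly P) (hne : P.Nonempty) : (ri P).Nonempty := by
  obtain ⟨S, rfl⟩ := hP
  have hS : S.Nonempty := by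
    rw [← Finset.coe_nonempty]; exact convexHull_nonempty_iff.1 hne
  have hc : (0 : ℝ) < S.card := by exact_mod_cast hS.card_pos
  have hsum : ∑ s ∈ S, (S.card : ℝ)⁻¹ = 1 := by
    rw [Finset.sum_const, nsmul_eq_mul]; field_simp
  set x := ∑ s ∈ S, (S.card : ℝ)⁻¹ • s with hx
  have hxP : x ∈ convexHull ℝ (S : Set (EucSp d)) :=
    (convex_convexHull ℝ _).sum_mem (fun _ _ => by positivity) hsum
      (fun s hs => subset_convexHull ℝ _ hs)
  refine ⟨x, hxP, fun G hG hxG => subset_antisymm hG.subset ?_⟩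
  obtain ⟨l, M, h1, h2⟩ := exposed_max hG ⟨x, hxG⟩
  apply convexHull_min _ (hG.convex (convex_convexHull ℝ _))
  intro s hs
  have hlx := ((h2 x).1 hxG).2
  have hle : ∀ t ∈ S, (S.card : ℝ)⁻¹ * l t ≤ (S.card : ℝ)⁻¹ * M := fun t ht =>
    mul_le_mul_of_nonneg_left (h1 t (subset_convexHull ℝ _ ht)) (by positivity)
  have heq : ∑ t ∈ S, (S.card : ℝ)⁻¹ * l t = ∑ t ∈ S, (S.card : ℝ)⁻¹ * M := by
    rw [← Finset.sum_mul, hsum, one_mul, ← hlx, hx, map_sum]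
    simp
  have := (Finset.sum_eq_sum_iff_of_le hle).1 heq s hs
  exact (h2 s).2 ⟨subset_convexHull ℝ _ hs, mul_left_cancel₀ (by positivity) this⟩

end Geo


namespace Geo

variable {d : ℕ} {T : Set (Set (EucSp d))}

/-- nonempty faces of the tiling -/
abbrev NF (T : Set (Set (EucSp d))) : Type :=
  {F : Set (EucSp d) // F.Nonempty ∧ ∃ t ∈ T, IsExposed ℝ t F}


lemma NF.le_def {F G : NF T} : F ≤ G ↔ F.1 ⊆ G.1 := Iff.rfl

lemma tile_poly (hT : IsLFCTiling T) {t : Set (EucSp d)} (ht : t ∈ T) : IsPoly t :=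
  (hT.polytope t ht).1

lemma face_cross (hT : IsLFCTiling T) {t s F : Set (EucSp d)} (ht : t ∈ T) (hs : s ∈ T)
    (hF : IsExposed ℝ t F) (hFs : F ⊆ s) : IsExposed ℝ s F := by
  obtain ⟨-, h2⟩ := hT.face_to_face t ht s hs
  have h3 : IsExposed ℝ (t ∩ s) F :=
    hF.mono Set.inter_subset_left (Set.subset_inter hF.subset hFs)
  exact exposed_trans (tile_poly hT hs) h2 h3

lemma key (hT : IsLFCTiling T) {t s F G : Set (EucSp d)} (ht : t ∈ T) (hs : s ∈ T)
    (hF : IsExposed ℝ t F) (hG : IsExposed ℝ s G) {x : EucSp d} (hx : x ∈ ri F) (hxG : x ∈ G) :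
    F ⊆ G ∧ IsExposed ℝ G F := by
  obtain ⟨h1, h2⟩ := hT.face_to_face t ht s hs
  have h3 : IsExposed ℝ F (F ∩ (t ∩ s)) :=
    (hF.inter h1).mono hF.subset Set.inter_subset_left
  have h4 := hx.2 _ h3 ⟨hx.1, hF.subset hx.1, hG.subset hxG⟩
  have hFs : F ⊆ s := by
    intro y hy
    rw [← h4] at hy
    exact hy.2.2
  have hFs' := face_cross hT ht hs hF hFs
  have h5 : IsExposed ℝ F (F ∩ G) := (hFs'.inter hG).mono hFs Set.inter_subset_left
  have h6 := hx.2 _ h5 ⟨hx.1, hxG⟩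
  have h7 : F ⊆ G := by
    intro y hy
    rw [← h6] at hy
    exact hy.2
  exact ⟨h7, hFs'.mono hG.subset h7⟩

lemma face_inter (hT : IsLFCTiling T) {t s F G : Set (EucSp d)} (ht : t ∈ T) (hs : s ∈ T)
    (hF : IsExposed ℝ t F) (hG : IsExposed ℝ s G) : IsExposed ℝ t (F ∩ G) := by
  obtain ⟨h1, h2⟩ := hT.face_to_face t ht s hs
  have h3 : IsExposed ℝ t (F ∩ (t ∩ s)) := hF.inter h1
  have h4 : IsExposed ℝ s (F ∩ (t ∩ s)) :=
    face_cross hT ht hs h3 (fun x hx => hx.2.2)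
  have h5 := h4.inter hG
  have h6 : F ∩ (t ∩ s) ∩ G = F ∩ G := by
    ext x
    constructor
    · rintro ⟨⟨a, -⟩, b⟩; exact ⟨a, b⟩
    · rintro ⟨a, b⟩; exact ⟨⟨a, hF.subset a, hG.subset b⟩, b⟩
  rw [h6] at h5
  exact face_cross hT hs ht h5 (fun x hx => hF.subset hx.1)

lemma NF.poly (hT : IsLFCTiling T) (F : NF T) : IsPoly F.1 := by
  obtain ⟨F, hne, t, ht, h⟩ := F
  exact exposed_poly (tile_poly hT ht) h

/-- barycentre -/
noncomputable def bc (hT : IsLFCTiling T) (F : NF T) : EucSp d := (ri_nonempty (F.poly hT) F.2.1).some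

lemma bc_mem (hT : IsLFCTiling T) (F : NF T) : bc hT F ∈ ri F.1 :=
  (ri_nonempty (F.poly hT) F.2.1).some_mem

lemma NF.exp (hT : IsLFCTiling T) {F G : NF T} (h : F ≤ G) : IsExposed ℝ G.1 F.1 := by
  have hx := bc_mem hT F
  obtain ⟨t, ht, hF⟩ := F.2.2
  obtain ⟨s, hs, hG⟩ := G.2.2
  exact (key hT ht hs hF hG hx (h hx.1)).2

lemma NF.le_of_ri {F G : NF T} (hT : IsLFCTiling T) {x : EucSp d} (hx : x ∈ ri F.1)
    (hG : x ∈ G.1) : F ≤ G := by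
  obtain ⟨t, ht, hF⟩ := F.2.2
  obtain ⟨s, hs, hG'⟩ := G.2.2
  exact (key hT ht hs hF hG' hx hG).1

lemma NF.dim_lt (hT : IsLFCTiling T) {F G : NF T} (h : F < G) : dim F.1 < dim G.1 :=
  Geo.dim_lt (NF.exp hT h.le) F.2.1 fun e => h.ne (Subtype.ext e)

lemma chain_top {N : Type} [PartialOrder N] {C : Finset N} (hne : C.Nonempty)
    (hC : IsChain (· ≤ ·) (C : Set N)) : ∃ F ∈ C, ∀ G ∈ C, G ≤ F := by
  obtain ⟨F, hF⟩ := C.exists_maximal hne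
  refine ⟨F, hF.1, fun G hG => ?_⟩
  rcases hC.total hG hF.1 with h | h
  · exact h
  · exact hF.2 hG h

lemma ex_aux (hT : IsLFCTiling T) : ∀ n : ℕ, ∀ F : NF T, dim F.1 ≤ n → ∀ x ∈ F.1,
    ∃ C : Finset (NF T), C.Nonempty ∧ IsChain (· ≤ ·) (C : Set (NF T)) ∧ (∀ G ∈ C, G ≤ F) ∧
    ∃ w : NF T → ℝ, (∀ v ∈ C, 0 < w v) ∧ ∑ v ∈ C, w v = 1 ∧ ∑ v ∈ C, w v • bc hT v = x := by
  intro n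
  induction n with
  | zero =>
    intro F hF x hx
    have hFp := F.poly hT
    refine ⟨{F}, by simp, by simp, by simp, fun _ => 1, by simp, by simp, ?_⟩
    simp only [Finset.sum_singleton, one_smul]
    have h0 : dim F.1 = 0 := by omega
    have h1 : (affineSpan ℝ F.1).direction = ⊥ := Submodule.finrank_eq_zero.1 h0
    have h2 : x -ᵥ bc hT F ∈ (affineSpan ℝ F.1).direction :=
      AffineSubspace.vsub_mem_direction (subset_affineSpan ℝ _ hx)
        (subset_affineSpan ℝ _ (bc_mem hT F).1)
    rw [h1, Submodule.mem_bot, vsub_eq_sub, sub_eq_zero] at h2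
    exact h2.symm
  | succ n ih =>
    intro F hF x hx
    have hFp := F.poly hT
    set b := bc hT F with hb
    have hbF : b ∈ F.1 := (bc_mem hT F).1
    by_cases hxb : x = b
    · refine ⟨{F}, by simp, by simp, by simp, fun _ => 1, by simp, by simp, ?_⟩
      simp [hxb, hb]
    have hpos : 0 < ‖x - b‖ := norm_pos_iff.2 (sub_ne_zero.2 hxb)
    have hcont : Continuous fun s : ℝ => b + s • (x - b) := by fun_prop
    set I : Set ℝ := {s : ℝ | 1 ≤ s ∧ b + s • (x - b) ∈ F.1} with hI
    have hIcl : IsClosed I :=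
      (isClosed_le continuous_const continuous_id).inter
        (hFp.compact.isClosed.preimage hcont)
    obtain ⟨R, hR⟩ := hFp.compact.isBounded.subset_closedBall b
    have hIc : IsCompact I := by
      refine (isCompact_Icc (a := (1 : ℝ)) (b := R / ‖x - b‖)).of_isClosed_subset hIcl ?_
      rintro s ⟨h1, h2⟩
      refine ⟨h1, ?_⟩
      have h3 := hR h2
      rw [Metric.mem_closedBall, dist_eq_norm, add_sub_cancel_left, norm_smul] at h3
      rw [le_div_iff₀ hpos]
      calc s * ‖x - b‖ ≤ ‖s‖ * ‖x - b‖ :=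
            mul_le_mul_of_nonneg_right (le_abs_self s) hpos.le
        _ ≤ R := h3
    have h1I : (1 : ℝ) ∈ I := ⟨le_rfl, by simpa using hx⟩
    obtain ⟨m, hm, hmax⟩ := hIc.exists_isGreatest ⟨1, h1I⟩
    have hm1 : 1 ≤ m := hm.1
    have hm0 : 0 < m := by linarith
    set y := b + m • (x - b) with hy
    obtain ⟨G, hG, hyG, hGF⟩ := exit hFp.convex hbF hm.2 (by
      intro s hs hsF
      have h2 : b + (s * m) • (x - b) ∈ F.1 := by
        rw [add_sub_cancel_left, smul_smul] at hsF
        exact hsF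
      have h3 := hmax (show s * m ∈ I from ⟨by nlinarith, h2⟩)
      nlinarith)
    obtain ⟨t, ht, hFt⟩ := F.2.2
    let G' : NF T := ⟨G, ⟨y, hyG⟩, t, ht, exposed_trans (tile_poly hT ht) hFt hG⟩
    have hd : dim G < dim F.1 := Geo.dim_lt hG ⟨y, hyG⟩ hGF
    have hGF' : G' ≤ F := hG.subset
    obtain ⟨C, hCne, hC, hCG, w, hw, hw1, hwx⟩ := ih G' (by show dim G ≤ n; omega) y hyG
    rcases eq_or_lt_of_le hm1 with e | hlt
    · refine ⟨C, hCne, hC, fun H hH => (hCG H hH).trans hGF', w, hw, hw1, ?_⟩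
      rw [hwx, hy, ← e]; simp
    · have hFC : F ∉ C := fun h => hGF (subset_antisymm hG.subset (hCG F h))
      refine ⟨insert F C, Finset.insert_nonempty _ _, ?_, ?_,
        fun v => if v = F then 1 - 1 / m else w v / m, ?_, ?_, ?_⟩
      · rw [Finset.coe_insert]
        exact hC.insert fun H hH _ => Or.inr ((hCG H hH).trans hGF')
      · intro H hH
        rcases Finset.mem_insert.1 hH with rfl | hH
        · exact le_rfl
        · exact (hCG H hH).trans hGF'
      · intro H hH
        have : 1 / m < 1 := by rw [div_lt_one hm0]; exact hlt
        try dsimp only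
        split_ifs with h
        · linarith
        · exact div_pos (hw H ((Finset.mem_insert.1 hH).resolve_left h)) hm0
      · rw [Finset.sum_insert hFC]
        try dsimp only
        rw [if_pos rfl]
        have : ∑ v ∈ C, (if v = F then 1 - 1 / m else w v / m) = ∑ v ∈ C, w v / m :=
          Finset.sum_congr rfl fun v hv => if_neg fun e : v = F => hFC (e ▸ hv)
        rw [this, ← Finset.sum_div, hw1]; ring
      · rw [Finset.sum_insert hFC]
        try dsimp only
        rw [if_pos rfl]
        have : ∑ v ∈ C, (if v = F then 1 - 1 / m else w v / m) • bc hT v =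
            ∑ v ∈ C, (1 / m) • w v • bc hT v :=
          Finset.sum_congr rfl fun v hv => by
            rw [if_neg fun e : v = F => hFC (e ▸ hv), smul_smul]; congr 1; ring
        rw [this, ← Finset.smul_sum, hwx, hy, ← hb, smul_add, smul_smul]
        have : 1 / m * m = 1 := by field_simp
        rw [this, sub_smul, one_smul, one_smul]
        abel

lemma ri_comb (hT : IsLFCTiling T) {C : Finset (NF T)} {F : NF T} (hF : F ∈ C)
    (hC : ∀ G ∈ C, G ≤ F) {w : NF T → ℝ} (hw : ∀ v ∈ C, 0 < w v) (h1 : ∑ v ∈ C, w v = 1) :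
    ∑ v ∈ C, w v • bc hT v ∈ ri F.1 := by
  have hmem : ∀ v ∈ C, bc hT v ∈ F.1 := fun v hv => hC v hv (bc_mem hT v).1
  have hx : ∑ v ∈ C, w v • bc hT v ∈ F.1 :=
    (F.poly hT).convex.sum_mem (fun v hv => (hw v hv).le) h1 hmem
  refine ⟨hx, fun G hG hxG => ?_⟩
  obtain ⟨l, M, hl, hM⟩ := exposed_max hG ⟨_, hxG⟩
  have h2 := ((hM _).1 hxG).2
  rw [map_sum] at h2
  have h3 : ∑ v ∈ C, w v * l (bc hT v) = ∑ v ∈ C, w v * M := by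
    rw [← Finset.sum_mul, h1, one_mul, ← h2]
    simp
  have h4 := (Finset.sum_eq_sum_iff_of_le (fun v hv =>
    mul_le_mul_of_nonneg_left (hl _ (hmem v hv)) (hw v hv).le)).1 h3 F hF
  have h5 : l (bc hT F) = M := mul_left_cancel₀ (hw F hF).ne' h4
  exact (bc_mem hT F).2 G hG ((hM _).2 ⟨hmem F hF, h5⟩)

lemma top_le (hT : IsLFCTiling T) {C D : Finset (NF T)} {F : NF T} (hF : F ∈ C) (hFD : F ∈ D)
    (hCc : IsChain (· ≤ ·) (C : Set (NF T)))
    (hC : ∀ G ∈ C, G ≤ F) (hD : ∀ G ∈ D, G ≤ F) {w w' : NF T → ℝ} (hw : ∀ v ∈ C, 0 < w v)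
    (hw' : ∀ v ∈ D, 0 < w' v) (hs : ∑ v ∈ C, w v = ∑ v ∈ D, w' v)
    (hx : ∑ v ∈ C, w v • bc hT v = ∑ v ∈ D, w' v • bc hT v) : w' F ≤ w F := by
  by_contra hlt
  push Not at hlt
  rw [← Finset.add_sum_erase _ _ hF, ← Finset.add_sum_erase _ _ hFD] at hs hx
  have hne : (C.erase F).Nonempty := by
    by_contra h
    rw [Finset.not_nonempty_iff_eq_empty] at h
    rw [h] at hs
    have : 0 ≤ ∑ v ∈ D.erase F, w' v :=
      Finset.sum_nonneg fun v hv => (hw' v (Finset.mem_of_mem_erase hv)).le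
    simp at hs
    linarith
  obtain ⟨G, hG, hGtop⟩ := chain_top hne (hCc.mono (by simp))
  have hGF : G ≤ F := hC G (Finset.mem_of_mem_erase hG)
  have hexp := NF.exp hT hGF
  obtain ⟨l, M, hl, hM⟩ := exposed_max hexp G.2.1
  have h1 : l (bc hT F) < M := by
    refine lt_of_le_of_ne (hl _ (bc_mem hT F).1) fun e => ?_
    have := (bc_mem hT F).2 _ hexp ((hM _).2 ⟨(bc_mem hT F).1, e⟩)
    exact (Finset.ne_of_mem_erase hG) (Subtype.ext this)
  have h2 := congrArg l hx
  simp only [map_add, map_sum, map_smul, smul_eq_mul] at h2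
  have h3 : ∑ v ∈ C.erase F, w v * l (bc hT v) = (∑ v ∈ C.erase F, w v) * M := by
    rw [Finset.sum_mul]
    refine Finset.sum_congr rfl fun v hv => ?_
    rw [((hM _).1 (hGtop v hv (bc_mem hT v).1)).2]
  have h4 : ∑ v ∈ D.erase F, w' v * l (bc hT v) ≤ (∑ v ∈ D.erase F, w' v) * M := by
    rw [Finset.sum_mul]
    refine Finset.sum_le_sum fun v hv => ?_
    have hv' := Finset.mem_of_mem_erase hv
    exact mul_le_mul_of_nonneg_left (hl _ (hD v hv' (bc_mem hT v).1)) (hw' v hv').le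
  have h5 : ∑ v ∈ C.erase F, w v = (w' F - w F) + ∑ v ∈ D.erase F, w' v := by linarith
  rw [h3, h5, add_mul] at h2
  have h6 : 0 < (w' F - w F) * (M - l (bc hT F)) := mul_pos (by linarith) (by linarith)
  nlinarith

lemma uniq_aux (hT : IsLFCTiling T) : ∀ n : ℕ, ∀ C D : Finset (NF T), C.card = n →
    IsChain (· ≤ ·) (C : Set (NF T)) → IsChain (· ≤ ·) (D : Set (NF T)) → ∀ w w' : NF T → ℝ,
    (∀ v ∈ C, 0 < w v) → (∀ v ∈ D, 0 < w' v) → ∑ v ∈ C, w v = ∑ v ∈ D, w' v →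
    ∑ v ∈ C, w v • bc hT v = ∑ v ∈ D, w' v • bc hT v → C = D ∧ ∀ v ∈ C, w v = w' v := by
  have hpos : ∀ (C : Finset (NF T)) (w : NF T → ℝ), (∀ v ∈ C, 0 < w v) → C.Nonempty →
    0 < ∑ v ∈ C, w v := fun C w h hne => Finset.sum_pos h hne
  intro n
  induction n with
  | zero =>
    intro C D hn _ _ w w' _ hw' hs _
    rw [Finset.card_eq_zero] at hn
    subst hn
    have : D = ∅ := by
      by_contra h
      have := hpos D w' hw' (Finset.nonempty_iff_ne_empty.2 h)
      simp at hs
      linarith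
    exact ⟨this.symm, by simp⟩
  | succ n ih =>
    intro C D hn hC hD w w' hw hw' hs hx
    have hCne : C.Nonempty := Finset.card_pos.1 (by omega)
    have hc := hpos C w hw hCne
    have hDne : D.Nonempty := by
      rw [Finset.nonempty_iff_ne_empty]
      rintro rfl
      simp at hs
      linarith
    obtain ⟨F, hF, hFt⟩ := chain_top hCne hC
    obtain ⟨F', hF', hFt'⟩ := chain_top hDne hD
    set c := ∑ v ∈ C, w v with hcdef
    have r1 := ri_comb hT hF hFt (w := fun v => w v / c) (fun v hv => div_pos (hw v hv) hc)
      (by rw [← Finset.sum_div, ← hcdef, div_self hc.ne'])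
    have r2 := ri_comb hT hF' hFt' (w := fun v => w' v / c) (fun v hv => div_pos (hw' v hv) hc)
      (by rw [← Finset.sum_div, ← hs, div_self hc.ne'])
    have he : ∑ v ∈ C, (w v / c) • bc hT v = ∑ v ∈ D, (w' v / c) • bc hT v := by
      simp only [div_eq_inv_mul, mul_smul]
      rw [← Finset.smul_sum, ← Finset.smul_sum, hx]
    have hFF : F = F' := by
      apply le_antisymm
      · refine NF.le_of_ri hT r1 ?_
        try dsimp only
        rw [he]; exact r2.1
      · refine NF.le_of_ri hT r2 ?_
        try dsimp only
        rw [← he]; exact r1.1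
    subst hFF
    have hww : w F = w' F :=
      le_antisymm (top_le hT hF' hF hD hFt' hFt hw' hw hs.symm hx.symm)
        (top_le hT hF hF' hC hFt hFt' hw hw' hs hx)
    have hs2 := hs
    have hx2 := hx
    rw [hcdef, ← Finset.add_sum_erase _ _ hF, ← Finset.add_sum_erase _ _ hF', hww] at hs2
    rw [← Finset.add_sum_erase _ _ hF, ← Finset.add_sum_erase _ _ hF', hww] at hx2
    obtain ⟨h1, h2⟩ := ih (C.erase F) (D.erase F)
      (by rw [Finset.card_erase_of_mem hF]; omega) (hC.mono (by simp))
      (hD.mono (by simp)) w w' (fun v hv => hw v (Finset.mem_of_mem_erase hv))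
      (fun v hv => hw' v (Finset.mem_of_mem_erase hv)) (add_left_cancel hs2) (add_left_cancel hx2)
    constructor
    · rw [← Finset.insert_erase hF, ← Finset.insert_erase hF', h1]
    · intro v hv
      by_cases e : v = F
      · rw [e, hww]
      · exact h2 v (Finset.mem_erase.2 ⟨e, hv⟩)

lemma exists_NF (hT : IsLFCTiling T) (x : EucSp d) : ∃ F : NF T, x ∈ F.1 := by
  have : x ∈ ⋃₀ T := by rw [hT.covers]; trivial
  obtain ⟨t, ht, hx⟩ := this
  exact ⟨⟨t, ⟨x, hx⟩, t, ht, IsExposed.refl t⟩, hx⟩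

/-- the barycentric subdivision -/
noncomputable def tri (hT : IsLFCTiling T) (hd : 0 < d) : Tri d (NF T) where
  b := bc hT
  S := {C | C.Nonempty ∧ IsChain (· ≤ ·) (C : Set (NF T))}
  ne := fun C h => h.1
  down := fun C h D hD hne => ⟨hne, h.2.mono (by exact_mod_cast hD)⟩
  ex := by
    intro x
    obtain ⟨F, hF⟩ := exists_NF hT x
    obtain ⟨C, h1, h2, -, w, h3⟩ := ex_aux hT _ F le_rfl x hF
    exact ⟨C, ⟨h1, h2⟩, w, h3⟩
  uniq := by
    intro C hC D hD w w' hw h1 hw' h1' he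
    exact uniq_aux hT _ C D rfl hC.2 hD.2 w w' hw hw' (h1.trans h1'.symm) he
  lf := by
    intro R
    have hfin := hT.locally_finite (Metric.closedBall 0 R) Metric.isBounded_closedBall
    have hA : (⋃ t ∈ {t ∈ T | (t ∩ Metric.closedBall 0 R).Nonempty},
        {F : NF T | IsExposed ℝ t F.1}).Finite := by
      refine hfin.biUnion fun t ht => ?_
      exact (exposed_finite (tile_poly hT ht.1)).preimage Subtype.val_injective.injOn
    refine (hA.toFinset.powerset.finite_toSet).subset ?_
    rintro C ⟨⟨hne, hC⟩, x, hx, hxR⟩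
    obtain ⟨F, hF, hFt⟩ := chain_top hne hC
    obtain ⟨t, ht, hFe⟩ := F.2.2
    have hxF : x ∈ F.1 := by
      refine convexHull_min ?_ (F.poly hT).convex hx
      rintro _ ⟨G, hG, rfl⟩
      exact hFt G hG (bc_mem hT G).1
    refine Finset.mem_coe.2 (Finset.mem_powerset.2 fun G hG => ?_)
    rw [Set.Finite.mem_toFinset]
    refine Set.mem_biUnion (x := t) ⟨ht, x, hFe.subset hxF, by simpa using hxR⟩ ?_
    exact exposed_trans (tile_poly hT ht) hFe (NF.exp hT (hFt G hG))
  rk := fun F => ⟨dim F.1, Nat.lt_succ_of_le (dim_le _)⟩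
  rk_inj := by
    rintro C ⟨-, hC⟩ F hF G hG h
    have h' : dim F.1 = dim G.1 := by simpa using h
    by_contra hne
    rcases hC hF hG hne with h1 | h1
    · exact absurd h' (NF.dim_lt hT (lt_of_le_of_ne h1 hne)).ne
    · exact absurd h'.symm (NF.dim_lt hT (lt_of_le_of_ne h1 (Ne.symm hne))).ne
  dpos := hd

end Geo


namespace Tri

/-- an order complex -/
structure Ord {d : ℕ} {N : Type} [PartialOrder N] (K : Tri d N) : Prop where
  S_iff : ∀ C, C ∈ K.S ↔ C.Nonempty ∧ IsChain (· ≤ ·) (C : Set N)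
  mono : StrictMono K.rk
  meet : ∀ a b b' : N, a ≤ b → a ≤ b' → ∃ m, m ≤ b ∧ m ≤ b' ∧ ∀ c, c ≤ b → c ≤ b' → c ≤ m

namespace Ord

variable {d : ℕ} {N : Type} [PartialOrder N] {K : Tri d N}

lemma vtx_strict (O : K.Ord) (Φ : K.Fac) : StrictMono (K.vtx Φ) := by
  intro i j hij
  have hne : K.vtx Φ i ≠ K.vtx Φ j := by
    intro e
    have := congrArg K.rk e
    rw [K.rk_vtx, K.rk_vtx] at this
    exact hij.ne this
  rcases ((O.S_iff _).1 Φ.2.1).2 (K.vtx_mem Φ i) (K.vtx_mem Φ j) hne with h | h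
  · exact lt_of_le_of_ne h hne
  · have := O.mono (lt_of_le_of_ne h hne.symm)
    rw [K.rk_vtx, K.rk_vtx] at this
    exact absurd this hij.not_gt

lemma mk_fac (O : K.Ord) (f : Fin (d + 1) → N) (hf : Monotone f) (hr : ∀ i, K.rk (f i) = i) :
    ∃ Φ : K.Fac, ∀ i, K.vtx Φ i = f i := by
  have hinj : Function.Injective f := fun i j h => by rw [← hr i, ← hr j, h]
  have hS : Finset.univ.image f ∈ K.S := by
    rw [O.S_iff]
    refine ⟨by simp, ?_⟩
    intro x hx y hy _
    simp only [Finset.coe_image, Finset.coe_univ, Set.image_univ, Set.mem_range] at hx hy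
    obtain ⟨i, rfl⟩ := hx
    obtain ⟨j, rfl⟩ := hy
    rcases le_total i j with h | h
    · exact Or.inl (hf h)
    · exact Or.inr (hf h)
  have hc : (Finset.univ.image f).card = d + 1 := by
    rw [Finset.card_image_of_injective _ hinj]; simp
  refine ⟨⟨_, hS, hc⟩, fun i => ?_⟩
  have : f i ∈ (⟨_, hS, hc⟩ : K.Fac).1 := Finset.mem_image_of_mem f (Finset.mem_univ i)
  have h2 := K.eq_vtx this
  rwa [hr] at h2

lemma comm (O : K.Ord) (i j : Fin (d + 1)) (Φ : K.Fac) (h : (i : ℕ) + 2 ≤ j) :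
    K.r i (K.r j Φ) = K.r j (K.r i Φ) := by
  have hij : i ≠ j := by rintro rfl; omega
  set f : Fin (d + 1) → N := fun k =>
    if k = i then K.vtx (K.r i Φ) i else if k = j then K.vtx (K.r j Φ) j else K.vtx Φ k with hf
  have f1 : ∀ k, k ≠ j → f k = K.vtx (K.r i Φ) k := by
    intro k hk
    by_cases e : k = i
    · simp [hf, e]
    · simp [hf, e, hk, K.vtx_r e]
  have f2 : ∀ k, k ≠ i → f k = K.vtx (K.r j Φ) k := by
    intro k hk
    by_cases e : k = j
    · subst e; simp [hf, hk]
    · simp [hf, e, hk, K.vtx_r e]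
  have hm : Monotone f := by
    intro k l hkl
    by_cases h1 : k ≠ i ∧ l ≠ i
    · rw [f2 k h1.1, f2 l h1.2]; exact (O.vtx_strict _).monotone hkl
    by_cases h2 : k ≠ j ∧ l ≠ j
    · rw [f1 k h2.1, f1 l h2.2]; exact (O.vtx_strict _).monotone hkl
    have hh : k = i ∧ l = j := by
      have hkl' : (k : ℕ) ≤ l := hkl
      by_cases a : k = i
      · refine ⟨a, ?_⟩
        by_contra b
        exact h2 ⟨by rw [a]; exact hij, b⟩
      · have b : l = i := by
          by_contra b
          exact h1 ⟨a, b⟩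
        have c : k = j := by
          by_contra c
          exact h2 ⟨c, by rw [b]; exact hij⟩
        subst b c
        omega
    obtain ⟨rfl, rfl⟩ := hh
    let m : Fin (d + 1) := ⟨k + 1, by omega⟩
    have hmk : m ≠ k := by intro e; have := congrArg Fin.val e; simp [m] at this
    have hml : m ≠ l := by intro e; have := congrArg Fin.val e; simp [m] at this; omega
    calc f k = K.vtx (K.r k Φ) k := f1 k hij
      _ ≤ K.vtx (K.r k Φ) m := (O.vtx_strict _).monotone (by rw [Fin.le_def]; simp [m])
      _ = f m := (f1 m hml).symm
      _ = K.vtx (K.r l Φ) m := f2 m hmk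
      _ ≤ K.vtx (K.r l Φ) l := (O.vtx_strict _).monotone (by rw [Fin.le_def]; simp [m]; omega)
      _ = f l := (f2 l hij.symm).symm
  have hr : ∀ k, K.rk (f k) = k := by
    intro k
    by_cases e : k = i
    · rw [f1 k (by rw [e]; exact hij), K.rk_vtx]
    · rw [f2 k e, K.rk_vtx]
  obtain ⟨Ω, hΩ⟩ := O.mk_fac f hm hr
  have e1 : Ω = K.r i (K.r j Φ) := by
    rcases K.adj_cases (i := i) (Φ := K.r j Φ) (Ψ := Ω) (fun k hk => by rw [hΩ, f2 k hk]) with h | h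
    · exfalso
      have := hΩ i
      rw [h, f1 i hij, K.vtx_r hij] at this
      exact K.vtx_r_ne i Φ this.symm
    · exact h
  have e2 : Ω = K.r j (K.r i Φ) := by
    rcases K.adj_cases (i := j) (Φ := K.r i Φ) (Ψ := Ω) (fun k hk => by rw [hΩ, f1 k hk]) with h | h
    · exfalso
      have := hΩ j
      rw [h, f2 j hij.symm, K.vtx_r hij.symm] at this
      exact K.vtx_r_ne j Φ this.symm
    · exact h
  rw [← e1, e2]

lemma four (O : K.Ord) (i j : Fin (d + 1)) (Φ : K.Fac) (h : (i : ℕ) + 1 = j) :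
    K.r i (K.r j (K.r i (K.r j Φ))) ≠ Φ := by
  intro he
  have hij : i ≠ j := by rintro rfl; omega
  have hlt : i < j := by rw [Fin.lt_def]; omega
  set a := K.vtx Φ i with ha
  set b := K.vtx Φ j with hb
  set Φ1 := K.r j Φ
  set Φ2 := K.r i Φ1 with hΦ2
  set Φ3 := K.r j Φ2 with hΦ3
  have a1 : K.vtx Φ1 i = a := K.vtx_r hij Φ
  set b' := K.vtx Φ1 j with hb'
  have hbb : b' ≠ b := K.vtx_r_ne j Φ
  set a' := K.vtx Φ2 i with ha'
  have haa : a' ≠ a := by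
    have := K.vtx_r_ne i Φ1
    rwa [a1] at this
  have b2 : K.vtx Φ2 j = b' := K.vtx_r hij.symm Φ1
  have a3 : K.vtx Φ3 i = a' := K.vtx_r hij Φ2
  have b3 : K.vtx Φ3 j = b := by
    rw [hb]
    conv_rhs => rw [← he]
    exact (K.vtx_r hij.symm Φ3).symm
  have l1 : a ≤ b := (O.vtx_strict Φ).monotone hlt.le
  have l2 : a ≤ b' := by rw [← a1]; exact (O.vtx_strict Φ1).monotone hlt.le
  have l3 : a' ≤ b' := by rw [← b2]; exact (O.vtx_strict Φ2).monotone hlt.le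
  have l4 : a' ≤ b := by rw [← a3, ← b3]; exact (O.vtx_strict Φ3).monotone hlt.le
  obtain ⟨m, m1, m2, m3⟩ := O.meet a b b' l1 l2
  have ra : K.rk a = i := K.rk_vtx _ _
  have ra' : K.rk a' = i := K.rk_vtx _ _
  have rb : K.rk b = j := K.rk_vtx _ _
  have rb' : K.rk b' = j := K.rk_vtx _ _
  have hmb : m ≠ b := by
    rintro rfl
    have := O.mono (lt_of_le_of_ne m2 hbb.symm)
    rw [rb, rb'] at this
    exact lt_irrefl _ this
  have hm : K.rk m < j := by
    have := O.mono (lt_of_le_of_ne m1 hmb)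
    rwa [rb] at this
  have key : ∀ c, c ≤ m → K.rk c = i → c = m := by
    intro c hc hci
    by_contra hne
    have := O.mono (lt_of_le_of_ne hc hne)
    rw [hci] at this
    rw [Fin.lt_def] at this hm
    omega
  exact haa ((key a' (m3 a' l4 l3) ra').trans (key a (m3 a l1 l2) ra).symm)

lemma ne (i j : Fin (d + 1)) (Φ : K.Fac) (h : i ≠ j) : K.r i Φ ≠ K.r j Φ := by
  intro e
  have h1 := K.vtx_r_ne i Φ
  rw [e, K.vtx_r h] at h1
  exact h1 rfl

end Ord

end Tri


namespace Tri.Ord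

variable {d : ℕ} {N : Type} [PartialOrder N] {K : Tri d N}

/-- same orbit -/
def Orb (K : Tri d N) (Φ Ψ : K.Fac) : Prop := ∃ δ : N ≃o N, ∀ v ∈ Φ.1, δ v ∈ Ψ.1

lemma mem_iff_of {Φ Ψ : K.Fac} {δ : N ≃o N} (h : ∀ v ∈ Φ.1, δ v ∈ Ψ.1) {v : N} :
    δ v ∈ Ψ.1 ↔ v ∈ Φ.1 := by
  have h1 : Φ.1.image δ = Ψ.1 := by
    apply Finset.eq_of_subset_of_card_le
    · intro x hx
      obtain ⟨v, hv, rfl⟩ := Finset.mem_image.1 hx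
      exact h v hv
    · rw [Finset.card_image_of_injective _ δ.injective, Φ.2.2, Ψ.2.2]
  rw [← h1, Finset.mem_image]
  constructor
  · rintro ⟨u, hu, e⟩
    rwa [← δ.injective e]
  · intro hv
    exact ⟨v, hv, rfl⟩

lemma Orb.refl (Φ : K.Fac) : Orb K Φ Φ := ⟨OrderIso.refl N, fun _ hv => hv⟩

lemma Orb.symm {Φ Ψ : K.Fac} (h : Orb K Φ Ψ) : Orb K Ψ Φ := by
  obtain ⟨δ, h⟩ := h
  refine ⟨δ.symm, fun v hv => ?_⟩
  rw [← mem_iff_of h, OrderIso.apply_symm_apply]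
  exact hv

lemma Orb.trans {Φ Ψ Ω : K.Fac} (h : Orb K Φ Ψ) (h' : Orb K Ψ Ω) : Orb K Φ Ω := by
  obtain ⟨δ, h⟩ := h
  obtain ⟨δ', h'⟩ := h'
  exact ⟨δ.trans δ', fun v hv => h' _ (h _ hv)⟩

lemma single_mem (O : K.Ord) (v : N) : {v} ∈ K.S := by
  rw [O.S_iff]; simp

lemma rk_aut (O : K.Ord) (δ : N ≃o N) (v : N) : K.rk (δ v) = K.rk v := by
  obtain ⟨Φ, hΦ⟩ := K.exists_fac (O.single_mem v)
  have hv : v ∈ Φ.1 := hΦ (Finset.mem_singleton_self v)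
  have hs : StrictMono fun i => K.rk (δ (K.vtx Φ i)) :=
    O.mono.comp (δ.strictMono.comp (O.vtx_strict Φ))
  have h1 : K.rk (δ (K.vtx Φ (K.rk v))) = K.rk v := le_antisymm hs.apply_le hs.le_apply
  rwa [K.eq_vtx hv] at h1

lemma Orb.map (O : K.Ord) {Φ Ψ : K.Fac} (h : Orb K Φ Ψ) :
    ∃ g : K.Fac → K.Fac, (∀ i Ω, g (K.r i Ω) = K.r i (g Ω)) ∧ g Φ = Ψ ∧ ∀ Ω, Orb K Ω (g Ω) := by
  obtain ⟨δ, h⟩ := h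
  have hex : ∀ Ω : K.Fac, ∃ Ω' : K.Fac, ∀ i, K.vtx Ω' i = δ (K.vtx Ω i) := by
    intro Ω
    refine O.mk_fac (fun i => δ (K.vtx Ω i)) (δ.monotone.comp (O.vtx_strict Ω).monotone) fun i => ?_
    rw [O.rk_aut, K.rk_vtx]
  choose g hg using hex
  refine ⟨g, fun i Ω => ?_, ?_, fun Ω => ⟨δ, fun v hv => ?_⟩⟩
  · rcases K.adj_cases (i := i) (Φ := g Ω) (Ψ := g (K.r i Ω))
      (fun j hj => by rw [hg, hg, K.vtx_r hj]) with e | e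
    · exfalso
      have h1 := hg (K.r i Ω) i
      rw [e, hg] at h1
      exact K.vtx_r_ne i Ω (δ.injective h1).symm
    · exact e
  · apply K.fac_ext
    intro i
    rw [hg]
    have h1 := h _ (K.vtx_mem Φ i)
    have h2 := K.eq_vtx h1
    rw [O.rk_aut, K.rk_vtx] at h2
    exact h2.symm
  · rw [← K.eq_vtx hv, ← hg]
    exact K.vtx_mem _ _

/-- vertex map induced by a map of facets -/
lemma vmap (O : K.Ord) (g : K.Fac → K.Fac) (hg : ∀ i Ω, g (K.r i Ω) = K.r i (g Ω)) :
    ∃ γ : N → N, Monotone γ ∧ ∀ Φ : K.Fac, ∀ v ∈ Φ.1, γ v = K.vtx (g Φ) (K.rk v) := by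
  have hwd : ∀ (v : N) (Φ Ψ : K.Fac), v ∈ Φ.1 → v ∈ Ψ.1 →
      K.vtx (g Φ) (K.rk v) = K.vtx (g Ψ) (K.rk v) := by
    intro v Φ Ψ hΦ hΨ
    have := K.conn_res (O.single_mem v)
      {Ω | v ∈ Ω.1 ∧ K.vtx (g Φ) (K.rk v) = K.vtx (g Ω) (K.rk v)} ?_ (Φ := Φ) (Ψ := Ψ)
      (by simpa using hΦ) (by simpa using hΨ) ⟨hΦ, rfl⟩
    · exact this.2
    · rintro Ω ⟨h1, h2⟩ i hi
      refine ⟨by simpa using hi, ?_⟩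
      have h3 := (K.sub_r (C := {v}) (by simpa using h1)).1 hi v (by simp)
      rw [hg, K.vtx_r h3]
      exact h2
  have hex : ∀ v : N, ∃ Φ : K.Fac, v ∈ Φ.1 := fun v => by
    obtain ⟨Φ, hΦ⟩ := K.exists_fac (O.single_mem v)
    exact ⟨Φ, hΦ (Finset.mem_singleton_self v)⟩
  choose c hc using hex
  have hprop : ∀ Φ : K.Fac, ∀ v ∈ Φ.1, K.vtx (g (c v)) (K.rk v) = K.vtx (g Φ) (K.rk v) :=
    fun Φ v hv => hwd v _ _ (hc v) hv
  refine ⟨fun v => K.vtx (g (c v)) (K.rk v), ?_, hprop⟩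
  intro u v huv
  have hS : ({u, v} : Finset N) ∈ K.S := by
    rw [O.S_iff]
    refine ⟨by simp, ?_⟩
    rw [Finset.coe_pair]
    exact IsChain.pair huv
  obtain ⟨Φ, hΦ⟩ := K.exists_fac hS
  show K.vtx (g (c u)) (K.rk u) ≤ K.vtx (g (c v)) (K.rk v)
  rw [hprop Φ u (hΦ (by simp)), hprop Φ v (hΦ (by simp))]
  exact (O.vtx_strict _).monotone (O.mono.monotone huv)

lemma orb_of_inv (O : K.Ord) (g s : K.Fac → K.Fac) (hg : ∀ i Ω, g (K.r i Ω) = K.r i (g Ω))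
    (hs : ∀ i Ω, s (K.r i Ω) = K.r i (s Ω)) (h1 : ∀ Ω, g (s Ω) = Ω) (h2 : ∀ Ω, s (g Ω) = Ω)
    (Φ : K.Fac) : Orb K Φ (g Φ) := by
  obtain ⟨γ, γm, hγ⟩ := O.vmap g hg
  obtain ⟨σ, σm, hσ⟩ := O.vmap s hs
  have hinv : ∀ (g s : K.Fac → K.Fac) (γ σ : N → N), (∀ Ω, s (g Ω) = Ω) →
      (∀ Φ : K.Fac, ∀ v ∈ Φ.1, γ v = K.vtx (g Φ) (K.rk v)) →
      (∀ Φ : K.Fac, ∀ v ∈ Φ.1, σ v = K.vtx (s Φ) (K.rk v)) → ∀ v, σ (γ v) = v := by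
    intro g s γ σ h hγ hσ v
    obtain ⟨Φ, hΦ⟩ := K.exists_fac (O.single_mem v)
    have hv : v ∈ Φ.1 := hΦ (Finset.mem_singleton_self v)
    rw [hγ Φ v hv, hσ (g Φ) _ (K.vtx_mem _ _), h, K.rk_vtx, K.eq_vtx hv]
  have i1 := hinv g s γ σ h2 hγ hσ
  have i2 := hinv s g σ γ h1 hσ hγ
  refine ⟨{ toFun := γ, invFun := σ, left_inv := i1, right_inv := i2, map_rel_iff' := ?_ }, ?_⟩
  · intro a b
    constructor
    · intro h
      have := σm h
      change σ (γ a) ≤ σ (γ b) at this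
      rwa [i1, i1] at this
    · intro h
      exact γm h
  · intro v hv
    change γ v ∈ (g Φ).1
    rw [hγ Φ v hv]
    exact K.vtx_mem _ _

lemma lift (K : Tri d N) (X : Type) (π : X → K.Fac) (R : Fin (d + 1) → X → X)
    (h1 : ∀ i x, π (R i x) = K.r i (π x)) (h2 : ∀ i x, R i (R i x) = x)
    (h3 : ∀ i j, i ≠ j → ∀ x (k : ℕ), (K.r i ∘ K.r j)^[k] (π x) = π x → (R i ∘ R j)^[k] x = x)
    (e : X) : ∃ s : K.Fac → X, s (π e) = e ∧ (∀ Φ, π (s Φ) = Φ) ∧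
      ∀ i Φ, s (K.r i Φ) = R i (s Φ) :=
  Tri.Cov.section_exists (K := K) ⟨π, R, h1, h2, h3⟩ e

lemma comm_iter (g : K.Fac → K.Fac) (hg : ∀ i Ω, g (K.r i Ω) = K.r i (g Ω)) (i j : Fin (d + 1))
    (k : ℕ) (Ω : K.Fac) : g ((K.r i ∘ K.r j)^[k] Ω) = (K.r i ∘ K.r j)^[k] (g Ω) := by
  induction k generalizing Ω with
  | zero => rfl
  | succ k ih =>
    rw [Function.iterate_succ_apply, Function.iterate_succ_apply, ih]
    simp only [Function.comp]
    rw [hg, hg]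

/-- the two-orbit system -/
lemma final (O : K.Ord) {Φ₀ Ψ₀ : K.Fac} (hno : ¬ Orb K Φ₀ Ψ₀)
    (hall : ∀ Ω, Orb K Ω Φ₀ ∨ Orb K Ω Ψ₀) : Nonempty (Sys (d + 1) K.Fac) := by
  set col : K.Fac → Bool := fun Φ => decide (Orb K Φ Φ₀) with hcol
  have hO : ∀ Φ Ψ, col Φ = col Ψ ↔ Orb K Φ Ψ := by
    intro Φ Ψ
    have h0 : col Φ = col Ψ ↔ (Orb K Φ Φ₀ ↔ Orb K Ψ Φ₀) := by
      simp [hcol]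
    rw [h0]
    constructor
    · intro h
      by_cases h1 : Orb K Φ Φ₀
      · exact h1.trans (h.1 h1).symm
      · have h2 := (hall Φ).resolve_left h1
        have h3 := (hall Ψ).resolve_left (fun h' => h1 (h.2 h'))
        exact h2.trans h3.symm
    · intro h
      exact ⟨fun h' => h.symm.trans h', fun h' => h.trans h'⟩
  -- colour change is uniform
  have hJ : ∀ i Φ Ψ, col (K.r i Φ) = col Φ → col (K.r i Ψ) = col Ψ := by
    have hsame : ∀ i Φ Ψ, col Φ = col Ψ → col (K.r i Φ) = col (K.r i Ψ) := by
      intro i Φ Ψ h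
      obtain ⟨g, hg, hgΦ, hgo⟩ := ((hO _ _).1 h).map O
      have := (hO _ _).2 (hgo (K.r i Φ))
      rwa [hg, hgΦ] at this
    intro i Φ Ψ h
    by_cases e : col Φ = col Ψ
    · rw [← hsame i Φ Ψ e, h, e]
    · by_contra hne
      have h1 : col (K.r i Ψ) = col Φ := by
        revert e hne; cases col Φ <;> cases col Ψ <;> cases col (K.r i Ψ) <;> simp
      have h2 := hsame i _ _ h1
      rw [K.r_r, h] at h2
      exact e h2.symm
  have haut' : ∀ g : K.Fac → K.Fac, (∀ i Ω, g (K.r i Ω) = K.r i (g Ω)) →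
      ∀ Φ, col (g Φ) = col Φ := by
    intro g hg Φ
    by_contra hne
    have hsw : ∀ Ψ, col (g Ψ) ≠ col Ψ := by
      refine fun Ψ => K.conn_all {Ψ | col (g Ψ) ≠ col Ψ} ?_ hne Ψ
      intro Ω hΩ i
      change col (g (K.r i Ω)) ≠ col (K.r i Ω)
      change col (g Ω) ≠ col Ω at hΩ
      rw [hg]
      have h1 := hJ i Ω (g Ω)
      have h2 := hJ i (g Ω) Ω
      revert hΩ h1 h2
      cases col Ω <;> cases col (g Ω) <;> cases col (K.r i Ω) <;> cases col (K.r i (g Ω)) <;> simp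
    obtain ⟨s, s1, s2, s3⟩ := lift K K.Fac g K.r hg K.r_r (by
      intro i j _ Ω k hk
      have h1 := congrArg g hk
      rw [comm_iter g hg] at h1
      have h2 : col (g (g Ω)) = col Ω := by
        have a := hsw Ω
        have b := hsw (g Ω)
        revert a b
        cases col Ω <;> cases col (g Ω) <;> cases col (g (g Ω)) <;> simp
      obtain ⟨h, hh, hh2, -⟩ := ((hO _ _).1 h2).map O
      have h3 := congrArg h h1
      rw [comm_iter h hh, hh2] at h3
      exact h3) Φ
    have s4 : ∀ Ω, s (g Ω) = Ω := by
      refine fun Ω => K.conn_all {Ω | s (g Ω) = Ω} ?_ s1 Ω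
      intro Ω hΩ i
      change s (g (K.r i Ω)) = K.r i Ω
      rw [hg, s3]
      exact congrArg _ hΩ
    exact hne ((hO _ _).2 (O.orb_of_inv g s hg s3 s2 s4 Φ).symm)
  exact ⟨{
    r := K.r
    col := col
    inv := K.r_r
    nofix := K.r_ne
    ne := fun i j Φ h => Ord.ne i j Φ h
    comm := O.comm
    four := O.four
    aut := by
      intro Φ Ψ h
      obtain ⟨g, hg, hgΦ, -⟩ := ((hO _ _).1 h).map O
      exact ⟨g, hg, hgΦ⟩
    aut' := haut'
    onto := by
      intro c
      cases c
      · exact ⟨Ψ₀, decide_eq_false fun h => hno h.symm⟩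
      · exact ⟨Φ₀, decide_eq_true (Orb.refl _)⟩
    conn := fun W hW Φ hΦ Ψ => K.conn_all W hW hΦ Ψ
    fin := by
      intro i Φ
      refine ⟨{Ψ : K.Fac | {K.vtx Φ i} ⊆ Ψ.1}, K.res_finite (O.single_mem _), ?_, ?_⟩
      · simpa using K.vtx_mem Φ i
      · intro Ψ hΨ j hj
        refine (K.sub_r hΨ).2 ?_
        intro v hv
        rw [Finset.mem_singleton.1 hv, K.rk_vtx]
        exact hj.symm
    lift := lift K }⟩

end Tri.Ord


namespace Tri.Ord

variable {d : ℕ} {N : Type} [PartialOrder N] {K : Tri d N}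

lemma two_orb (O : K.Ord) {P : Type} [PartialOrder P] (bot top : P) (hb : ∀ p, bot ≤ p)
    (ht : ∀ p, p ≤ top) (ι : N → P) (hι : ∀ x y, ι x ≤ ι y ↔ x ≤ y) (hιb : ∀ x, ι x ≠ bot)
    (hιt : ∀ x, ι x ≠ top) (hP : ∀ p, p = bot ∨ p = top ∨ ∃ x, ι x = p) (h2 : TwoFlagOrbits P) :
    ∃ Φ₀ Ψ₀ : K.Fac, ¬ Orb K Φ₀ Ψ₀ ∧ ∀ Ω, Orb K Ω Φ₀ ∨ Orb K Ω Ψ₀ := by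
  have hinj : ∀ x y, ι x = ι y → x = y := fun x y h =>
    le_antisymm ((hι x y).1 h.le) ((hι y x).1 h.ge)
  -- flag of a facet
  have hA : ∀ Φ : K.Fac, ∃ Ω : Flag P, ∀ p, p ∈ Ω ↔ p = bot ∨ p = top ∨ ∃ x ∈ Φ.1, ι x = p := by
    intro Φ
    have hch := ((O.S_iff _).1 Φ.2.1).2
    set s : Set P := {p | p = bot ∨ p = top ∨ ∃ x ∈ Φ.1, ι x = p} with hs
    have hc : IsChain (· ≤ ·) s := by
      rintro p (rfl | rfl | ⟨x, hx, rfl⟩) q (rfl | rfl | ⟨y, hy, rfl⟩) hne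
      · exact Or.inl le_rfl
      · exact Or.inl (hb _)
      · exact Or.inl (hb _)
      · exact Or.inr (hb _)
      · exact Or.inl le_rfl
      · exact Or.inr (ht _)
      · exact Or.inr (hb _)
      · exact Or.inl (ht _)
      · rcases hch.total hx hy with h | h
        · exact Or.inl ((hι _ _).2 h)
        · exact Or.inr ((hι _ _).2 h)
    refine ⟨⟨s, hc, ?_⟩, fun p => Iff.rfl⟩
    intro t htc hst
    refine subset_antisymm hst fun p hp => ?_
    rcases hP p with h | h | ⟨x, rfl⟩
    · exact Or.inl h
    · exact Or.inr (Or.inl h)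
    · refine Or.inr (Or.inr ⟨x, ?_, rfl⟩)
      have hS : insert x Φ.1 ∈ K.S := by
        rw [O.S_iff]
        refine ⟨Finset.insert_nonempty _ _, ?_⟩
        rw [Finset.coe_insert]
        refine hch.insert fun y hy _ => ?_
        rcases htc.total hp (hst (show ι y ∈ s from Or.inr (Or.inr ⟨y, hy, rfl⟩))) with h | h
        · exact Or.inl ((hι _ _).1 h)
        · exact Or.inr ((hι _ _).1 h)
      by_contra hx
      have := K.card_le hS
      rw [Finset.card_insert_of_notMem hx, Φ.2.2] at this
      omega
  have hB : ∀ Ω : Flag P, ∃ Φ : K.Fac, ∀ p, p ∈ Ω ↔ p = bot ∨ p = top ∨ ∃ x ∈ Φ.1, ι x = p := by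
    intro Ω
    set C : Set N := {x | ι x ∈ Ω} with hC
    have hch : IsChain (· ≤ ·) C := by
      intro x hx y hy _
      rcases Ω.le_or_le hx hy with h | h
      · exact Or.inl ((hι _ _).1 h)
      · exact Or.inr ((hι _ _).1 h)
    have hfin : C.Finite := by
      refine Set.Finite.of_finite_image (f := K.rk) (Set.toFinite _) ?_
      intro x hx y hy h
      by_contra hne
      rcases hch hx hy hne with h1 | h1
      · exact (O.mono (lt_of_le_of_ne h1 hne)).ne h
      · exact (O.mono (lt_of_le_of_ne h1 (Ne.symm hne))).ne h.symm
    obtain ⟨Φ, hΦ⟩ : ∃ Φ : K.Fac, ∀ x ∈ C, x ∈ Φ.1 := by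
      by_cases hne : C.Nonempty
      · have hS : hfin.toFinset ∈ K.S := by
          rw [O.S_iff]
          refine ⟨by simpa using hne, ?_⟩
          rw [Set.Finite.coe_toFinset]
          exact hch
        obtain ⟨Φ, hΦ⟩ := K.exists_fac hS
        exact ⟨Φ, fun x hx => hΦ (by simpa using hx)⟩
      · obtain ⟨Φ⟩ := K.nonempty_fac
        exact ⟨Φ, fun x hx => absurd ⟨x, hx⟩ hne⟩
    obtain ⟨Ω', hΩ'⟩ := hA Φ
    refine ⟨Φ, fun p => ?_⟩
    have hsub : (Ω : Set P) ⊆ Ω' := by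
      intro p hp
      refine (hΩ' p).2 ?_
      rcases hP p with h | h | ⟨x, rfl⟩
      · exact Or.inl h
      · exact Or.inr (Or.inl h)
      · exact Or.inr (Or.inr ⟨x, hΦ x hp, rfl⟩)
    have he : (Ω : Set P) = Ω' := Ω.maxChain.2 Ω'.chain_le hsub
    rw [← hΩ' p]
    exact Set.ext_iff.1 he p
  have hmem : ∀ {Ω : Flag P} {Φ : K.Fac}, (∀ p, p ∈ Ω ↔ p = bot ∨ p = top ∨ ∃ x ∈ Φ.1, ι x = p) →
      ∀ x, ι x ∈ Ω ↔ x ∈ Φ.1 := by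
    intro Ω Φ h x
    rw [h]
    constructor
    · rintro (h | h | ⟨y, hy, e⟩)
      · exact absurd h (hιb x)
      · exact absurd h (hιt x)
      · rwa [← hinj _ _ e]
    · intro hx
      exact Or.inr (Or.inr ⟨x, hx, rfl⟩)
  -- restriction of automorphisms
  have hres : ∀ γ : P ≃o P, ∃ δ : N ≃o N, ∀ x, ι (δ x) = γ (ι x) := by
    have hex : ∀ γ : P ≃o P, ∀ x, ∃ y, ι y = γ (ι x) := by
      intro γ x
      rcases hP (γ (ι x)) with h | h | h
      · exfalso
        apply hιb x
        apply le_antisymm _ (hb _)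
        have : γ (ι x) ≤ γ bot := by rw [h]; exact hb _
        exact γ.le_iff_le.1 this
      · exfalso
        apply hιt x
        apply le_antisymm (ht _)
        have : γ top ≤ γ (ι x) := by rw [h]; exact ht _
        exact γ.le_iff_le.1 this
      · exact h
    intro γ
    choose f hf using hex γ
    choose f' hf' using hex γ.symm
    refine ⟨{ toFun := f, invFun := f', left_inv := ?_, right_inv := ?_, map_rel_iff' := ?_ }, hf⟩
    · intro x
      apply hinj
      rw [hf', hf, OrderIso.symm_apply_apply]
    · intro x
      apply hinj
      rw [hf, hf', OrderIso.apply_symm_apply]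
    · intro a b
      change f a ≤ f b ↔ a ≤ b
      rw [← hι, hf, hf, γ.le_iff_le, hι]
  -- extension of automorphisms
  have hext : ∀ δ : N ≃o N, ∃ γ : P ≃o P, γ bot = bot ∧ γ top = top ∧ ∀ x, γ (ι x) = ι (δ x) := by
    have hex : ∀ δ : N ≃o N, ∃ f : P → P, f bot = bot ∧ f top = top ∧ ∀ x, f (ι x) = ι (δ x) := by
      intro δ
      refine ⟨fun p => if h : ∃ x, ι x = p then ι (δ h.choose) else p, ?_, ?_, ?_⟩
      · refine dif_neg ?_
        rintro ⟨x, hx⟩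
        exact hιb x hx
      · refine dif_neg ?_
        rintro ⟨x, hx⟩
        exact hιt x hx
      · intro x
        have h : ∃ y, ι y = ι x := ⟨x, rfl⟩
        refine (dif_pos h).trans ?_
        rw [hinj _ _ h.choose_spec]
    have hmono : ∀ (δ : N ≃o N) (f : P → P), f bot = bot → f top = top →
        (∀ x, f (ι x) = ι (δ x)) → Monotone f := by
      intro δ f f1 f2 f3 p q hpq
      rcases hP p with rfl | rfl | ⟨x, rfl⟩
      · rw [f1]; exact hb _
      · rw [le_antisymm (ht q) hpq]
      · rcases hP q with rfl | rfl | ⟨y, rfl⟩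
        · rw [le_antisymm hpq (hb _)]
        · rw [f2]; exact ht _
        · rw [f3, f3, hι, δ.le_iff_le, ← hι]; exact hpq
    intro δ
    obtain ⟨f, f1, f2, f3⟩ := hex δ
    obtain ⟨f', f1', f2', f3'⟩ := hex δ.symm
    have i1 : ∀ p, f' (f p) = p := by
      intro p
      rcases hP p with rfl | rfl | ⟨x, rfl⟩
      · rw [f1, f1']
      · rw [f2, f2']
      · rw [f3, f3', OrderIso.symm_apply_apply]
    have i2 : ∀ p, f (f' p) = p := by
      intro p
      rcases hP p with rfl | rfl | ⟨x, rfl⟩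
      · rw [f1', f1]
      · rw [f2', f2]
      · rw [f3', f3, OrderIso.apply_symm_apply]
    have m1 := hmono δ f f1 f2 f3
    have m2 := hmono δ.symm f' f1' f2' f3'
    refine ⟨{ toFun := f, invFun := f', left_inv := i1, right_inv := i2, map_rel_iff' := ?_ },
      f1, f2, f3⟩
    intro a b
    constructor
    · intro h
      have := m2 h
      change f' (f a) ≤ f' (f b) at this
      rwa [i1, i1] at this
    · intro h
      exact m1 h
  obtain ⟨Ω₁, Ω₂, hno, hall⟩ := h2
  obtain ⟨Φ₁, hΦ₁⟩ := hB Ω₁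
  obtain ⟨Φ₂, hΦ₂⟩ := hB Ω₂
  have hto : ∀ {Ω Ω' : Flag P} {Φ Φ' : K.Fac}, (∀ x, ι x ∈ Ω ↔ x ∈ Φ.1) →
      (∀ x, ι x ∈ Ω' ↔ x ∈ Φ'.1) → SameFlagOrbit Ω Ω' → Orb K Φ Φ' := by
    rintro Ω Ω' Φ Φ' h h' ⟨γ, hγ⟩
    obtain ⟨δ, hδ⟩ := hres γ
    refine ⟨δ, fun v hv => ?_⟩
    rw [← h', hδ]
    have : γ (ι v) ∈ γ '' (Ω : Set P) := ⟨_, (h v).2 hv, rfl⟩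
    rw [hγ] at this
    exact this
  refine ⟨Φ₁, Φ₂, ?_, ?_⟩
  · rintro ⟨δ, hδ⟩
    obtain ⟨γ, g1, g2, g3⟩ := hext δ
    apply hno
    refine ⟨γ, ?_⟩
    refine (Flag.map γ Ω₁).maxChain.2 Ω₂.chain_le ?_
    rintro _ ⟨p, hp, rfl⟩
    refine (hΦ₂ _).2 ?_
    rcases (hΦ₁ p).1 hp with rfl | rfl | ⟨x, hx, rfl⟩
    · exact Or.inl g1
    · exact Or.inr (Or.inl g2)
    · exact Or.inr (Or.inr ⟨δ x, hδ x hx, (g3 x).symm⟩)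
  · intro Φ
    obtain ⟨Ω, hΩ⟩ := hA Φ
    rcases hall Ω with h | h
    · exact Or.inl (hto (hmem hΩ) (hmem hΦ₁) h)
    · exact Or.inr (hto (hmem hΩ) (hmem hΦ₂) h)

end Tri.Ord

namespace Geo

variable {d : ℕ} {T : Set (Set (EucSp d))}

lemma tri_ord (hT : IsLFCTiling T) (hd : 0 < d) : (tri hT hd).Ord where
  S_iff := fun C => Iff.rfl
  mono := fun F G h => Fin.lt_def.2 (NF.dim_lt hT h)
  meet := by
    intro a b b' h h'
    obtain ⟨t, ht, hb⟩ := b.2.2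
    obtain ⟨s, hs, hb'⟩ := b'.2.2
    refine ⟨⟨b.1 ∩ b'.1, a.2.1.mono (Set.subset_inter h h'), t, ht, face_inter hT ht hs hb hb'⟩,
      Set.inter_subset_left, Set.inter_subset_right, fun c h1 h2 => Set.subset_inter h1 h2⟩

lemma two (hT : IsLFCTiling T) (hd : 0 < d) (h2 : TwoFlagOrbits (TPoset T)) :
    ∃ Φ₀ Ψ₀ : (tri hT hd).Fac, ¬ Tri.Ord.Orb _ Φ₀ Ψ₀ ∧
      ∀ Ω, Tri.Ord.Orb _ Ω Φ₀ ∨ Tri.Ord.Orb _ Ω Ψ₀ := by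
  obtain ⟨F, -⟩ := exists_NF hT 0
  obtain ⟨t, ht, -⟩ := F.2.2
  let bot : TFace T := ⟨∅, t, ht, isExposed_empty⟩
  have hbot : ∀ F : TFace T, bot ≤ F := fun F => Set.empty_subset F.1
  let e : NF T → TFace T := fun x => ⟨x.1, x.2.2⟩
  refine (tri_ord hT hd).two_orb (P := TPoset T) (bot : WithTop (TFace T)) ⊤ ?_ (fun _ => le_top)
    (fun x => ((e x : TFace T) : WithTop (TFace T))) ?_ ?_ (fun x => WithTop.coe_ne_top) ?_ h2
  · intro p
    induction p using WithTop.recTopCoe with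
    | top => exact le_top
    | coe F => exact WithTop.coe_le_coe.2 (hbot F)
  · intro x y
    rw [WithTop.coe_le_coe]
    exact Iff.rfl
  · intro x h
    have h1 := WithTop.coe_injective h
    have h3 : x.1 = ∅ := congrArg Subtype.val h1
    exact x.2.1.ne_empty h3
  · intro p
    induction p using WithTop.recTopCoe with
    | top => exact Or.inr (Or.inl rfl)
    | coe F =>
      rcases Set.eq_empty_or_nonempty F.1 with h | h
      · left
        have : F = bot := Subtype.ext h
        rw [this]
      · right; right
        exact ⟨⟨F.1, h, F.2⟩, rfl⟩

end Geo

/-- Combinatorially two-orbit LFC tilings of `ℝ^d` (`d ≥ 1`) only occur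
for `d = 2` or `d = 3`. -/
theorem two_orbit_tiling_dimension {d : ℕ} (hd : 1 ≤ d) (T : Set (Set (EucSp d)))
    (hT : IsLFCTiling T) (h2 : TwoFlagOrbits (TPoset T)) :
    d = 2 ∨ d = 3 := by
  obtain ⟨Φ, Ψ, h3, h4⟩ := Geo.two hT hd h2
  obtain ⟨Q⟩ := (Geo.tri_ord hT hd).final h3 h4
  by_contra hne
  exact Q.main (by omega)
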